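/- Let k be an algebraically closed field and let p be a prime number with p ≥ 5 and p ≠ char(k). If G is a subgroup of the Cremona group Cr_k = Aut_k(k(x,y)) which is isomorphic to (ℤ/p)^r for some natural number r, then r ≤ 2. -/

import Mathlib

/-- The field `k(x,y)` of rational functions in two variables over `k`. -/
noncomputable abbrev Kxy (k : Type*) [Field k] : Type _ :=
  FractionRing (MvPolynomial (Fin 2) k)

/-- A homogeneous ideal of a graded algebra whose graded pieces `A i` are subspaces of `K`. -/
@[ext]
structure HIdeal {k K ι : Type*} [Field k] [Field K] [Algebra k K] [AddCommMonoid ι]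
    (A : ι → Submodule k K) where
  carrier : ι → Submodule k K
  le : ∀ i, carrier i ≤ A i
  mul : ∀ i j a b, a ∈ A i → b ∈ carrier j → a * b ∈ carrier (i + j)

namespace HIdeal

section General

variable {k K ι : Type*} [Field k] [Field K] [Algebra k K] [AddCancelCommMonoid ι]
  {A : ι → Submodule k K}

instance : PartialOrder (HIdeal A) where
  le I J := ∀ i, I.carrier i ≤ J.carrier i
  le_refl I i := le_refl _
  le_trans I J L h1 h2 i := (h1 i).trans (h2 i)
  le_antisymm I J h1 h2 := HIdeal.ext (funext fun i => le_antisymm (h1 i) (h2 i))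

/-- The zero homogeneous ideal. -/
def zero (A : ι → Submodule k K) : HIdeal A where
  carrier _ := ⊥
  le _ := bot_le
  mul i j a b _ hb := by simp_all

/-- A homogeneous ideal is prime if it is proper and prime with respect to homogeneous elements. -/
def Prime (P : HIdeal A) : Prop :=
  (∃ i, P.carrier i ≠ A i) ∧ ∀ i j a b, a ∈ A i → b ∈ A j → a * b ∈ P.carrier (i + j) →
    a ∈ P.carrier i ∨ b ∈ P.carrier j

/-- The colon ideal `I : x`. -/
def colon (hA : ∀ i j a b, a ∈ A i → b ∈ A j → a * b ∈ A (i + j)) (I : HIdeal A) (j : ι) (x : K) :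
    HIdeal A where
  carrier l := A l ⊓ (I.carrier (l + j)).comap (LinearMap.mulLeft k x)
  le l := inf_le_left
  mul i l a b ha hb := by
    refine ⟨hA _ _ _ _ ha hb.1, ?_⟩
    have h : a * (x * b) ∈ I.carrier (i + (l + j)) := I.mul i _ a _ ha hb.2
    change x * (a * b) ∈ I.carrier (i + l + j)
    rwa [mul_left_comm, add_assoc]

/-- The ideal generated by `I` and a homogeneous element `x`. -/
def adjoin (hA : ∀ i j a b, a ∈ A i → b ∈ A j → a * b ∈ A (i + j)) (I : HIdeal A) (j : ι) (x : K)
    (hx : x ∈ A j) : HIdeal A where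
  carrier i := I.carrier i ⊔ ⨆ l : {l // l + j = i}, (A l).map (LinearMap.mulLeft k x)
  le i := by
    refine sup_le (I.le i) (iSup_le ?_)
    rintro ⟨l, rfl⟩
    rintro _ ⟨a, ha, rfl⟩
    simp only [LinearMap.mulLeft_apply]
    rw [mul_comm]
    exact hA _ _ _ _ ha hx
  mul i i' a b ha hb := by
    have : I.carrier i' ⊔ ⨆ l : {l // l + j = i'}, (A l).map (LinearMap.mulLeft k x) ≤
      (I.carrier (i + i') ⊔ ⨆ l : {l // l + j = i + i'}, (A l).map (LinearMap.mulLeft k x)).comap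
        (LinearMap.mulLeft k a) := by
      refine sup_le (fun y hy => ?_) (iSup_le ?_)
      · exact Submodule.mem_sup_left (I.mul _ _ _ _ ha hy)
      · rintro ⟨l, rfl⟩ _ ⟨c, hc, rfl⟩
        refine Submodule.mem_sup_right ?_
        refine Submodule.mem_iSup_of_mem ⟨i + l, add_assoc _ _ _⟩ ?_
        refine ⟨a * c, hA _ _ _ _ ha hc, ?_⟩
        simp [mul_left_comm]
    exact this hb

variable (hA : ∀ i j a b, a ∈ A i → b ∈ A j → a * b ∈ A (i + j))

theorem le_colon (I : HIdeal A) (j : ι) (x : K) (hx : x ∈ A j) : I ≤ I.colon hA j x := by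
  intro l b hb
  refine ⟨I.le _ hb, ?_⟩
  change x * b ∈ I.carrier (l + j)
  rw [add_comm]
  exact I.mul _ _ _ _ hx hb

theorem le_adjoin (I : HIdeal A) (j : ι) (x : K) (hx : x ∈ A j) : I ≤ I.adjoin hA j x hx :=
  fun _ => le_sup_left

theorem mem_adjoin_self (h1 : (1 : K) ∈ A 0) (I : HIdeal A) (j : ι) (x : K) (hx : x ∈ A j) :
    x ∈ (I.adjoin hA j x hx).carrier j := by
  refine Submodule.mem_sup_right (Submodule.mem_iSup_of_mem ⟨0, zero_add j⟩ ⟨1, h1, ?_⟩)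
  simp

theorem lt_adjoin (h1 : (1 : K) ∈ A 0) (I : HIdeal A) (j : ι) (x : K) (hx : x ∈ A j)
    (hxI : x ∉ I.carrier j) : I < I.adjoin hA j x hx := by
  refine lt_of_le_of_ne (le_adjoin hA I j x hx) fun h => hxI ?_
  rw [h]
  exact mem_adjoin_self hA h1 I j x hx

/-- The colength of `I` in degree `i`, as an integer. -/
noncomputable def colength (I : HIdeal A) (i : ι) : ℤ :=
  (Module.finrank k (A i) : ℤ) - Module.finrank k (I.carrier i)

theorem colength_add [∀ i, FiniteDimensional k (A i)] (I : HIdeal A) (j l : ι) (x : K)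
    (hx : x ∈ A j) (hx0 : x ≠ 0) :
    I.colength (l + j) = (I.colon hA j x).colength l + (I.adjoin hA j x hx).colength (l + j) := by
  have hinj : Function.Injective (LinearMap.mulLeft k x) := mul_right_injective₀ hx0
  have hfin : ∀ i, ∀ S : Submodule k K, S ≤ A i → FiniteDimensional k S := fun i S hS =>
    Submodule.finiteDimensional_of_le hS
  have had : (I.adjoin hA j x hx).carrier (l + j) =
      I.carrier (l + j) ⊔ (A l).map (LinearMap.mulLeft k x) := by
    refine le_antisymm (sup_le le_sup_left (iSup_le ?_)) (sup_le le_sup_left ?_)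
    · rintro ⟨l', hl'⟩
      obtain rfl := add_right_cancel hl'
      exact le_sup_right
    · exact le_sup_of_le_right (le_iSup_of_le ⟨l, rfl⟩ le_rfl)
  have hcol : ((I.colon hA j x).carrier l).map (LinearMap.mulLeft k x) =
      I.carrier (l + j) ⊓ (A l).map (LinearMap.mulLeft k x) := by
    ext y
    constructor
    · rintro ⟨a, ha, rfl⟩
      exact ⟨ha.2, ⟨a, ha.1, rfl⟩⟩
    · rintro ⟨hy, ⟨a, ha, rfl⟩⟩
      exact ⟨a, ⟨ha, hy⟩, rfl⟩
  have e1 : Module.finrank k ((A l).map (LinearMap.mulLeft k x)) = Module.finrank k (A l) :=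
    (LinearEquiv.finrank_eq (Submodule.equivMapOfInjective _ hinj _)).symm
  have e2 : Module.finrank k (((I.colon hA j x).carrier l).map (LinearMap.mulLeft k x)) =
      Module.finrank k ((I.colon hA j x).carrier l) :=
    (LinearEquiv.finrank_eq (Submodule.equivMapOfInjective _ hinj _)).symm
  have := hfin _ _ (I.le (l + j))
  have e3 := Submodule.finrank_sup_add_finrank_inf_eq (I.carrier (l + j))
    ((A l).map (LinearMap.mulLeft k x))
  rw [← hcol, ← had, e1, e2] at e3
  unfold colength
  omega

theorem Prime.colon_eq {P : HIdeal A} (hP : P.Prime) (j : ι) (x : K) (hx : x ∈ A j)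
    (hxP : x ∉ P.carrier j) : P.colon hA j x = P := by
  refine le_antisymm (fun l a ha => ?_) (le_colon hA P j x hx)
  have h : x * a ∈ P.carrier (l + j) := ha.2
  rw [add_comm] at h
  exact (hP.2 _ _ _ _ hx ha.1 h).resolve_left hxP

end General

section Ranks

variable {k K Λ : Type*} [Field k] [Field K] [Algebra k K] [AddCommGroup Λ]
  {A : ℕ × Λ → Submodule k K}

/-- The ideal contains all elements of large degree. -/
def Irr (P : HIdeal A) : Prop := ∃ n0, ∀ n, n0 ≤ n → ∀ ψ, P.carrier (n, ψ) = A (n, ψ)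

/-- The primes above `I` have coheight less than `e`, disregarding irrelevant primes. -/
def Coh : ℕ → HIdeal A → Prop
  | 0, I => ∀ P : HIdeal A, P.Prime → I ≤ P → P.Irr
  | e + 1, I => ∀ P : HIdeal A, P.Prime → I ≤ P → ∀ J, P < J → Coh e J

theorem Coh.mono {e : ℕ} {I J : HIdeal A} (h : Coh e I) (hIJ : I ≤ J) : Coh e J := by
  cases e with
  | zero => exact fun P hP hJ => h P hP (hIJ.trans hJ)
  | succ e => exact fun P hP hJ => h P hP (hIJ.trans hJ)

theorem colength_eq_zero {I : HIdeal A} {i : ℕ × Λ} (h : I.carrier i = A i) :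
    I.colength i = 0 := by
  unfold colength
  rw [h, sub_self]

/-- The colengths of `I` in large degrees are orthogonal to the functions in the class `T`. -/
def Orth {p : ℕ} [Fintype Λ] (T : (Λ → ZMod p) → Prop) (I : HIdeal A) : Prop :=
  ∃ N0, ∀ N, N0 ≤ N → ∀ q, T q → ∑ ψ, ((I.colength (N, ψ) : ℤ) : ZMod p) * q ψ = 0

theorem Orth.of_irr {p : ℕ} [Fintype Λ] {T : (Λ → ZMod p) → Prop} {I : HIdeal A}
    (hI : I.Irr) : Orth T I := by
  obtain ⟨n0, hn0⟩ := hI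
  refine ⟨n0, fun N hN q _ => Finset.sum_eq_zero fun ψ _ => ?_⟩
  rw [colength_eq_zero (hn0 N hN ψ)]
  simp

theorem Orth.of_colon_adjoin {p : ℕ} [Fintype Λ]
    (hA : ∀ i j a b, a ∈ A i → b ∈ A j → a * b ∈ A (i + j))
    [∀ i, FiniteDimensional k (A i)] {T : (Λ → ZMod p) → Prop}
    (htrans : ∀ q χ, T q → T (fun ψ => q (ψ + χ))) {I : HIdeal A} (m : ℕ) (α : Λ) (x : K)
    (hx : x ∈ A (m, α)) (hx0 : x ≠ 0) (h1 : Orth T (I.colon hA (m, α) x))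
    (h2 : Orth T (I.adjoin hA (m, α) x hx)) : Orth T I := by
  obtain ⟨N1, h1⟩ := h1
  obtain ⟨N2, h2⟩ := h2
  refine ⟨max (N1 + m) N2, fun N hN q hq => ?_⟩
  obtain ⟨n, rfl⟩ : ∃ n, N = n + m := ⟨N - m, by omega⟩
  have e : ∀ ψ, I.colength (n + m, ψ) = (I.colon hA (m, α) x).colength (n, ψ - α) +
      (I.adjoin hA (m, α) x hx).colength (n + m, ψ) := by
    intro ψ
    have := colength_add hA I (m, α) (n, ψ - α) x hx hx0
    simpa using this
  simp_rw [e, Int.cast_add, add_mul, Finset.sum_add_distrib]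
  rw [h2 _ (by omega) q hq, add_zero, ← h1 n (by omega) _ (htrans q α hq)]
  rw [← Equiv.sum_comp (Equiv.addRight α)]
  simp

theorem orth_of_coh {p : ℕ} [Fintype Λ]
    (hA : ∀ i j a b, a ∈ A i → b ∈ A j → a * b ∈ A (i + j)) (h1 : (1 : K) ∈ A 0)
    [∀ i, FiniteDimensional k (A i)] [WellFoundedGT (HIdeal A)]
    (hfix : ∀ P : HIdeal A, P.Prime → P.Irr ∨ ∃ m α χ a b, χ ≠ 0 ∧ a ∈ A (m, α) ∧
      a ∉ P.carrier (m, α) ∧ b ∈ A (m, α + χ) ∧ b ∉ P.carrier (m, α + χ))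
    (T : ℕ → (Λ → ZMod p) → Prop)
    (htrans : ∀ e q χ, T e q → T e (fun ψ => q (ψ + χ)))
    (hanti : ∀ e < 3, ∀ q χ, χ ≠ 0 → T (e + 1) q → ∃ Q, T e Q ∧ ∀ ψ, Q (ψ + χ) - Q ψ = q ψ)
    (e : ℕ) (he : e ≤ 3) (I : HIdeal A) (hI : Coh e I) : Orth (T e) I := by
  induction e generalizing I with
  | zero =>
    induction I using WellFoundedGT.induction with
    | ind I ih =>
    by_cases htop : ∀ i, I.carrier i = A i
    · exact Orth.of_irr ⟨0, fun n _ ψ => htop _⟩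
    by_cases hpr : I.Prime
    · exact Orth.of_irr (hI I hpr le_rfl)
    obtain ⟨i, j, a, b, ha, hb, hab, haI, hbI⟩ : ∃ i j a b, a ∈ A i ∧ b ∈ A j ∧
        a * b ∈ I.carrier (i + j) ∧ a ∉ I.carrier i ∧ b ∉ I.carrier j := by
      by_contra! h
      push Not at htop
      exact hpr ⟨htop, fun i j a b ha hb hab => or_iff_not_imp_left.2 (h i j a b ha hb hab)⟩
    have ha0 : a ≠ 0 := by
      rintro rfl
      exact haI (zero_mem _)
    have hlt : I < I.colon hA i a := by
      refine lt_of_le_of_ne (le_colon hA I i a ha) fun h => hbI ?_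
      rw [h]
      refine ⟨hb, ?_⟩
      change a * b ∈ I.carrier (j + i)
      rwa [add_comm]
    have hlt' := lt_adjoin hA h1 I i a ha haI
    exact Orth.of_colon_adjoin hA (htrans 0) i.1 i.2 a ha ha0 (ih _ hlt (hI.mono hlt.le))
      (ih _ hlt' (hI.mono hlt'.le))
  | succ e ihe =>
    induction I using WellFoundedGT.induction with
    | ind I ih =>
    by_cases htop : ∀ i, I.carrier i = A i
    · exact Orth.of_irr ⟨0, fun n _ ψ => htop _⟩
    by_cases hpr : I.Prime
    · obtain hirr | ⟨m, α, χ, a, b, hχ, ha, haI, hb, hbI⟩ := hfix I hpr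
      · exact Orth.of_irr hirr
      have ha0 : a ≠ 0 := by
        rintro rfl
        exact haI (zero_mem _)
      have hb0 : b ≠ 0 := by
        rintro rfl
        exact hbI (zero_mem _)
      obtain ⟨N1, hN1⟩ := ihe (by omega) (I.adjoin hA _ a ha)
        (hI I hpr le_rfl _ (lt_adjoin hA h1 I _ a ha haI))
      obtain ⟨N2, hN2⟩ := ihe (by omega) (I.adjoin hA _ b hb)
        (hI I hpr le_rfl _ (lt_adjoin hA h1 I _ b hb hbI))
      refine ⟨N1 + N2 + m, fun N hN q hq => ?_⟩
      obtain ⟨Q, hQ, hQq⟩ := hanti e (by omega) q χ hχ hq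
      obtain ⟨n, rfl⟩ : ∃ n, N = n + m := ⟨N - m, by omega⟩
      have e1 : ∀ ψ, I.colength (n + m, ψ) = I.colength (n, ψ - α) +
          (I.adjoin hA _ a ha).colength (n + m, ψ) := by
        intro ψ
        have := colength_add hA I (m, α) (n, ψ - α) a ha ha0
        rw [hpr.colon_eq hA _ a ha haI] at this
        simpa using this
      have e2 : ∀ ψ, I.colength (n + m, ψ + χ) = I.colength (n, ψ - α) +
          (I.adjoin hA _ b hb).colength (n + m, ψ + χ) := by
        intro ψ
        have := colength_add hA I (m, α + χ) (n, ψ - α) b hb hb0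
        rw [hpr.colon_eq hA _ b hb hbI] at this
        simpa [← add_assoc] using this
      have z1 := hN1 (n + m) (by omega) _ (htrans e Q χ hQ)
      have z2 := hN2 (n + m) (by omega) Q hQ
      rw [← Equiv.sum_comp (Equiv.addRight χ)] at z2
      have t : ∑ ψ, ((I.colength (n + m, ψ) : ℤ) : ZMod p) * Q ψ =
          ∑ ψ, ((I.colength (n + m, ψ + χ) : ℤ) : ZMod p) * Q (ψ + χ) := by
        rw [← Equiv.sum_comp (Equiv.addRight χ)]
        rfl
      calc ∑ ψ, ((I.colength (n + m, ψ) : ℤ) : ZMod p) * q ψ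
          = ∑ ψ, ((I.colength (n + m, ψ) : ℤ) : ZMod p) * Q (ψ + χ) -
            ∑ ψ, ((I.colength (n + m, ψ) : ℤ) : ZMod p) * Q ψ := by
            rw [← Finset.sum_sub_distrib]
            exact Finset.sum_congr rfl fun ψ _ => by rw [← hQq]; ring
        _ = ∑ ψ, (((I.adjoin hA _ a ha).colength (n + m, ψ) : ℤ) : ZMod p) * Q (ψ + χ) -
            ∑ ψ, (((I.adjoin hA _ b hb).colength (n + m, ψ + χ) : ℤ) : ZMod p) * Q (ψ + χ) := by
            rw [t, ← Finset.sum_sub_distrib, ← Finset.sum_sub_distrib]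
            exact Finset.sum_congr rfl fun ψ _ => by rw [e1, e2]; push_cast; ring
        _ = 0 := by
            rw [z1]
            simpa using z2
    obtain ⟨i, j, a, b, ha, hb, hab, haI, hbI⟩ : ∃ i j a b, a ∈ A i ∧ b ∈ A j ∧
        a * b ∈ I.carrier (i + j) ∧ a ∉ I.carrier i ∧ b ∉ I.carrier j := by
      by_contra! h
      push Not at htop
      exact hpr ⟨htop, fun i j a b ha hb hab => or_iff_not_imp_left.2 (h i j a b ha hb hab)⟩
    have ha0 : a ≠ 0 := by
      rintro rfl
      exact haI (zero_mem _)
    have hlt : I < I.colon hA i a := by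
      refine lt_of_le_of_ne (le_colon hA I i a ha) fun h => hbI ?_
      rw [h]
      refine ⟨hb, ?_⟩
      change a * b ∈ I.carrier (j + i)
      rwa [add_comm]
    have hlt' := lt_adjoin hA h1 I i a ha haI
    exact Orth.of_colon_adjoin hA (htrans _) i.1 i.2 a ha ha0 (ih _ hlt (hI.mono hlt.le))
      (ih _ hlt' (hI.mono hlt'.le))

end Ranks

end HIdeal

namespace HIdeal

/-- Vanishing of iterated differences: `3` constants, `2` affine functions, `1` quadratic
functions, `0` all functions. -/
def DiffTest {p r : ℕ} : ℕ → ((Fin r → ZMod p) → ZMod p) → Prop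
  | 0, _ => True
  | 1, q => ∀ a b c ψ, q (ψ + a + b + c) - q (ψ + a + b) - q (ψ + a + c) - q (ψ + b + c)
      + q (ψ + a) + q (ψ + b) + q (ψ + c) - q ψ = 0
  | 2, q => ∀ a b ψ, q (ψ + a + b) - q (ψ + a) - q (ψ + b) + q ψ = 0
  | _ + 3, q => ∀ a ψ, q (ψ + a) = q ψ

theorem DiffTest.translate {p r : ℕ} (e : ℕ) (q : (Fin r → ZMod p) → ZMod p) (χ : Fin r → ZMod p)
    (h : DiffTest e q) : DiffTest e (fun ψ => q (ψ + χ)) := by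
  match e, h with
  | 0, _ => trivial
  | 1, h =>
    intro a b c ψ
    rw [← h a b c (ψ + χ)]
    simp only [add_right_comm _ χ]
  | 2, h =>
    intro a b ψ
    rw [← h a b (ψ + χ)]
    simp only [add_right_comm _ χ]
  | _ + 3, h =>
    intro a ψ
    change q (ψ + a + χ) = q (ψ + χ)
    rw [← h a (ψ + χ), add_right_comm]

theorem DiffTest.antiderivative {p r : ℕ} [Fact p.Prime] (hp5 : 5 ≤ p) (e : ℕ) (he : e < 3)
    (q : (Fin r → ZMod p) → ZMod p) (χ : Fin r → ZMod p) (hχ : χ ≠ 0) (h : DiffTest (e + 1) q) :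
    ∃ Q, DiffTest e Q ∧ ∀ ψ, Q (ψ + χ) - Q ψ = q ψ := by
  obtain ⟨i, hi⟩ : ∃ i, χ i ≠ 0 := by
    by_contra! hc
    exact hχ (funext hc)
  have h2 : (2 : ZMod p) ≠ 0 := by
    intro h
    have : ((2 : ℕ) : ZMod p) = 0 := by exact_mod_cast h
    rw [ZMod.natCast_eq_zero_iff] at this
    exact absurd (Nat.le_of_dvd (by norm_num) this) (by omega)
  have h3 : (3 : ZMod p) ≠ 0 := by
    intro h
    have : ((3 : ℕ) : ZMod p) = 0 := by exact_mod_cast h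
    rw [ZMod.natCast_eq_zero_iff] at this
    exact absurd (Nat.le_of_dvd (by norm_num) this) (by omega)
  obtain ⟨l, hl, hlχ⟩ : ∃ l : (Fin r → ZMod p) → ZMod p, (∀ a b, l (a + b) = l a + l b) ∧
      l χ = 1 := by
    refine ⟨fun ψ => ψ i * (χ i)⁻¹, fun a b => by simp [add_mul], ?_⟩
    simp [hi]
  have e23 : (2 : ZMod p) * 2⁻¹ = 1 := mul_inv_cancel₀ h2
  have e33 : (3 : ZMod p) * 3⁻¹ = 1 := mul_inv_cancel₀ h3
  match e, he, h with
  | 0, _, h =>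
    refine ⟨fun ψ => l ψ * q ψ - l ψ * (l ψ + 1) * 2⁻¹ * (q (ψ + χ) - q ψ) +
      l ψ * (l ψ + 1) * (l ψ + 2) * (2⁻¹ * 3⁻¹) * (q (ψ + χ + χ) - 2 * q (ψ + χ) + q ψ),
      trivial, fun ψ => ?_⟩
    have h' := h χ χ χ ψ
    simp only [hl, hlχ]
    field_simp
    linear_combination (l ψ + 1) * (l ψ + 2) * (l ψ + 3) * h'
  | 1, _, h =>
    obtain ⟨q0, L, hL, hq⟩ : ∃ q0, ∃ L : (Fin r → ZMod p) → ZMod p,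
        (∀ a b, L (a + b) = L a + L b) ∧ ∀ ψ, q ψ = q0 + L ψ := by
      refine ⟨q 0, fun ψ => q ψ - q 0, fun a b => ?_, fun ψ => by ring⟩
      have := h a b 0
      simp only [zero_add] at this
      linear_combination this
    refine ⟨fun ψ => l ψ * q ψ - l ψ * (l ψ + 1) * 2⁻¹ * (q (ψ + χ) - q ψ), ?_, fun ψ => ?_⟩
    · intro a b c ψ
      simp only [hq, hl, hL]
      ring
    · simp only [hq, hl, hL, hlχ]
      field_simp
      ring
  | 2, _, h =>
    refine ⟨fun ψ => l ψ * q ψ, ?_, fun ψ => ?_⟩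
    · intro a b ψ
      have h1 := fun ψ a => h a ψ
      simp only [h1, hl]
      ring
    · have h1 : q (ψ + χ) = q ψ := h χ ψ
      simp only [h1, hl, hlχ]
      ring

theorem dvd_sum_finrank {k K : Type*} [Field k] [Field K] [Algebra k K] {p r : ℕ} [Fact p.Prime]
    (hp5 : 5 ≤ p) {A : ℕ × (Fin r → ZMod p) → Submodule k K}
    (hA : ∀ i j a b, a ∈ A i → b ∈ A j → a * b ∈ A (i + j)) (h1 : (1 : K) ∈ A 0)
    [∀ i, FiniteDimensional k (A i)] [WellFoundedGT (HIdeal A)]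
    (hfix : ∀ P : HIdeal A, P.Prime → P.Irr ∨ ∃ m α χ a b, χ ≠ 0 ∧ a ∈ A (m, α) ∧
      a ∉ P.carrier (m, α) ∧ b ∈ A (m, α + χ) ∧ b ∉ P.carrier (m, α + χ))
    (hcoh : Coh 3 (zero A)) :
    ∃ N0, ∀ N, N0 ≤ N → p ∣ ∑ ψ, Module.finrank k (A (N, ψ)) := by
  obtain ⟨N0, hN0⟩ := orth_of_coh hA h1 hfix DiffTest DiffTest.translate
    (fun e he q χ => DiffTest.antiderivative hp5 e he q χ) 3 le_rfl _ hcoh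
  refine ⟨N0, fun N hN => ?_⟩
  have h := hN0 N hN (fun _ => 1) (fun _ _ => rfl)
  have e : ∀ i, (zero A).colength i = Module.finrank k (A i) := fun i => by
    change (Module.finrank k (A i) : ℤ) - Module.finrank k (⊥ : Submodule k K) = _
    rw [finrank_bot, Nat.cast_zero, sub_zero]
  rw [← ZMod.natCast_eq_zero_iff]
  simpa [e] using h

end HIdeal

section RelLength

variable {k M : Type*} [Field k] [AddCommGroup M] [Module k M]

/-- The length of `N / (I ∩ N)`. -/
noncomputable def relLength (I N : Submodule k M) : ℕ∞ := Module.length k (N ⧸ I.submoduleOf N)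

theorem relLength_inf (I N : Submodule k M) : relLength (N ⊓ I) N = relLength I N := by
  have : (N ⊓ I).submoduleOf N = I.submoduleOf N := by
    ext x
    simp [Submodule.submoduleOf]
  unfold relLength
  rw [this]

theorem relLength_sup (I N : Submodule k M) : relLength I (N ⊔ I) = relLength I N := by
  rw [← relLength_inf I N]
  exact (LinearMap.quotientInfEquivSupQuotient N I).length_eq.symm

theorem relLength_self (I : Submodule k M) : relLength I I = 0 := by
  have : I.submoduleOf I = ⊤ := Submodule.submoduleOf_self I
  unfold relLength
  rw [this]
  exact Module.length_eq_zero

theorem relLength_add {I J N : Submodule k M} (h1 : I ≤ J) (h2 : J ≤ N) :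
    relLength I N = relLength I J + relLength J N := by
  let f : (J ⧸ I.submoduleOf J) →ₗ[k] (N ⧸ I.submoduleOf N) :=
    Submodule.mapQ _ _ (Submodule.inclusion h2) (fun x hx => hx)
  let g : (N ⧸ I.submoduleOf N) →ₗ[k] (N ⧸ J.submoduleOf N) :=
    Submodule.mapQ _ _ LinearMap.id (fun x hx => h1 hx)
  have hf : Function.Injective f := by
    rw [injective_iff_map_eq_zero]
    intro z hz
    obtain ⟨z, rfl⟩ := Submodule.Quotient.mk_surjective _ z
    have e : f (Submodule.Quotient.mk z) = Submodule.Quotient.mk (Submodule.inclusion h2 z) := rfl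
    rw [e, Submodule.Quotient.mk_eq_zero] at hz
    exact (Submodule.Quotient.mk_eq_zero _).2 hz
  have hg : Function.Surjective g := by
    intro y
    obtain ⟨x, rfl⟩ := Submodule.Quotient.mk_surjective _ y
    exact ⟨Submodule.Quotient.mk x, rfl⟩
  refine Module.length_eq_add_of_exact f g hf hg fun y => ?_
  obtain ⟨x, rfl⟩ := Submodule.Quotient.mk_surjective _ y
  have e : g (Submodule.Quotient.mk x) = Submodule.Quotient.mk x := rfl
  rw [e, Submodule.Quotient.mk_eq_zero]
  constructor
  · intro hx
    exact ⟨Submodule.Quotient.mk ⟨x, hx⟩, rfl⟩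
  · rintro ⟨z, hz⟩
    obtain ⟨z, rfl⟩ := Submodule.Quotient.mk_surjective _ z
    have e : f (Submodule.Quotient.mk z) = Submodule.Quotient.mk (Submodule.inclusion h2 z) := rfl
    rw [e, Submodule.Quotient.eq] at hz
    have : (z : M) - x ∈ I := hz
    have h3 := J.sub_mem z.2 (h1 this)
    rwa [sub_sub_cancel] at h3

theorem relLength_anti {I J N : Submodule k M} (h1 : I ≤ J) (h2 : J ≤ N) :
    relLength J N ≤ relLength I N := by
  rw [relLength_add h1 h2]
  exact le_add_self

theorem relLength_map {M' : Type*} [AddCommGroup M'] [Module k M'] (f : M →ₗ[k] M')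
    (hf : Function.Injective f) (I N : Submodule k M) :
    relLength (I.map f) (N.map f) = relLength I N := by
  refine (LinearEquiv.length_eq (Submodule.Quotient.equiv _ _
    (Submodule.equivMapOfInjective f hf N) ?_)).symm
  ext ⟨y, hy⟩
  obtain ⟨x, hx, rfl⟩ := hy
  constructor
  · rintro ⟨z, hz, hzx⟩
    have : f z = f x := congrArg Subtype.val hzx
    exact ⟨z, hz, this⟩
  · rintro ⟨z, hz, hzx⟩
    obtain rfl := hf hzx
    exact ⟨⟨z, hx⟩, hz, rfl⟩

theorem LinearIndependent.span_image_inf {ι : Type*} {e : ι → M} (he : LinearIndependent k e)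
    (s t : Set ι) :
    Submodule.span k (e '' s) ⊓ Submodule.span k (e '' t) = Submodule.span k (e '' (s ∩ t)) := by
  simp only [Finsupp.span_image_eq_map_linearCombination, Finsupp.supported_inter]
  rw [Submodule.map_inf]
  exact he

theorem relLength_bot (N : Submodule k M) : relLength ⊥ N = Module.length k N := by
  have : (⊥ : Submodule k M).submoduleOf N = ⊥ := by
    ext x
    simp [Submodule.submoduleOf]
  unfold relLength
  rw [this]
  exact (Submodule.quotEquivOfEqBot _ rfl).length_eq

theorem LinearIndependent.relLength_span {ι : Type*} {e : ι → M} (he : LinearIndependent k e)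
    (s : Finset ι) (t : Set ι) (hst : Disjoint (s : Set ι) t) :
    relLength (Submodule.span k (e '' t)) (Submodule.span k (e '' (s ∪ t))) = s.card := by
  rw [Set.image_union, Submodule.span_union, relLength_sup, ← relLength_inf]
  rw [(he.disjoint_span_image hst).eq_bot, relLength_bot]
  have h : LinearIndependent k (fun x : s => e x) := he.comp _ Subtype.val_injective
  have e1 : Submodule.span k (e '' s) = Submodule.span k (Set.range fun x : s => e x) := by
    congr 1
    ext x
    simp
  rw [e1, (Module.Basis.span h).repr.length_eq, Module.length_finsupp]
  simp

end RelLength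

section VSpan

variable {k K : Type*} [Field k] [Field K] [Algebra k K]

/-- The set of products of elements of a valuation ring and of a subspace is closed under addition. -/
theorem ValuationSubring.exists_add_eq_mul (v : ValuationSubring K) {w1 w2 c1 c2 : K}
    (h1 : c1 ∈ v) (h2 : c2 ∈ v) :
    (∃ c ∈ v, c1 * w1 + c2 * w2 = c * w1) ∨ ∃ c ∈ v, c1 * w1 + c2 * w2 = c * w2 := by
  by_cases hw1 : w1 = 0
  · exact Or.inr ⟨c2, h2, by simp [hw1]⟩
  by_cases hw2 : w2 = 0
  · exact Or.inl ⟨c1, h1, by simp [hw2]⟩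
  rcases v.mem_or_inv_mem (w1 / w2) with h | h
  · refine Or.inr ⟨c1 * (w1 / w2) + c2, v.add_mem _ _ (v.mul_mem _ _ h1 h) h2, ?_⟩
    field_simp
  · rw [inv_div] at h
    refine Or.inl ⟨c1 + c2 * (w2 / w1), v.add_mem _ _ h1 (v.mul_mem _ _ h2 h), ?_⟩
    field_simp

/-- The integral closure of the subspace `W` over the subalgebra `S`: the elements that belong to
`W v` for every valuation ring `v` containing `S`. -/
def intClosure (S : Subalgebra k K) (W : Submodule k K) : Submodule k K where
  carrier := {b | ∀ v : ValuationSubring K, (∀ x ∈ S, x ∈ v) → ∃ w ∈ W, ∃ c ∈ v, b = c * w}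
  zero_mem' v _ := ⟨0, W.zero_mem, 0, v.zero_mem, by simp⟩
  add_mem' := by
    intro a b ha hb v hv
    obtain ⟨w1, hw1, c1, hc1, rfl⟩ := ha v hv
    obtain ⟨w2, hw2, c2, hc2, rfl⟩ := hb v hv
    rcases v.exists_add_eq_mul (w1 := w1) (w2 := w2) hc1 hc2 with ⟨c, hc, h⟩ | ⟨c, hc, h⟩
    · exact ⟨w1, hw1, c, hc, h⟩
    · exact ⟨w2, hw2, c, hc, h⟩
  smul_mem' := by
    intro r a ha v hv
    obtain ⟨w1, hw1, c1, hc1, rfl⟩ := ha v hv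
    exact ⟨r • w1, W.smul_mem r hw1, c1, hc1, by simp⟩

theorem le_intClosure (S : Subalgebra k K) (W : Submodule k K) : W ≤ intClosure S W :=
  fun w hw v _ => ⟨w, hw, 1, v.one_mem, by simp⟩

theorem subalgebra_mul_le_intClosure (S : Subalgebra k K) (W : Submodule k K) :
    Subalgebra.toSubmodule S * W ≤ intClosure S W := by
  rw [Submodule.mul_le]
  exact fun c hc w hw v hv => ⟨w, hw, c, hv c hc, rfl⟩

/-- A sum of multiples of elements of `W` by elements of a valuation ring is such a multiple. -/
theorem ValuationSubring.exists_of_mem_mul {v : ValuationSubring K} {S : Subalgebra k K}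
    (hv : ∀ x ∈ S, x ∈ v) {W : Submodule k K} {b : K} (hb : b ∈ Subalgebra.toSubmodule S * W) :
    ∃ w ∈ W, ∃ c ∈ v, b = c * w :=
  subalgebra_mul_le_intClosure S W hb v hv

end VSpan

section Plane

variable {k K : Type*} [Field k] [Field K] [Algebra k K]

theorem exists_valuationSubring_of_algHom (S : Subalgebra k K) (g : S →ₐ[k] k) :
    ∃ v : ValuationSubring K, (∀ x ∈ S, x ∈ v) ∧ (∀ x : S, g x = 0 → v.valuation x < 1) ∧
      ∀ x : S, g x ≠ 0 → v.valuation x = 1 := by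
  obtain ⟨v, hv, hI⟩ := Ideal.image_subset_nonunits_valuationSubring (A := S.toSubring)
    (RingHom.ker g.toRingHom : Ideal S) (RingHom.ker_ne_top _)
  have h0 : ∀ x : S, g x = 0 → v.valuation x < 1 := fun x hx =>
    (v.mem_nonunits_iff).1 (hI ⟨x, hx, rfl⟩)
  refine ⟨v, fun x hx => hv hx, h0, fun x hx => ?_⟩
  refine le_antisymm ((v.valuation_le_one_iff _).2 (hv x.2)) (not_lt.1 fun hlt => ?_)
  have h1 : v.valuation ((algebraMap k S (g x) - x : S) : K) < 1 := h0 _ (by simp)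
  have h2 : v.valuation (algebraMap k K (g x)) < 1 := by
    have e : algebraMap k K (g x) = ((algebraMap k S (g x) - x : S) : K) + x := by simp
    rw [e]
    exact (v.valuation.map_add _ _).trans_lt (max_lt h1 hlt)
  have h3 : v.valuation (algebraMap k K (g x)⁻¹) ≤ 1 :=
    (v.valuation_le_one_iff _).2 (hv (S.algebraMap_mem _))
  have h4 : v.valuation (algebraMap k K (g x) * algebraMap k K (g x)⁻¹) < 1 := by
    rw [map_mul]
    exact mul_lt_one_of_lt_of_le h2 h3
  rw [← map_mul, mul_inv_cancel₀ hx, map_one, map_one] at h4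
  exact lt_irrefl _ h4

/-- The monomials in `s` and `t` are linearly independent. -/
def MonIndep (k : Type*) {K : Type*} [Field k] [Field K] [Algebra k K] (s t : K) : Prop :=
  LinearIndependent k (fun i : ℕ × ℕ => s ^ i.1 * t ^ i.2)

theorem toSubmodule_adjoin_pair (s t : K) : Subalgebra.toSubmodule (Algebra.adjoin k {s, t}) =
    Submodule.span k (Set.range fun i : ℕ × ℕ => s ^ i.1 * t ^ i.2) := by
  rw [Algebra.adjoin_eq_span]
  congr 1
  ext z
  simp [Submonoid.mem_closure_pair]

theorem monIndep_iff (s t : K) : MonIndep k s t ↔ AlgebraicIndependent k ![s, t] := by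
  have e : ∀ m : Fin 2 →₀ ℕ, MvPolynomial.aeval ![s, t] (MvPolynomial.monomial m (1 : k)) =
      s ^ m 0 * t ^ m 1 := by
    intro m
    rw [MvPolynomial.aeval_monomial, map_one, one_mul, Finsupp.prod_fintype _ _ (by simp)]
    simp [Fin.prod_univ_two]
  let E : (Fin 2 →₀ ℕ) ≃ ℕ × ℕ := Finsupp.equivFunOnFinite.trans (finTwoArrowEquiv ℕ)
  have hfam : (fun i : ℕ × ℕ => s ^ i.1 * t ^ i.2) ∘ E =
      (MvPolynomial.aeval (R := k) ![s, t]).toLinearMap ∘ MvPolynomial.basisMonomials (Fin 2) k := by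
    funext m
    simp only [Function.comp_apply, MvPolynomial.coe_basisMonomials, AlgHom.toLinearMap_apply, e]
    rfl
  unfold MonIndep
  rw [← linearIndependent_equiv E, hfam, AlgebraicIndependent]
  constructor
  · intro h
    rw [injective_iff_map_eq_zero]
    intro f hf
    have := (linearIndependent_iff.1 h) ((MvPolynomial.basisMonomials (Fin 2) k).repr f) ?_
    · simpa using this
    · have e1 := (MvPolynomial.basisMonomials (Fin 2) k).linearCombination_repr f
      rw [← Finsupp.apply_linearCombination, e1]
      exact hf
  · intro h
    exact (MvPolynomial.basisMonomials (Fin 2) k).linearIndependent.map'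
      _ (LinearMap.ker_eq_bot.2 h)

theorem MonIndep.exists_algHom {s t : K} (h : MonIndep k s t) {B : Type*} [CommRing B]
    [Algebra k B] (x y : B) : ∃ g : Algebra.adjoin k {s, t} →ₐ[k] B,
      (∀ r : Algebra.adjoin k {s, t}, (r : K) = s → g r = x) ∧
      (∀ r : Algebra.adjoin k {s, t}, (r : K) = t → g r = y) := by
  have h' := (monIndep_iff s t).1 h
  have hr : Set.range ![s, t] = {s, t} := by
    ext z
    simp [eq_comm, or_comm]
  rw [← hr]
  refine ⟨(MvPolynomial.aeval ![x, y]).comp h'.aevalEquiv.symm.toAlgHom, ?_, ?_⟩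
  · intro r hr
    have : r = h'.aevalEquiv (MvPolynomial.X 0) := by
      apply Subtype.ext
      simp [hr]
    subst this
    simp
  · intro r hr
    have : r = h'.aevalEquiv (MvPolynomial.X 1) := by
      apply Subtype.ext
      simp [hr]
    subst this
    simp

theorem left_mem_adjoin_pair (s t : K) : s ∈ Algebra.adjoin k {s, t} :=
  Algebra.subset_adjoin (by simp)

theorem right_mem_adjoin_pair (s t : K) : t ∈ Algebra.adjoin k {s, t} :=
  Algebra.subset_adjoin (by simp)

open Polynomial in
theorem exists_eq_aeval_add (s t : K) {r : K} (hr : r ∈ Algebra.adjoin k {s, t}) :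
    ∃ P : k[X], ∃ r' ∈ Algebra.adjoin k {s, t}, r = aeval t P + s * r' := by
  induction hr using Algebra.adjoin_induction with
  | mem x hx =>
    rcases hx with rfl | rfl
    · exact ⟨0, 1, one_mem _, by simp⟩
    · exact ⟨X, 0, zero_mem _, by simp⟩
  | algebraMap c => exact ⟨C c, 0, zero_mem _, by simp⟩
  | add x y _ _ hx hy =>
    obtain ⟨P, a, ha, rfl⟩ := hx
    obtain ⟨Q, b, hb, rfl⟩ := hy
    exact ⟨P + Q, a + b, add_mem ha hb, by simp; ring⟩
  | mul x y _ hy' hx hy =>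
    obtain ⟨P, a, ha, rfl⟩ := hx
    obtain ⟨Q, b, hb, rfl⟩ := hy
    have ht : aeval t P ∈ Algebra.adjoin k {s, t} := by
      have := Polynomial.aeval_mem_adjoin_singleton k t (p := P)
      exact Algebra.adjoin_mono (by simp) this
    refine ⟨P * Q, aeval t P * b + a * (aeval t Q + s * b), ?_, by simp; ring⟩
    exact add_mem (mul_mem ht hb) (mul_mem ha hy')

open Polynomial in
theorem MonIndep.exists_restriction {s t : K} (h : MonIndep k s t) :
    ∃ ρ : Algebra.adjoin k {s, t} →ₐ[k] k[X],
      (∀ r : Algebra.adjoin k {s, t}, (r : K) = s → ρ r = 0) ∧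
      (∀ r : Algebra.adjoin k {s, t}, (r : K) = t → ρ r = X) ∧
      ∀ r, ρ r = 0 → ∃ r' ∈ Algebra.adjoin k {s, t}, (r : K) = s * r' := by
  obtain ⟨ρ, h1, h2⟩ := h.exists_algHom (0 : k[X]) X
  refine ⟨ρ, h1, h2, fun r hr => ?_⟩
  obtain ⟨P, r', hr', e⟩ := exists_eq_aeval_add s t r.2
  let s0 : Algebra.adjoin k {s, t} := ⟨s, left_mem_adjoin_pair s t⟩
  let t0 : Algebra.adjoin k {s, t} := ⟨t, right_mem_adjoin_pair s t⟩
  have e' : r = aeval t0 P + s0 * ⟨r', hr'⟩ := by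
    apply Subtype.ext
    rw [e]
    have e1 : ((aeval t0 P : Algebra.adjoin k {s, t}) : K) = aeval t P :=
      (Polynomial.aeval_algHom_apply (Algebra.adjoin k {s, t}).val t0 P).symm
    simp [s0, e1]
  rw [e', map_add, map_mul, h1 s0 rfl, zero_mul, add_zero, ← Polynomial.aeval_algHom_apply,
    h2 t0 rfl, aeval_X_left_apply] at hr
  exact ⟨r', hr', by rw [e, hr]; simp⟩

theorem MonIndep.ne_zero_left {s t : K} (h : MonIndep k s t) : s ≠ 0 := by
  rintro rfl
  exact h.ne_zero (1, 0) (by simp)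

theorem MonIndep.ne_zero_right {s t : K} (h : MonIndep k s t) : t ≠ 0 := by
  rintro rfl
  exact h.ne_zero (0, 1) (by simp)

theorem MonIndep.div {s t : K} (h : MonIndep k s t) : MonIndep k s (t / s) := by
  have hs := h.ne_zero_left
  unfold MonIndep
  rw [linearIndependent_iff_finset_linearIndependent]
  intro F
  obtain ⟨M, hM⟩ : ∃ M, ∀ i ∈ F, i.2 ≤ M := ⟨F.sup Prod.snd, fun i hi => Finset.le_sup hi⟩
  refine LinearIndependent.of_comp (LinearMap.mulLeft k (s ^ M)) ?_
  have e : LinearMap.mulLeft k (s ^ M) ∘ ((fun i : ℕ × ℕ => s ^ i.1 * (t / s) ^ i.2) ∘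
      (Subtype.val : F → ℕ × ℕ)) = (fun i : ℕ × ℕ => s ^ i.1 * t ^ i.2) ∘
        fun i : F => (i.1.1 + (M - i.1.2), i.1.2) := by
    funext ⟨⟨i, j⟩, hi⟩
    have := hM _ hi
    simp only at this
    simp only [Function.comp_apply, LinearMap.mulLeft_apply]
    obtain ⟨l, rfl⟩ := Nat.exists_eq_add_of_le this
    rw [show i + (j + l - j) = i + l by omega, div_pow, pow_add, pow_add]
    field_simp
  rw [e]
  refine h.comp _ ?_
  rintro ⟨⟨i, j⟩, hi⟩ ⟨⟨i', j'⟩, hi'⟩ he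
  simp only [Prod.mk.injEq] at he
  ext <;> simp <;> omega

end Plane

section BlowUp

variable {k K : Type*} [Field k] [Field K] [Algebra k K]

/-- The multiple `c W` of a subspace. -/
abbrev scale (c : K) (W : Submodule k K) : Submodule k K := W.map (LinearMap.mulLeft k c)

theorem mem_scale {c : K} {W : Submodule k K} {b : K} : b ∈ scale c W ↔ ∃ r ∈ W, c * r = b :=
  Iff.rfl

/-- The coordinate ring `k[s, t]` as a subspace. -/
abbrev planeRing (k : Type*) {K : Type*} [Field k] [Field K] [Algebra k K] (s t : K) :
    Submodule k K :=
  Subalgebra.toSubmodule (Algebra.adjoin k {s, t})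

theorem Subalgebra.toSubmodule_pow_le (S : Subalgebra k K) (n : ℕ) :
    Subalgebra.toSubmodule S ^ n ≤ Subalgebra.toSubmodule S := by
  induction n with
  | zero =>
    rw [pow_zero, Submodule.one_le]
    exact S.one_mem
  | succ n ih =>
    rw [pow_succ, Submodule.mul_le]
    exact fun a ha b hb => S.mul_mem (ih ha) hb

theorem adjoin_le_adjoin_div {s : K} (hs : s ≠ 0) (t : K) :
    Algebra.adjoin k {s, t} ≤ Algebra.adjoin k {s, t / s} := by
  rw [Algebra.adjoin_le_iff]
  rintro x (rfl | rfl)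
  · exact left_mem_adjoin_pair _ _
  · have := mul_mem (left_mem_adjoin_pair (k := k) s (x / s)) (right_mem_adjoin_pair s (x / s))
    rwa [mul_div_cancel₀ _ hs] at this

theorem planeRing_eq_span {s : K} (hs : s ≠ 0) (t : K) : planeRing k s t =
    Submodule.span k ((fun i : ℕ × ℕ => s ^ i.1 * (t / s) ^ i.2) '' {i | i.2 ≤ i.1}) := by
  rw [planeRing, toSubmodule_adjoin_pair]
  congr 1
  ext z
  constructor
  · rintro ⟨⟨i, j⟩, rfl⟩
    refine ⟨(i + j, j), by simp, ?_⟩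
    simp only [pow_add, div_pow]
    field_simp
  · rintro ⟨⟨i, j⟩, hij, rfl⟩
    obtain ⟨l, rfl⟩ := Nat.exists_eq_add_of_le (show j ≤ i from hij)
    refine ⟨(l, j), ?_⟩
    simp only [pow_add, div_pow]
    field_simp

theorem scale_planeRing_eq_span (s u : K) (N : ℕ) : scale (s ^ N) (planeRing k s u) =
    Submodule.span k ((fun i : ℕ × ℕ => s ^ i.1 * u ^ i.2) '' {i | N ≤ i.1}) := by
  rw [scale, planeRing, toSubmodule_adjoin_pair, Submodule.map_span]
  congr 1
  ext z
  constructor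
  · rintro ⟨_, ⟨⟨i, j⟩, rfl⟩, rfl⟩
    refine ⟨(N + i, j), by simp, ?_⟩
    simp [pow_add, mul_assoc]
  · rintro ⟨⟨i, j⟩, hij, rfl⟩
    obtain ⟨l, rfl⟩ := Nat.exists_eq_add_of_le (show N ≤ i from hij)
    refine ⟨_, ⟨(l, j), rfl⟩, ?_⟩
    simp [pow_add, mul_assoc]

theorem scale_left_planeRing_eq_span {s : K} (hs : s ≠ 0) (t : K) : scale s (planeRing k s t) =
    Submodule.span k ((fun i : ℕ × ℕ => s ^ i.1 * (t / s) ^ i.2) '' {i | i.2 < i.1}) := by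
  rw [scale, planeRing, toSubmodule_adjoin_pair, Submodule.map_span]
  congr 1
  ext z
  constructor
  · rintro ⟨_, ⟨⟨i, j⟩, rfl⟩, rfl⟩
    refine ⟨(i + j + 1, j), show j < i + j + 1 by omega, ?_⟩
    simp only [pow_add, div_pow, LinearMap.mulLeft_apply]
    field_simp
  · rintro ⟨⟨i, j⟩, hij, rfl⟩
    obtain ⟨l, rfl⟩ := Nat.exists_eq_add_of_lt (show j < i from hij)
    refine ⟨_, ⟨(l, j), rfl⟩, ?_⟩
    simp only [pow_add, div_pow, LinearMap.mulLeft_apply]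
    field_simp

/-- The `N`-th power of the maximal ideal `(s, t)`. -/
abbrev orderIdeal (k : Type*) {K : Type*} [Field k] [Field K] [Algebra k K] (s t : K) (N : ℕ) :
    Submodule k K :=
  planeRing k s t ⊓ scale (s ^ N) (planeRing k s (t / s))

theorem orderIdeal_eq_span {s t : K} (h : MonIndep k s t) (N : ℕ) : orderIdeal k s t N =
    Submodule.span k ((fun i : ℕ × ℕ => s ^ i.1 * (t / s) ^ i.2) '' {i | i.2 ≤ i.1 ∧ N ≤ i.1}) := by
  rw [orderIdeal, planeRing_eq_span h.ne_zero_left, scale_planeRing_eq_span]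
  exact LinearIndependent.span_image_inf h.div _ _

theorem relLength_orderIdeal {s t : K} (h : MonIndep k s t) (N : ℕ) :
    relLength (orderIdeal k s t N) (planeRing k s t) = ((∑ i ∈ Finset.range N, (i + 1) : ℕ) : ℕ∞) := by
  let F : Finset (ℕ × ℕ) := ((Finset.range N).sigma fun i => Finset.range (i + 1)).map
    ⟨fun x => (x.1, x.2), by rintro ⟨a, b⟩ ⟨c, d⟩ h; simp at h; simp [h.1, h.2]⟩
  have hF : ∀ i, i ∈ F ↔ i.1 < N ∧ i.2 ≤ i.1 := by
    rintro ⟨i, j⟩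
    simp only [F, Finset.mem_map, Finset.mem_sigma, Finset.mem_range]
    constructor
    · rintro ⟨⟨a, b⟩, h1, h2⟩
      have h3 : (a, b) = (i, j) := h2
      simp only [Prod.mk.injEq] at h3
      simp only at h1
      omega
    · rintro ⟨h1, h2⟩
      exact ⟨⟨i, j⟩, ⟨h1, by simp only; omega⟩, rfl⟩
  have hcard : F.card = ∑ i ∈ Finset.range N, (i + 1) := by
    simp [F]
  have hset : {i : ℕ × ℕ | i.2 ≤ i.1} = (F : Set (ℕ × ℕ)) ∪ {i | i.2 ≤ i.1 ∧ N ≤ i.1} := by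
    ext i
    simp only [Set.mem_ofPred_eq, Set.mem_union, Finset.mem_coe, hF]
    omega
  rw [orderIdeal_eq_span h, planeRing_eq_span h.ne_zero_left, hset, ← hcard]
  refine LinearIndependent.relLength_span h.div F _ ?_
  rw [Set.disjoint_left]
  intro i hi hi'
  have := (hF i).1 hi
  simp only [Set.mem_ofPred_eq] at hi'
  omega

theorem pow_le_scale {S : Subalgebra k K} {c : K} {a : Submodule k K}
    (ha : a ≤ scale c (Subalgebra.toSubmodule S)) (n : ℕ) :
    a ^ n ≤ scale (c ^ n) (Subalgebra.toSubmodule S) := by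
  induction n with
  | zero =>
    rw [pow_zero, Submodule.one_le]
    exact ⟨1, S.one_mem, by simp⟩
  | succ n ih =>
    rw [pow_succ, Submodule.mul_le]
    intro x hx y hy
    obtain ⟨x', hx', rfl⟩ := ih hx
    obtain ⟨y', hy', rfl⟩ := ha hy
    refine ⟨x' * y', S.mul_mem hx' hy', ?_⟩
    simp only [LinearMap.mulLeft_apply]
    ring

theorem mem_scale_of_mem_intClosure {s u : K} (h : MonIndep k s u) [Infinite k]
    {W : Submodule k K} {N : ℕ}
    (hW : W ≤ scale (s ^ N) (planeRing k s u)) {b : K} (hb : b ∈ planeRing k s u)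
    (hbW : b ∈ intClosure (Algebra.adjoin k {s, u}) W) :
    b ∈ scale (s ^ N) (planeRing k s u) := by
  have hs := h.ne_zero_left
  by_contra hcon
  obtain ⟨d, hd, hbd, hbd'⟩ : ∃ d < N, b ∈ scale (s ^ d) (planeRing k s u) ∧
      b ∉ scale (s ^ (d + 1)) (planeRing k s u) := by
    by_contra! hall
    refine hcon ?_
    have : ∀ d ≤ N, b ∈ scale (s ^ d) (planeRing k s u) := by
      intro d hd
      induction d with
      | zero => exact ⟨b, hb, by simp⟩
      | succ d ih => exact hall d (by omega) (ih (by omega))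
    exact this N le_rfl
  obtain ⟨w0, hu, rfl⟩ := hbd
  obtain ⟨ρ, hρs, -, hρ⟩ := h.exists_restriction
  have hu0 : ρ ⟨w0, hu⟩ ≠ 0 := by
    intro h0
    obtain ⟨r, hr, hur⟩ := hρ _ h0
    refine hbd' ⟨r, hr, ?_⟩
    simp only at hur
    simp only [LinearMap.mulLeft_apply, hur]
    ring
  obtain ⟨c, hc⟩ : ∃ c, (ρ ⟨w0, hu⟩).eval c ≠ 0 := by
    by_contra! hall
    exact hu0 (Polynomial.funext fun c => by simp [hall])
  obtain ⟨v, hv, hv0, hv1⟩ := exists_valuationSubring_of_algHom _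
    ((Polynomial.aeval c).comp ρ)
  obtain ⟨w, hw, e, he, hbe⟩ := hbW v hv
  obtain ⟨w', hw', rfl⟩ := hW hw
  obtain ⟨l, rfl⟩ := Nat.exists_eq_add_of_lt hd
  simp only [LinearMap.mulLeft_apply] at hbe
  have h1 : w0 = s * (s ^ l * e * w') := by
    have := pow_ne_zero d hs
    apply mul_left_cancel₀ this
    rw [hbe]
    ring
  have hvs : v.valuation s < 1 := hv0 ⟨s, left_mem_adjoin_pair _ _⟩ (by simp [hρs])
  have hvu : v.valuation w0 = 1 := hv1 ⟨w0, hu⟩ (by simpa [Polynomial.coe_aeval_eq_eval] using hc)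
  have hsv : s ∈ v := hv s (left_mem_adjoin_pair _ _)
  have h2 : v.valuation (s ^ l * e * w') ≤ 1 :=
    (v.valuation_le_one_iff _).2 (mul_mem (mul_mem (pow_mem hsv l) he) (hv _ hw'))
  rw [h1, map_mul] at hvu
  exact absurd hvu (mul_lt_one_of_lt_of_le hvs h2).ne

theorem scale_planeRing_le {s t : K} (h : MonIndep k s t) {N : ℕ} {G : Submodule k K}
    (hG : ∀ r ∈ planeRing k s (t / s), ∀ g ∈ G, r * g ∈ G) {f g : K} (hf : f ∈ G)
    (hfN : f ∈ scale (s ^ N) (planeRing k s (t / s))) (hg : g ∈ planeRing k s t)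
    (hfg : f = t ^ N - s * g) :
    scale (s ^ N) (planeRing k s (t / s)) ≤ orderIdeal k s t N ⊔ G := by
  have hs := h.ne_zero_left
  have htN : t ^ N = s ^ N * (t / s) ^ N := by
    rw [div_pow]
    field_simp
  have hsg : s * g ∈ Submodule.span k ((fun i : ℕ × ℕ => s ^ i.1 * (t / s) ^ i.2) ''
      ({i | i.2 < i.1} ∩ {i | N ≤ i.1})) := by
    rw [← LinearIndependent.span_image_inf h.div, ← scale_left_planeRing_eq_span hs,
      ← scale_planeRing_eq_span]
    refine ⟨⟨g, hg, rfl⟩, ?_⟩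
    have : s * g = t ^ N - f := by rw [hfg]; ring
    rw [this]
    refine Submodule.sub_mem _ ?_ hfN
    rw [htN]
    exact ⟨_, pow_mem (right_mem_adjoin_pair _ _) N, rfl⟩
  have key : ∀ l D j, N ≤ D → j ≤ D + l → s ^ D * (t / s) ^ j ∈ orderIdeal k s t N ⊔ G := by
    intro l
    induction l with
    | zero =>
      intro D j hD hj
      refine Submodule.mem_sup_left ?_
      rw [orderIdeal_eq_span h]
      exact Submodule.subset_span ⟨(D, j), ⟨hj, hD⟩, rfl⟩
    | succ l ih =>
      intro D j hD hj
      by_cases hj' : j ≤ D + l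
      · exact ih D j hD hj'
      obtain ⟨D, rfl⟩ := Nat.exists_eq_add_of_le hD
      obtain ⟨j, rfl⟩ := Nat.exists_eq_add_of_le (show N ≤ j by omega)
      have e : s ^ (N + D) * (t / s) ^ (N + j) =
          (s ^ D * (t / s) ^ j) * f + (s ^ D * (t / s) ^ j) * (s * g) := by
        rw [hfg, htN]
        ring
      rw [e]
      refine Submodule.add_mem _ (Submodule.mem_sup_right (hG _ ?_ _ hf)) ?_
      · exact Subalgebra.mul_mem _ (pow_mem (left_mem_adjoin_pair _ _) _)
          (pow_mem (right_mem_adjoin_pair _ _) _)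
      · have : Submodule.span k ((fun i : ℕ × ℕ => s ^ i.1 * (t / s) ^ i.2) ''
            ({i | i.2 < i.1} ∩ {i | N ≤ i.1})) ≤
            (orderIdeal k s t N ⊔ G).comap (LinearMap.mulLeft k (s ^ D * (t / s) ^ j)) := by
          rw [Submodule.span_le]
          rintro _ ⟨⟨a, b⟩, ⟨hab, haN⟩, rfl⟩
          simp only [Set.mem_ofPred_eq] at hab haN
          have h2 := ih (D + a) (j + b) (by omega) (by omega)
          have e2 : s ^ D * (t / s) ^ j * (s ^ a * (t / s) ^ b) =
            s ^ (D + a) * (t / s) ^ (j + b) := by ring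
          simpa only [SetLike.mem_coe, Submodule.mem_comap, LinearMap.mulLeft_apply, e2] using h2
        exact this hsg
  rw [scale_planeRing_eq_span, Submodule.span_le]
  rintro _ ⟨⟨D, j⟩, hD, rfl⟩
  exact key j D j hD (by omega)

theorem relLength_blowUp {s t : K} (h : MonIndep k s t) {N : ℕ} {I I1 : Submodule k K}
    (hI1 : I1 ≤ planeRing k s (t / s)) (hI : I = orderIdeal k s t N ⊓ scale (s ^ N) I1)
    (hsup : scale (s ^ N) (planeRing k s (t / s)) ≤ orderIdeal k s t N ⊔ scale (s ^ N) I1) :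
    relLength I (planeRing k s t) = ((∑ i ∈ Finset.range N, (i + 1) : ℕ) : ℕ∞) +
      relLength I1 (planeRing k s (t / s)) := by
  have hle : I ≤ orderIdeal k s t N := hI ▸ inf_le_left
  rw [relLength_add hle inf_le_left, relLength_orderIdeal h, add_comm]
  congr 1
  have hinj : Function.Injective (LinearMap.mulLeft k (s ^ N)) :=
    mul_right_injective₀ (pow_ne_zero _ h.ne_zero_left)
  have e : orderIdeal k s t N ⊔ scale (s ^ N) I1 = scale (s ^ N) (planeRing k s (t / s)) :=
    le_antisymm (sup_le inf_le_right (Submodule.map_mono hI1)) hsup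
  rw [hI, relLength_inf, ← relLength_sup, e, relLength_map _ hinj]

end BlowUp

section BlowUpClosure

variable {k K : Type*} [Field k] [Field K] [Algebra k K]

theorem scale_eq_span_mul (c : K) (W : Submodule k K) : scale c W = Submodule.span k {c} * W := by
  ext x
  rw [Submodule.mem_span_singleton_mul]
  exact Iff.rfl

theorem scale_pow (c : K) (W : Submodule k K) (n : ℕ) : scale c W ^ n = scale (c ^ n) (W ^ n) := by
  rw [scale_eq_span_mul, mul_pow, Submodule.span_pow, Set.singleton_pow, ← scale_eq_span_mul]

theorem pow_mul_le (S : Subalgebra k K) (W : Submodule k K) (n : ℕ) :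
    (Subalgebra.toSubmodule S * W) ^ n ≤ Subalgebra.toSubmodule S * W ^ n := by
  rw [mul_pow]
  exact mul_le_mul' (Subalgebra.toSubmodule_pow_le S n) le_rfl

theorem le_subalgebra_mul (S : Subalgebra k K) (W : Submodule k K) :
    W ≤ Subalgebra.toSubmodule S * W := fun w hw => by
  have := Submodule.mul_mem_mul (show (1 : K) ∈ Subalgebra.toSubmodule S from S.one_mem) hw
  rwa [one_mul] at this

/-- The weak transform of `a` under the blow up of the origin. -/
abbrev weakTransform (s t : K) (m : ℕ) (a : Submodule k K) : Submodule k K :=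
  scale (s ^ m)⁻¹ (planeRing k s (t / s) * a)

theorem mem_intClosure_weakTransform {s t : K} (h : MonIndep k s t) {a : Submodule k K} {m n : ℕ}
    {x : K} (hx : s ^ (m * n) * x ∈ intClosure (Algebra.adjoin k {s, t}) (a ^ n)) :
    x ∈ intClosure (Algebra.adjoin k {s, t / s}) (weakTransform s t m a ^ n) := by
  have hs := h.ne_zero_left
  intro v hv
  obtain ⟨w, hw, c, hc, e⟩ := hx v fun y hy => hv y (adjoin_le_adjoin_div hs t hy)
  refine ⟨((s ^ m)⁻¹) ^ n * w, ?_, c, hc, ?_⟩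
  · rw [scale_pow]
    exact ⟨w, pow_le_pow_left' (le_subalgebra_mul _ a) n hw, rfl⟩
  · have := pow_ne_zero (m * n) hs
    apply mul_left_cancel₀ this
    rw [e, inv_pow, ← pow_mul]
    field_simp

theorem Valuation.lt_of_mem_span {Γ : Type*} [LinearOrderedCommGroupWithZero Γ] (v : Valuation K Γ)
    (hk : ∀ c : k, v (algebraMap k K c) ≤ 1) {γ : Γ} (hγ : γ ≠ 0) {S : Set K}
    (hS : ∀ x ∈ S, v x < γ) {x : K} (hx : x ∈ Submodule.span k S) : v x < γ := by
  induction hx using Submodule.span_induction with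
  | mem x hx => exact hS x hx
  | zero => simpa [zero_lt_iff] using hγ
  | add x y _ _ hx hy => exact (v.map_add _ _).trans_lt (max_lt hx hy)
  | smul c x _ hx =>
    rw [Algebra.smul_def, map_mul]
    exact (mul_le_of_le_one_left' (hk c)).trans_lt hx

theorem Valuation.le_of_mem_span {Γ : Type*} [LinearOrderedCommGroupWithZero Γ] (v : Valuation K Γ)
    (hk : ∀ c : k, v (algebraMap k K c) ≤ 1) {γ : Γ} {S : Set K}
    (hS : ∀ x ∈ S, v x ≤ γ) {x : K} (hx : x ∈ Submodule.span k S) : v x ≤ γ := by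
  induction hx using Submodule.span_induction with
  | mem x hx => exact hS x hx
  | zero => simp
  | add x y _ _ hx hy => exact (v.map_add _ _).trans (max_le hx hy)
  | smul c x _ hx =>
    rw [Algebra.smul_def, map_mul]
    exact (mul_le_of_le_one_left' (hk c)).trans hx

theorem mem_intClosure_of_weakTransform {s t : K} (h : MonIndep k s t) {a : Submodule k K}
    {m n : ℕ} (ham : a ≤ scale (s ^ m) (planeRing k s (t / s)))
    {f g : K} (hf : f ∈ a) (hg : g ∈ planeRing k s t) (hfg : f = t ^ m - s * g)
    {x : K} (hx1 : x ∈ planeRing k s (t / s)) (hx : s ^ (m * n) * x ∈ planeRing k s t)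
    (hxc : x ∈ intClosure (Algebra.adjoin k {s, t / s}) (weakTransform s t m a ^ n)) :
    s ^ (m * n) * x ∈ intClosure (Algebra.adjoin k {s, t}) (a ^ n) := by
  have hs := h.ne_zero_left
  have ht := h.ne_zero_right
  intro v hv
  by_cases hτ : t / s ∈ v
  · have hv1 : ∀ y ∈ Algebra.adjoin k {s, t / s}, y ∈ v := by
      intro y hy
      induction hy using Algebra.adjoin_induction with
      | mem y hy =>
        rcases hy with rfl | rfl
        · exact hv _ (left_mem_adjoin_pair _ _)
        · exact hτ
      | algebraMap c => exact hv _ (Subalgebra.algebraMap_mem _ c)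
      | add x y _ _ hx hy => exact add_mem hx hy
      | mul x y _ _ hx hy => exact mul_mem hx hy
    obtain ⟨w1, hw1, c, hc, rfl⟩ := hxc v hv1
    rw [scale_pow] at hw1
    obtain ⟨w2, hw2, rfl⟩ := hw1
    obtain ⟨w, hw, c', hc', rfl⟩ := ValuationSubring.exists_of_mem_mul hv1 (pow_mul_le _ a n hw2)
    refine ⟨w, hw, c * c', mul_mem hc hc', ?_⟩
    simp only [LinearMap.mulLeft_apply, inv_pow, ← pow_mul]
    have := pow_ne_zero (m * n) hs
    field_simp
  · set S := v.valuation s with hS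
    set T := v.valuation (t / s) with hT
    have hS0 : 0 < S := by
      rw [zero_lt_iff]
      exact (Valuation.ne_zero_iff _).2 hs
    have hT1 : 1 < T := by
      rw [← not_le, hT, v.valuation_le_one_iff]
      exact hτ
    have hT0 : 0 < T := zero_lt_one.trans hT1
    have hST : S * T = v.valuation t := by
      rw [hS, hT, ← map_mul, mul_div_cancel₀ _ hs]
    have hST1 : S * T ≤ 1 := by
      rw [hST, v.valuation_le_one_iff]
      exact hv _ (right_mem_adjoin_pair _ _)
    have hST0 : 0 < S * T := mul_pos hS0 hT0
    have hSlt : S < S * T := lt_mul_of_one_lt_right hS0 hT1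
    have hS1 : S < 1 := hSlt.trans_le hST1
    have hk : ∀ c : k, v.valuation (algebraMap k K c) ≤ 1 := fun c =>
      (v.valuation_le_one_iff _).2 (hv _ (Subalgebra.algebraMap_mem _ c))
    have hle : ∀ i j N : ℕ, j ≤ i → N ≤ i → S ^ i * T ^ j ≤ (S * T) ^ N := by
      intro i j N hji hNi
      by_cases hjN : N ≤ j
      · obtain ⟨l, rfl⟩ := Nat.exists_eq_add_of_le hji
        calc
          S ^ (j + l) * T ^ j = (S * T) ^ j * S ^ l := by rw [pow_add, mul_pow, mul_right_comm]
          _ ≤ (S * T) ^ j := mul_le_of_le_one_right' (pow_le_one' hS1.le l)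
          _ ≤ (S * T) ^ N := pow_le_pow_right_of_le_one' hST1 hjN
      · rw [mul_pow]
        exact mul_le_mul' (pow_le_pow_right_of_le_one' hS1.le hNi)
          (pow_le_pow_right' hT1.le (by omega))
    have hlt : ∀ i j N : ℕ, j < i → N ≤ i → S ^ i * T ^ j < (S * T) ^ N := by
      intro i j N hji hNi
      refine lt_of_lt_of_le ?_ (hle i (j + 1) N hji hNi)
      rw [pow_succ, ← mul_assoc]
      exact lt_mul_of_one_lt_right (mul_pos (pow_pos hS0 _) (pow_pos hT0 _)) hT1
    have hb : v.valuation (s ^ (m * n) * x) ≤ (S * T) ^ (m * n) := by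
      have h1 : s ^ (m * n) * x ∈ orderIdeal k s t (m * n) := ⟨hx, ⟨x, hx1, rfl⟩⟩
      rw [orderIdeal_eq_span h] at h1
      refine Valuation.le_of_mem_span _ hk ?_ h1
      rintro _ ⟨⟨i, j⟩, ⟨hji, hNi⟩, rfl⟩
      rw [map_mul, map_pow, map_pow]
      exact hle i j _ hji hNi
    have hsg : v.valuation (s * g) < (S * T) ^ m := by
      have h1 : s * g ∈ Submodule.span k ((fun i : ℕ × ℕ => s ^ i.1 * (t / s) ^ i.2) ''
          ({i | i.2 < i.1} ∩ {i | m ≤ i.1})) := by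
        rw [← LinearIndependent.span_image_inf h.div, ← scale_left_planeRing_eq_span hs,
          ← scale_planeRing_eq_span]
        refine ⟨⟨g, hg, rfl⟩, ?_⟩
        have : s * g = t ^ m - f := by rw [hfg]; ring
        rw [this]
        refine Submodule.sub_mem _ ⟨(t / s) ^ m, pow_mem (right_mem_adjoin_pair _ _) m, ?_⟩ (ham hf)
        simp only [LinearMap.mulLeft_apply, div_pow]
        field_simp
      refine Valuation.lt_of_mem_span _ hk (pow_ne_zero _ hST0.ne') ?_ h1
      rintro _ ⟨⟨i, j⟩, ⟨hji, hNi⟩, rfl⟩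
      rw [map_mul, map_pow, map_pow]
      exact hlt i j _ hji hNi
    have hfv : v.valuation f = (S * T) ^ m := by
      rw [hST, ← map_pow] at hsg
      rw [hfg, Valuation.map_sub_eq_of_lt_left _ hsg, map_pow, hST]
    have hf0 : f ≠ 0 := by
      rw [← Valuation.ne_zero_iff v.valuation, hfv]
      exact pow_ne_zero _ hST0.ne'
    refine ⟨f ^ n, Submodule.pow_mem_pow a hf n, s ^ (m * n) * x / f ^ n, ?_, ?_⟩
    · rw [← v.valuation_le_one_iff, map_div₀, map_pow, hfv, ← pow_mul]
      exact div_le_one_of_le₀ hb zero_le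
    · have := pow_ne_zero n hf0
      field_simp

end BlowUpClosure

section ClosureLength

variable {k K : Type*} [Field k] [Field K] [Algebra k K]

theorem mul_mem_intClosure {S : Subalgebra k K} {W : Submodule k K} {r b : K} (hr : r ∈ S)
    (hb : b ∈ intClosure S W) : r * b ∈ intClosure S W := by
  intro v hv
  obtain ⟨w, hw, c, hc, rfl⟩ := hb v hv
  exact ⟨w, hw, r * c, mul_mem (hv r hr) hc, by ring⟩

theorem intClosure_mono {S T : Subalgebra k K} (hST : S ≤ T) {W W' : Submodule k K} (hW : W ≤ W') :
    intClosure S W ≤ intClosure T W' := by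
  intro b hb v hv
  obtain ⟨w, hw, c, hc, e⟩ := hb v fun x hx => hv x (hST hx)
  exact ⟨w, hW hw, c, hc, e⟩

theorem weakTransform_le {s t : K} (hs : s ≠ 0) {m : ℕ} {a : Submodule k K}
    (ham : a ≤ scale (s ^ m) (planeRing k s (t / s))) :
    weakTransform s t m a ≤ planeRing k s (t / s) := by
  rintro _ ⟨x, hx, rfl⟩
  have : planeRing k s (t / s) * a ≤ scale (s ^ m) (planeRing k s (t / s)) := by
    rw [Submodule.mul_le]
    intro r hr b hb
    obtain ⟨u, hu, rfl⟩ := ham hb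
    exact ⟨r * u, Subalgebra.mul_mem _ hr hu, by simp only [LinearMap.mulLeft_apply]; ring⟩
  obtain ⟨u, hu, rfl⟩ := this hx
  have hsm := pow_ne_zero m hs
  simpa [hsm] using hu

theorem mul_mem_weakTransform {s t : K} {m : ℕ} {a : Submodule k K} {r b : K}
    (hr : r ∈ planeRing k s (t / s)) (hb : b ∈ weakTransform s t m a) :
    r * b ∈ weakTransform s t m a := by
  obtain ⟨x, hx, rfl⟩ := hb
  refine ⟨r * x, ?_, by simp only [LinearMap.mulLeft_apply]; ring⟩
  have := Submodule.mul_mem_mul hr hx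
  rwa [← mul_assoc, Subalgebra.isIdempotentElem_toSubmodule] at this

theorem le_scale_weakTransform {s t : K} (hs : s ≠ 0) (m : ℕ) (a : Submodule k K) :
    a ≤ scale (s ^ m) (weakTransform s t m a) := by
  intro x hx
  refine ⟨(s ^ m)⁻¹ * x, ⟨x, le_subalgebra_mul _ a hx, rfl⟩, ?_⟩
  have hsm := pow_ne_zero m hs
  simp [hsm]

theorem mul_mem_scale {c r b : K} {W : Submodule k K} (h : ∀ w ∈ W, r * w ∈ W)
    (hb : b ∈ scale c W) : r * b ∈ scale c W := by
  obtain ⟨w, hw, rfl⟩ := hb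
  exact ⟨r * w, h w hw, by simp only [LinearMap.mulLeft_apply]; ring⟩

/-- Coordinates in which the blow up of the origin is well adapted to the ideal `a`. -/
structure GoodCoordinates (a : Submodule k K) (s t : K) (m : ℕ) : Prop where
  indep : MonIndep k s t
  le_plane : a ≤ planeRing k s t
  le_scale : a ≤ scale (s ^ m) (planeRing k s (t / s))
  exists_mem : ∃ f ∈ a, ∃ g ∈ planeRing k s t, f = t ^ m - s * g

namespace GoodCoordinates

variable {a : Submodule k K} {s t : K} {m : ℕ}

theorem relLength_closure [Infinite k] (h : GoodCoordinates a s t m) (n : ℕ) :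
    relLength (planeRing k s t ⊓ intClosure (Algebra.adjoin k {s, t}) (a ^ n)) (planeRing k s t) =
      ((∑ i ∈ Finset.range (m * n), (i + 1) : ℕ) : ℕ∞) +
      relLength (planeRing k s (t / s) ⊓
        intClosure (Algebra.adjoin k {s, t / s}) (weakTransform s t m a ^ n))
        (planeRing k s (t / s)) := by
  obtain ⟨f, hf, g, hg, hfg⟩ := h.exists_mem
  have hs := h.indep.ne_zero_left
  have hpow : a ^ n ≤ scale (s ^ (m * n)) (planeRing k s (t / s)) := by
    rw [pow_mul]
    exact pow_le_scale h.le_scale n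
  have hI : planeRing k s t ⊓ intClosure (Algebra.adjoin k {s, t}) (a ^ n) =
      orderIdeal k s t (m * n) ⊓ scale (s ^ (m * n)) (planeRing k s (t / s) ⊓
        intClosure (Algebra.adjoin k {s, t / s}) (weakTransform s t m a ^ n)) := by
    apply le_antisymm
    · rintro b ⟨hb1, hb2⟩
      have hb3 := mem_scale_of_mem_intClosure h.indep.div hpow (adjoin_le_adjoin_div hs t hb1)
        (intClosure_mono (adjoin_le_adjoin_div hs t) le_rfl hb2)
      refine ⟨⟨hb1, hb3⟩, ?_⟩
      obtain ⟨u, hu, rfl⟩ := hb3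
      exact ⟨u, ⟨hu, mem_intClosure_weakTransform h.indep hb2⟩, rfl⟩
    · rintro _ ⟨⟨hb1, -⟩, ⟨u, ⟨hu1, hu2⟩, rfl⟩⟩
      exact ⟨hb1, mem_intClosure_of_weakTransform h.indep h.le_scale hf hg hfg hu1 hb1 hu2⟩
  refine relLength_blowUp h.indep inf_le_left hI ?_
  have hfn : f ^ n ∈ a ^ n := Submodule.pow_mem_pow a hf n
  have hfR : f ^ n ∈ planeRing k s t := pow_mem (S := Algebra.adjoin k {s, t}) (h.le_plane hf) n
  obtain ⟨g', hg'⟩ : ∃ g' ∈ planeRing k s t, f ^ n = t ^ (m * n) - s * g' := by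
    let f' : Algebra.adjoin k {s, t} := ⟨f, h.le_plane hf⟩
    let t' : Algebra.adjoin k {s, t} := ⟨t, right_mem_adjoin_pair _ _⟩
    let s' : Algebra.adjoin k {s, t} := ⟨s, left_mem_adjoin_pair _ _⟩
    have h1 : s' ∣ t' ^ m - f' := ⟨⟨g, hg⟩, Subtype.ext (by simp [s', t', f', hfg])⟩
    obtain ⟨g', hg'⟩ := h1.trans (sub_dvd_pow_sub_pow _ _ n)
    refine ⟨g', g'.2, ?_⟩
    have := congrArg (Subtype.val) hg'
    simp only [s', t', f', Subalgebra.coe_sub, Subalgebra.coe_pow, Subalgebra.coe_mul] at this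
    rw [← this, pow_mul]
    ring
  refine scale_planeRing_le h.indep (fun r hr b hb => mul_mem_scale ?_ hb) (f := f ^ n) ?_
    (hpow hfn) hg'.1 hg'.2
  · exact fun w hw => ⟨Subalgebra.mul_mem _ hr hw.1, mul_mem_intClosure hr hw.2⟩
  · exact (hI.le ⟨hfR, le_intClosure _ _ hfn⟩).2

theorem relLength_weakTransform_add_le (h : GoodCoordinates a s t m) :
    ((∑ i ∈ Finset.range m, (i + 1) : ℕ) : ℕ∞) +
      relLength (weakTransform s t m a) (planeRing k s (t / s)) ≤
      relLength a (planeRing k s t) := by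
  obtain ⟨f, hf, g, hg, hfg⟩ := h.exists_mem
  have hs := h.indep.ne_zero_left
  rw [← relLength_blowUp h.indep (weakTransform_le hs h.le_scale) rfl]
  · exact relLength_anti (le_inf (le_inf h.le_plane h.le_scale) (le_scale_weakTransform hs m a))
      (inf_le_left.trans inf_le_left)
  · exact scale_planeRing_le h.indep
      (fun r hr b hb => mul_mem_scale (fun w hw => mul_mem_weakTransform hr hw) hb)
      (le_scale_weakTransform hs m a hf) (h.le_scale hf) hg hfg

end GoodCoordinates

theorem Nat.dvd_sum_range_succ {p N : ℕ} (hp : p.Prime) (hp5 : 5 ≤ p) (h : p ∣ N) :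
    p ∣ ∑ i ∈ Finset.range N, (i + 1) := by
  have e : (∑ i ∈ Finset.range N, (i + 1)) * 2 = N * (N + 1) := by
    clear h
    induction N with
    | zero => simp
    | succ N ih => rw [Finset.sum_range_succ, add_mul, ih]; ring
  have h2 : p ∣ (∑ i ∈ Finset.range N, (i + 1)) * 2 := e ▸ h.mul_right _
  refine (Nat.Prime.dvd_mul hp).1 h2 |>.resolve_right fun h3 => ?_
  exact absurd (Nat.le_of_dvd two_pos h3) (by omega)

end ClosureLength

section GoodCoordinates

variable {k K : Type*} [Field k] [Field K] [Algebra k K]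

theorem finite_quotient_of_relLength_ne_top {M : Type*} [AddCommGroup M] [Module k M]
    {I N : Submodule k M} (h : relLength I N ≠ ⊤) : Module.Finite k (N ⧸ I.submoduleOf N) := by
  have h1 := Module.length_ne_top_iff.1 h
  rw [isFiniteLength_iff_isNoetherian_isArtinian] at h1
  have := h1.1
  infer_instance

open Polynomial in
theorem exists_aeval_mem_of_relLength_ne_top {S : Subalgebra k K} {a : Submodule k K}
    (h : relLength a (Subalgebra.toSubmodule S) ≠ ⊤) {z : K} (hz : z ∈ S) :
    ∃ P : k[X], P ≠ 0 ∧ aeval z P ∈ a := by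
  have := finite_quotient_of_relLength_ne_top h
  let φ : k[X] →ₗ[k] (Subalgebra.toSubmodule S) ⧸ a.submoduleOf (Subalgebra.toSubmodule S) :=
    (Submodule.mkQ _) ∘ₗ (aeval (⟨z, hz⟩ : S)).toLinearMap
  by_contra! hall
  have hinj : Function.Injective φ := by
    rw [← LinearMap.ker_eq_bot, Submodule.eq_bot_iff]
    intro P hP
    by_contra hP0
    refine hall P hP0 ?_
    have h1 : (aeval (⟨z, hz⟩ : S) P : S) ∈ a.submoduleOf (Subalgebra.toSubmodule S) :=
      (Submodule.Quotient.mk_eq_zero _).1 hP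
    have h2 : ((aeval (⟨z, hz⟩ : S) P : S) : K) ∈ a := h1
    have e1 : ((aeval (⟨z, hz⟩ : S) P : S) : K) = aeval z P :=
      (Polynomial.aeval_algHom_apply S.val (⟨z, hz⟩ : S) P).symm
    rwa [e1] at h2
  have := Module.Finite.of_injective φ hinj
  exact Polynomial.not_finite this

theorem Ideal.exists_algHom_of_ne_top [IsAlgClosed k] {A : Type*} [CommRing A] [Algebra k A]
    [Algebra.FiniteType k A] (I : Ideal A) (hI : I ≠ ⊤) : ∃ ε : A →ₐ[k] k, ∀ r ∈ I, ε r = 0 := by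
  obtain ⟨M, hM, hIM⟩ := Ideal.exists_le_maximal I hI
  let := Ideal.Quotient.field M
  have hfin := finite_of_finite_type_of_isJacobsonRing k (A ⧸ M)
  let e := AlgEquiv.ofBijective (Algebra.ofId k (A ⧸ M))
    (IsAlgClosed.algebraMap_bijective_of_isIntegral (k := k) (K := A ⧸ M))
  refine ⟨e.symm.toAlgHom.comp (Ideal.Quotient.mkₐ k M), fun r hr => ?_⟩
  have : Ideal.Quotient.mk M r = 0 := Ideal.Quotient.eq_zero_iff_mem.2 (hIM hr)
  simp [this]

/-- A subspace of a subalgebra which is closed under multiplication, as an ideal. -/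
def idealOf (S : Subalgebra k K) (a : Submodule k K)
    (hmul : ∀ r ∈ S, ∀ g ∈ a, r * g ∈ a) : Ideal S where
  carrier := {r | (r : K) ∈ a}
  add_mem' := fun ha hb => a.add_mem ha hb
  zero_mem' := a.zero_mem
  smul_mem' := fun c x hx => hmul c c.2 x hx

instance finiteType_adjoin_pair (s t : K) : Algebra.FiniteType k (Algebra.adjoin k {s, t}) := by
  rw [← Subalgebra.fg_iff_finiteType]
  exact Subalgebra.fg_def.2 ⟨{s, t}, by simp, rfl⟩

theorem exists_algHom_of_submodule [IsAlgClosed k] {S : Subalgebra k K} [Algebra.FiniteType k S]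
    {a : Submodule k K} (hmul : ∀ r ∈ S, ∀ g ∈ a, r * g ∈ a)
    (h1 : (1 : K) ∉ a) : ∃ ε : S →ₐ[k] k, ∀ r : S, (r : K) ∈ a → ε r = 0 :=
  Ideal.exists_algHom_of_ne_top (idealOf S a hmul) fun h => h1 (by
    have : (1 : S) ∈ idealOf S a hmul := h ▸ Submodule.mem_top
    exact this)

theorem algebraicIndependent_pair_of_trdeg {A : Type*} [CommRing A] [IsDomain A] [Algebra k A]
    (h : 2 ≤ Algebra.trdeg k A) (s t : A)
    [Algebra.IsAlgebraic (Algebra.adjoin k (Set.range ![s, t])) A] :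
    AlgebraicIndependent k ![s, t] := by
  refine (Algebra.IsAlgebraic.isTranscendenceBasis_of_lift_le_trdeg_of_finite k ![s, t] ?_).1
  simpa using h

theorem MonIndep.of_adjoin_eq {x y s t : K} (h : MonIndep k x y)
    (he : Algebra.adjoin k {s, t} = Algebra.adjoin k {x, y}) : MonIndep k s t := by
  rw [monIndep_iff] at h ⊢
  have hr : ∀ a b : K, Set.range ![a, b] = {a, b} := by
    intro a b
    ext z
    simp [eq_comm, or_comm]
  have hs : s ∈ Algebra.adjoin k {x, y} := he ▸ left_mem_adjoin_pair s t
  have ht : t ∈ Algebra.adjoin k {x, y} := he ▸ right_mem_adjoin_pair s t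
  have h2 : 2 ≤ Algebra.trdeg k (Algebra.adjoin k {x, y}) := by
    have : AlgebraicIndependent k ![(⟨x, left_mem_adjoin_pair x y⟩ : Algebra.adjoin k {x, y}),
        ⟨y, right_mem_adjoin_pair x y⟩] := by
      rw [← AlgHom.algebraicIndependent_iff (Algebra.adjoin k {x, y}).val Subtype.val_injective]
      convert h using 1
      funext i
      fin_cases i <;> rfl
    simpa using this.lift_cardinalMk_le_trdeg
  have e : ![s, t] = (Algebra.adjoin k {x, y}).val ∘ ![(⟨s, hs⟩ : Algebra.adjoin k {x, y}),
        ⟨t, ht⟩] := by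
    funext i
    fin_cases i <;> rfl
  rw [e, AlgHom.algebraicIndependent_iff _ Subtype.val_injective]
  have htop : Algebra.adjoin k (Set.range ![(⟨s, hs⟩ : Algebra.adjoin k {x, y}), ⟨t, ht⟩]) = ⊤ := by
    apply Subalgebra.map_injective (f := (Algebra.adjoin k {x, y}).val) Subtype.val_injective
    rw [← Algebra.adjoin_image, ← Set.range_comp, ← e, hr, he, Algebra.map_top, Subalgebra.range_val]
  have : Algebra.IsAlgebraic (Algebra.adjoin k
      (Set.range ![(⟨s, hs⟩ : Algebra.adjoin k {x, y}), ⟨t, ht⟩])) (Algebra.adjoin k {x, y}) := by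
    refine ⟨fun z => ?_⟩
    exact isAlgebraic_algebraMap (⟨z, htop ▸ Algebra.mem_top⟩ :
      Algebra.adjoin k (Set.range ![(⟨s, hs⟩ : Algebra.adjoin k {x, y}), ⟨t, ht⟩]))
  exact algebraicIndependent_pair_of_trdeg h2 _ _

theorem orderIdeal_eq_mul_pow {s t : K} (h : MonIndep k s t) (N : ℕ) :
    orderIdeal k s t N = planeRing k s t * (Submodule.span k {s, t}) ^ N := by
  have hs := h.ne_zero_left
  have hU : Submodule.span k {s, t} ≤ planeRing k s t := by
    rw [Submodule.span_le]
    exact Algebra.subset_adjoin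
  have hU1 : Submodule.span k {s, t} ≤ scale s (planeRing k s (t / s)) := by
    rw [Submodule.span_le]
    rintro z (rfl | rfl)
    · exact ⟨1, Subalgebra.one_mem _, by simp⟩
    · exact ⟨_, right_mem_adjoin_pair _ _, mul_div_cancel₀ _ hs⟩
  have hUp : ∀ n, (Submodule.span k {s, t}) ^ n ≤ planeRing k s t := fun n =>
    (pow_le_pow_left' hU n).trans (Subalgebra.toSubmodule_pow_le _ n)
  apply le_antisymm
  · rw [orderIdeal_eq_span h, Submodule.span_le]
    rintro _ ⟨⟨i, j⟩, ⟨hji, hNi⟩, rfl⟩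
    simp only at hji hNi ⊢
    obtain ⟨l, rfl⟩ := Nat.exists_eq_add_of_le hji
    obtain ⟨q, hq⟩ := Nat.exists_eq_add_of_le' hNi
    have e : s ^ (j + l) * (t / s) ^ j = s ^ l * t ^ j := by
      rw [div_pow]
      field_simp
      ring
    have h1 : s ^ l * t ^ j ∈ Submodule.span k {s, t} ^ (l + j) := by
      rw [pow_add]
      exact Submodule.mul_mem_mul (Submodule.pow_mem_pow _ (Submodule.subset_span (by simp)) _)
        (Submodule.pow_mem_pow _ (Submodule.subset_span (by simp)) _)
    rw [add_comm, hq, pow_add] at h1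
    rw [e]
    exact mul_le_mul' (hUp q) le_rfl h1
  · rw [Submodule.mul_le]
    intro r hr u hu
    refine ⟨Subalgebra.mul_mem _ hr (hUp N hu), ?_⟩
    exact mul_mem_scale (fun w hw => Subalgebra.mul_mem _ (adjoin_le_adjoin_div hs t hr) hw)
      (pow_le_scale hU1 N hu)

end GoodCoordinates

section ExistsGood

open Polynomial

variable {k K : Type*} [Field k] [Field K] [Algebra k K]

theorem coe_aeval_subalgebra {S : Subalgebra k K} (z : S) (P : k[X]) :
    ((aeval z P : S) : K) = aeval (z : K) P :=
  (Polynomial.aeval_algHom_apply S.val z P).symm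

theorem aeval_mem_subalgebra {S : Subalgebra k K} {z : K} (hz : z ∈ S) (P : k[X]) :
    aeval z P ∈ S := by
  rw [← coe_aeval_subalgebra (⟨z, hz⟩ : S)]
  exact Subtype.mem _

theorem MonIndep.mem_orderIdeal_one {s t : K} (h : MonIndep k s t)
    (ε : Algebra.adjoin k {s, t} →ₐ[k] k) (hεs : ∀ r : Algebra.adjoin k {s, t}, (r : K) = s → ε r = 0)
    (hεt : ∀ r : Algebra.adjoin k {s, t}, (r : K) = t → ε r = 0) (r : Algebra.adjoin k {s, t})
    (hr : ε r = 0) : (r : K) ∈ orderIdeal k s t 1 := by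
  obtain ⟨P, r', hr', e⟩ := exists_eq_aeval_add s t r.2
  let s0 : Algebra.adjoin k {s, t} := ⟨s, left_mem_adjoin_pair s t⟩
  let t0 : Algebra.adjoin k {s, t} := ⟨t, right_mem_adjoin_pair s t⟩
  have e' : r = aeval t0 P + s0 * ⟨r', hr'⟩ := by
    apply Subtype.ext
    rw [e]
    simp [s0, t0, coe_aeval_subalgebra]
  rw [e', map_add, map_mul, hεs s0 rfl, zero_mul, add_zero, ← Polynomial.aeval_algHom_apply,
    hεt t0 rfl, Polynomial.coe_aeval_eq_eval] at hr
  obtain ⟨Q, rfl⟩ := X_dvd_iff.2 (by rwa [coeff_zero_eq_eval_zero] : P.coeff 0 = 0)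
  rw [orderIdeal_eq_mul_pow h, pow_one, e, map_mul, aeval_X]
  refine Submodule.add_mem _ ?_ ?_
  · rw [mul_comm t]
    exact Submodule.mul_mem_mul (aeval_mem_subalgebra (right_mem_adjoin_pair _ _) Q)
      (Submodule.subset_span (by simp))
  · rw [mul_comm s]
    exact Submodule.mul_mem_mul hr' (Submodule.subset_span (by simp))

theorem adjoin_pair_le {s t : K} {S : Subalgebra k K} (hs : s ∈ S) (ht : t ∈ S) :
    Algebra.adjoin k {s, t} ≤ S := by
  rw [Algebra.adjoin_le_iff]
  rintro z (rfl | rfl)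
  · exact hs
  · exact ht

theorem exists_translation [IsAlgClosed k] {x y : K} (h : MonIndep k x y) {a : Submodule k K}
    (ha : a ≤ planeRing k x y) (hmul : ∀ r ∈ planeRing k x y, ∀ g ∈ a, r * g ∈ a)
    (h1 : (1 : K) ∉ a) : ∃ x0 y0 : K, Algebra.adjoin k {x0, y0} = Algebra.adjoin k {x, y} ∧
      MonIndep k x0 y0 ∧ a ≤ orderIdeal k x0 y0 1 := by
  obtain ⟨ε, hε⟩ := exists_algHom_of_submodule hmul h1
  let x' : Algebra.adjoin k {x, y} := ⟨x, left_mem_adjoin_pair x y⟩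
  let y' : Algebra.adjoin k {x, y} := ⟨y, right_mem_adjoin_pair x y⟩
  let x1 := x' - algebraMap k _ (ε x')
  let y1 := y' - algebraMap k _ (ε y')
  have he : Algebra.adjoin k {(x1 : K), (y1 : K)} = Algebra.adjoin k {x, y} := by
    apply le_antisymm
    · exact adjoin_pair_le x1.2 y1.2
    · apply adjoin_pair_le
      · have := add_mem (left_mem_adjoin_pair (k := k) (x1 : K) (y1 : K))
          (Subalgebra.algebraMap_mem _ (ε x'))
        simpa [x1, x'] using this
      · have := add_mem (right_mem_adjoin_pair (k := k) (x1 : K) (y1 : K))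
          (Subalgebra.algebraMap_mem _ (ε y'))
        simpa [y1, y'] using this
  have h0 := h.of_adjoin_eq he
  refine ⟨x1, y1, he, h0, fun r hr => ?_⟩
  refine h0.mem_orderIdeal_one (ε.comp (Subalgebra.inclusion he.le)) ?_ ?_
    ⟨r, he.ge (ha hr)⟩ (hε _ hr)
  · intro r hr
    have : Subalgebra.inclusion he.le r = x1 := Subtype.ext hr
    simp [this, x1]
  · intro r hr
    have : Subalgebra.inclusion he.le r = y1 := Subtype.ext hr
    simp [this, y1]

theorem exists_goodCoordinates [IsAlgClosed k] {x y : K} (h : MonIndep k x y) {a : Submodule k K}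
    (ha : a ≤ planeRing k x y) (hmul : ∀ r ∈ planeRing k x y, ∀ g ∈ a, r * g ∈ a)
    (h1 : (1 : K) ∉ a) (hD : relLength a (planeRing k x y) ≠ ⊤) :
    ∃ s t m, Algebra.adjoin k {s, t} = Algebra.adjoin k {x, y} ∧ 1 ≤ m ∧
      GoodCoordinates a s t m := by
  obtain ⟨x0, y0, he, h0, ha1⟩ := exists_translation h ha hmul h1
  have hx0 := h0.ne_zero_left
  obtain ⟨m, hm1, ham, hm⟩ : ∃ m, 1 ≤ m ∧ a ≤ orderIdeal k x0 y0 m ∧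
      ¬ a ≤ orderIdeal k x0 y0 (m + 1) := by
    by_contra! hall
    have : ∀ m, 1 ≤ m → a ≤ orderIdeal k x0 y0 m := fun m hm => by
      induction m, hm using Nat.le_induction with
      | base => exact ha1
      | succ m hm ih => exact hall m hm ih
    obtain ⟨D, hD'⟩ := ENat.ne_top_iff_exists.1 hD
    have h2 := relLength_anti (this (D + 1) (by omega)) inf_le_left
    rw [relLength_orderIdeal h0, planeRing, he, ← hD', Nat.cast_le, Finset.sum_range_succ] at h2
    omega
  obtain ⟨f0, hf0, hf0'⟩ := Set.not_subset.1 hm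
  obtain ⟨hf0R, ⟨u0, hu0, hu0e⟩⟩ := ham hf0
  simp only [LinearMap.mulLeft_apply] at hu0e
  obtain ⟨ρ, hρs, hρt, hρ⟩ := h0.div.exists_restriction
  have hρu : ρ ⟨u0, hu0⟩ ≠ 0 := by
    intro hz
    obtain ⟨r', hr', e⟩ := hρ _ hz
    refine hf0' ⟨hf0R, ⟨r', hr', ?_⟩⟩
    simp only at e
    simp only [LinearMap.mulLeft_apply]
    rw [← hu0e, e, pow_succ, mul_assoc]
  obtain ⟨P, hP0, hP⟩ := exists_aeval_mem_of_relLength_ne_top hD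
    (he.le (left_mem_adjoin_pair x0 y0))
  obtain ⟨Q, hQ0, hQ⟩ := exists_aeval_mem_of_relLength_ne_top hD
    (he.le (right_mem_adjoin_pair x0 y0))
  classical
  obtain ⟨lam, hlam⟩ := Infinite.exists_notMem_finset ((ρ ⟨u0, hu0⟩).roots.toFinset ∪
    Finset.image₂ (fun d c => d / c) Q.roots.toFinset P.roots.toFinset)
  simp only [Finset.mem_union, Multiset.mem_toFinset, mem_roots hρu, IsRoot.def,
    Finset.mem_image₂, mem_roots hP0, mem_roots hQ0, not_or, not_exists, not_and] at hlam
  obtain ⟨hlam1, hlam2⟩ := hlam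
  let s := y0 - algebraMap k K lam * x0
  have hsR : s ∈ Algebra.adjoin k {x0, y0} := sub_mem (right_mem_adjoin_pair _ _)
    (mul_mem (Subalgebra.algebraMap_mem _ _) (left_mem_adjoin_pair _ _))
  have he2 : Algebra.adjoin k {s, x0} = Algebra.adjoin k {x0, y0} := by
    apply le_antisymm
    · exact adjoin_pair_le hsR (left_mem_adjoin_pair _ _)
    · refine adjoin_pair_le (right_mem_adjoin_pair _ _) ?_
      have := add_mem (left_mem_adjoin_pair (k := k) s x0)
        (mul_mem (Subalgebra.algebraMap_mem _ lam) (right_mem_adjoin_pair (k := k) s x0))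
      simpa [s] using this
  have h2 := h0.of_adjoin_eq he2
  have hspan : Submodule.span k {s, x0} = Submodule.span k {x0, y0} := by
    apply le_antisymm
    · rw [Submodule.span_le]
      rintro z (rfl | rfl)
      · refine Submodule.sub_mem _ (Submodule.subset_span (by simp)) ?_
        rw [← Algebra.smul_def]
        exact Submodule.smul_mem _ _ (Submodule.subset_span (by simp))
      · exact Submodule.subset_span (by simp)
    · rw [Submodule.span_le]
      rintro z (rfl | rfl)
      · exact Submodule.subset_span (by simp)
      · have e : z = s + lam • x0 := by simp [s, Algebra.smul_def]
        rw [e]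
        exact Submodule.add_mem _ (Submodule.subset_span (by simp))
          (Submodule.smul_mem _ lam (Submodule.subset_span (by simp)))
  have hord : orderIdeal k s x0 m = orderIdeal k x0 y0 m := by
    rw [orderIdeal_eq_mul_pow h2, orderIdeal_eq_mul_pow h0, hspan, planeRing, planeRing, he2]
  obtain ⟨φ1, hφx, hφy⟩ := h0.div.exists_algHom (X : k[X]) (C lam)
  let φ : Algebra.adjoin k {x0, y0} →ₐ[k] k[X] :=
    φ1.comp (Subalgebra.inclusion (adjoin_le_adjoin_div hx0 y0))
  let X0 : Algebra.adjoin k {x0, y0} := ⟨x0, left_mem_adjoin_pair _ _⟩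
  let Y0 : Algebra.adjoin k {x0, y0} := ⟨y0, right_mem_adjoin_pair _ _⟩
  have hφX : φ X0 = X := hφx _ rfl
  have hφY : φ Y0 = C lam * X := by
    have e : Subalgebra.inclusion (adjoin_le_adjoin_div hx0 y0) Y0 =
      ⟨y0 / x0, right_mem_adjoin_pair _ _⟩ * ⟨x0, left_mem_adjoin_pair _ _⟩ := by
      apply Subtype.ext
      simp [Y0, hx0]
    simp only [φ, AlgHom.comp_apply]
    rw [e, map_mul, hφx ⟨x0, left_mem_adjoin_pair _ _⟩ rfl, hφy ⟨y0 / x0, right_mem_adjoin_pair _ _⟩ rfl]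
  have hφS : φ ⟨s, hsR⟩ = 0 := by
    have e : (⟨s, hsR⟩ : Algebra.adjoin k {x0, y0}) = Y0 - algebraMap k _ lam * X0 :=
      Subtype.ext (by simp [s, Y0, X0])
    rw [e, map_sub, map_mul, hφY, hφX, AlgHom.commutes]
    simp
  have hφsurj : Function.Surjective φ := fun P => ⟨aeval X0 P, by
    rw [← Polynomial.aeval_algHom_apply, hφX, aeval_X_left_apply]⟩
  have hmul0 : ∀ r ∈ Algebra.adjoin k {x0, y0}, ∀ g ∈ a, r * g ∈ a := fun r hr => hmul r (he.le hr)
  have haR : a ≤ planeRing k x0 y0 := ham.trans inf_le_left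
  let I := idealOf (Algebra.adjoin k {x0, y0}) a hmul0
  obtain ⟨g, hg⟩ := (IsPrincipalIdealRing.principal (I.map φ)).principal
  have hgmem : ∀ P, P ∈ I.map φ ↔ g ∣ P := fun P => by
    rw [hg]
    exact Ideal.mem_span_singleton
  have hXg : X ^ m ∣ g := by
    have h3 : I.map φ ≤ Ideal.span {X ^ m} := by
      rw [Ideal.map_le_iff_le_comap]
      rintro ⟨r, hrR⟩ hr
      rw [Ideal.mem_comap, Ideal.mem_span_singleton]
      obtain ⟨u, hu, e⟩ := (ham hr).2
      simp only [LinearMap.mulLeft_apply] at e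
      refine ⟨φ1 ⟨u, hu⟩, ?_⟩
      have e2 : Subalgebra.inclusion (adjoin_le_adjoin_div hx0 y0) ⟨r, hrR⟩ =
          ⟨x0, left_mem_adjoin_pair _ _⟩ ^ m * ⟨u, hu⟩ := Subtype.ext (by simp [e])
      simp only [φ, AlgHom.comp_apply]
      rw [e2, map_mul, map_pow, hφx _ rfl]
    exact Ideal.mem_span_singleton.1 (h3 ((hgmem g).2 dvd_rfl))
  obtain ⟨g', rfl⟩ := hXg
  have hf0φ : φ ⟨f0, hf0R⟩ = X ^ m * φ1 ⟨u0, hu0⟩ := by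
    have e2 : Subalgebra.inclusion (adjoin_le_adjoin_div hx0 y0) ⟨f0, hf0R⟩ =
          ⟨x0, left_mem_adjoin_pair _ _⟩ ^ m * ⟨u0, hu0⟩ := Subtype.ext (by simp [hu0e])
    simp only [φ, AlgHom.comp_apply]
    rw [e2, map_mul, map_pow, hφx _ rfl]
  have hw0 : (φ1 ⟨u0, hu0⟩).eval 0 ≠ 0 := by
    have e3 : (φ1 ⟨u0, hu0⟩).eval 0 = (ρ ⟨u0, hu0⟩).eval lam := by
      obtain ⟨P, r', hr', e⟩ := exists_eq_aeval_add x0 (y0 / x0) hu0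
      let t0 : Algebra.adjoin k {x0, y0 / x0} := ⟨y0 / x0, right_mem_adjoin_pair _ _⟩
      let s0 : Algebra.adjoin k {x0, y0 / x0} := ⟨x0, left_mem_adjoin_pair _ _⟩
      have e' : (⟨u0, hu0⟩ : Algebra.adjoin k {x0, y0 / x0}) = aeval t0 P + s0 * ⟨r', hr'⟩ := by
        apply Subtype.ext
        simp only [s0, t0, coe_aeval_subalgebra, Subalgebra.coe_add, Subalgebra.coe_mul]
        exact e
      rw [e', map_add, map_mul, map_add, map_mul, ← aeval_algHom_apply, ← aeval_algHom_apply,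
        hφx s0 rfl, hφy t0 rfl, hρs s0 rfl, hρt t0 rfl]
      have e4 : aeval (C lam) P = C (aeval lam P) := Polynomial.aeval_algebraMap_apply k[X] lam P
      simp [e4, Polynomial.coe_aeval_eq_eval]
    rw [e3]
    exact hlam1
  have hg'0 : g'.eval 0 ≠ 0 := by
    intro h3
    have h4 := (hgmem _).1 (Ideal.mem_map_of_mem φ (show (⟨f0, hf0R⟩ : Algebra.adjoin k {x0, y0}) ∈ I
      from hf0))
    rw [hf0φ, mul_dvd_mul_iff_left (pow_ne_zero m X_ne_zero)] at h4
    obtain ⟨q, hq⟩ := h4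
    rw [hq, eval_mul, h3, zero_mul] at hw0
    exact hw0 rfl
  have hg' : IsUnit g' := by
    by_contra hnu
    have hg'ne : g' ≠ 0 := by
      rintro rfl
      simp at hg'0
    obtain ⟨c, hc⟩ := IsAlgClosed.exists_root g' (fun hdeg => hnu (isUnit_iff_degree_eq_zero.2 hdeg))
    have hc0 : c ≠ 0 := by
      rintro rfl
      exact hg'0 hc
    have hvan : ∀ r : Algebra.adjoin k {x0, y0}, (r : K) ∈ a → (φ r).eval c = 0 := by
      intro r hr
      obtain ⟨q, hq⟩ := (hgmem _).1 (Ideal.mem_map_of_mem φ (show r ∈ I from hr))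
      rw [hq, eval_mul, eval_mul, hc.eq_zero]
      simp
    have hPc : P.eval c = 0 := by
      have := hvan (aeval X0 P) (by rw [coe_aeval_subalgebra]; exact hP)
      rwa [← Polynomial.aeval_algHom_apply, hφX, aeval_X_left_apply] at this
    have hQc : Q.eval (lam * c) = 0 := by
      have := hvan (aeval Y0 Q) (by rw [coe_aeval_subalgebra]; exact hQ)
      rw [← Polynomial.aeval_algHom_apply, hφY] at this
      change (evalRingHom c) _ = 0 at this
      rw [Polynomial.aeval_def, hom_eval₂] at this
      have e : (evalRingHom c).comp (algebraMap k k[X]) = RingHom.id k := by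
        ext; simp
      rw [e] at this
      simpa using this
    exact hlam2 _ hQc _ hPc (by field_simp)
  have hXm : X ^ m ∈ I.map φ := (hgmem _).2 (by
    obtain ⟨w, rfl⟩ := hg'
    exact ⟨((w⁻¹ : k[X]ˣ) : k[X]), by simp [mul_assoc]⟩)
  obtain ⟨⟨f, hfR⟩, hf, hfφ⟩ := (Ideal.mem_map_iff_of_surjective φ hφsurj).1 hXm
  have hfa : f ∈ a := hf
  refine ⟨s, x0, m, he2.trans he, hm1, h2, ?_, ?_, f, hfa, ?_⟩
  · rw [planeRing, he2]
    exact haR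
  · exact (ham.trans hord.ge).trans inf_le_right
  · obtain ⟨T, r', hr', e⟩ := exists_eq_aeval_add s x0 (he2.ge hfR)
    have e' : (⟨f, hfR⟩ : Algebra.adjoin k {x0, y0}) =
        aeval X0 T + ⟨s, hsR⟩ * ⟨r', he2.le hr'⟩ := by
      apply Subtype.ext
      simp only [X0, coe_aeval_subalgebra, Subalgebra.coe_add, Subalgebra.coe_mul]
      exact e
    rw [e', map_add, map_mul, hφS, zero_mul, add_zero, ← Polynomial.aeval_algHom_apply, hφX,
      aeval_X_left_apply] at hfφ
    exact ⟨-r', neg_mem hr', by rw [e, hfφ]; simp⟩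

theorem exists_relLength_closure_dvd [IsAlgClosed k] {p n : ℕ} (hp : p.Prime) (hp5 : 5 ≤ p)
    (hpn : p ∣ n) (D : ℕ) : ∀ {x y : K}, MonIndep k x y → ∀ {a : Submodule k K},
    a ≤ planeRing k x y → (∀ r ∈ planeRing k x y, ∀ g ∈ a, r * g ∈ a) →
    relLength a (planeRing k x y) = D → ∃ d : ℕ, p ∣ d ∧
      relLength (planeRing k x y ⊓ intClosure (Algebra.adjoin k {x, y}) (a ^ n))
        (planeRing k x y) = d := by
  induction D using Nat.strong_induction_on with
  | _ D ih =>
  intro x y h a ha hmul hD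
  by_cases h1 : (1 : K) ∈ a
  · refine ⟨0, dvd_zero _, ?_⟩
    have h2 : planeRing k x y ⊓ intClosure (Algebra.adjoin k {x, y}) (a ^ n) = planeRing k x y := by
      refine inf_eq_left.2 fun r hr => ?_
      have := mul_mem_intClosure hr (le_intClosure (Algebra.adjoin k {x, y}) _
        (Submodule.pow_mem_pow a h1 n))
      simpa using this
    rw [h2, relLength_self]
    rfl
  · obtain ⟨s, t, m, he, hm, hgood⟩ := exists_goodCoordinates h ha hmul h1 (by simp [hD])
    have hle := hgood.relLength_weakTransform_add_le
    have hs := hgood.indep.ne_zero_left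
    have heR : planeRing k s t = planeRing k x y := by rw [planeRing, he]
    rw [heR, hD] at hle
    obtain ⟨D1, hD1⟩ := ENat.ne_top_iff_exists.1
      (ne_top_of_le_ne_top (ENat.natCast_ne_top D) (le_add_self.trans hle))
    rw [← hD1, ← Nat.cast_add, Nat.cast_le] at hle
    have hpos : 1 ≤ ∑ i ∈ Finset.range m, (i + 1) := by
      obtain ⟨l, rfl⟩ := Nat.exists_eq_add_of_le' hm
      rw [Finset.sum_range_succ]
      omega
    obtain ⟨d, hd, hd'⟩ := ih D1 (by omega) hgood.indep.div (weakTransform_le hs hgood.le_scale)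
      (fun r hr g hg => mul_mem_weakTransform hr hg) hD1.symm
    have h3 := hgood.relLength_closure n
    rw [hd', ← Nat.cast_add, heR, he] at h3
    exact ⟨_, dvd_add (Nat.dvd_sum_range_succ hp hp5 (hpn.mul_left m)) hd, h3⟩

end ExistsGood

section DegreeFiltration

variable {k K : Type*} [Field k] [Field K] [Algebra k K]

theorem MonIndep.swap {x y : K} (h : MonIndep k x y) : MonIndep k y x := by
  unfold MonIndep at *
  have := h.comp Prod.swap Prod.swap_injective
  have e : (fun i : ℕ × ℕ => y ^ i.1 * x ^ i.2) =
      (fun i : ℕ × ℕ => x ^ i.1 * y ^ i.2) ∘ Prod.swap := by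
    funext i
    simp [mul_comm]
  rwa [e]

theorem MonIndep.inv_div {x y : K} (h : MonIndep k x y) : MonIndep k x⁻¹ (y / x) := by
  have hs := h.ne_zero_left
  unfold MonIndep
  rw [linearIndependent_iff_finset_linearIndependent]
  intro F
  obtain ⟨M, hM⟩ : ∃ M, ∀ i ∈ F, i.1 + i.2 ≤ M :=
    ⟨F.sup fun i => i.1 + i.2, fun i hi => Finset.le_sup (f := fun i : ℕ × ℕ => i.1 + i.2) hi⟩
  refine LinearIndependent.of_comp (LinearMap.mulLeft k (x ^ M)) ?_
  have e : LinearMap.mulLeft k (x ^ M) ∘ ((fun i : ℕ × ℕ => x⁻¹ ^ i.1 * (y / x) ^ i.2) ∘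
      (Subtype.val : F → ℕ × ℕ)) = (fun i : ℕ × ℕ => x ^ i.1 * y ^ i.2) ∘
        fun i : F => (M - i.1.1 - i.1.2, i.1.2) := by
    funext ⟨⟨i, j⟩, hi⟩
    have := hM _ hi
    simp only at this
    simp only [Function.comp_apply, LinearMap.mulLeft_apply]
    obtain ⟨l, rfl⟩ := Nat.exists_eq_add_of_le this
    rw [show i + j + l - i - j = l by omega, div_pow, pow_add, pow_add, inv_pow]
    field_simp
  rw [e]
  refine h.comp _ ?_
  rintro ⟨⟨i, j⟩, hi⟩ ⟨⟨i', j'⟩, hi'⟩ he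
  have h1 := hM _ hi
  have h2 := hM _ hi'
  simp only [Prod.mk.injEq] at he h1 h2
  ext <;> simp <;> omega

/-- The span of `1, x, y`. -/
abbrev linForms (k : Type*) {K : Type*} [Field k] [Field K] [Algebra k K] (x y : K) :
    Submodule k K :=
  Submodule.span k {1, x, y}

theorem one_mem_linForms (x y : K) : (1 : K) ∈ linForms k x y := Submodule.subset_span (by simp)

theorem linForms_pow_mono (x y : K) {M N : ℕ} (h : M ≤ N) :
    linForms k x y ^ M ≤ linForms k x y ^ N :=
  pow_le_pow_right' (Submodule.one_le.2 (one_mem_linForms x y)) h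

theorem linForms_comm (x y : K) : linForms k x y = linForms k y x := by
  rw [linForms, Set.pair_comm]

theorem pow_mul_pow_mem_linForms (x y : K) {i j N : ℕ} (h : i + j ≤ N) :
    x ^ i * y ^ j ∈ linForms k x y ^ N := by
  refine linForms_pow_mono x y h ?_
  rw [pow_add]
  exact Submodule.mul_mem_mul (Submodule.pow_mem_pow _ (Submodule.subset_span (by simp)) _)
    (Submodule.pow_mem_pow _ (Submodule.subset_span (by simp)) _)

theorem linForms_pow_eq_span (x y : K) (N : ℕ) : linForms k x y ^ N =
    Submodule.span k ((fun i : ℕ × ℕ => x ^ i.1 * y ^ i.2) '' {i | i.1 + i.2 ≤ N}) := by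
  refine le_antisymm ?_ ?_
  · induction N with
    | zero =>
      rw [pow_zero, Submodule.one_le]
      exact Submodule.subset_span ⟨(0, 0), by simp, by simp⟩
    | succ N ih =>
      rw [pow_succ]
      refine (mul_le_mul' ih le_rfl).trans ?_
      rw [linForms, Submodule.span_mul_span, Submodule.span_le]
      rintro _ ⟨_, ⟨⟨i, j⟩, hij, rfl⟩, b, hb, rfl⟩
      have hij' : i + j ≤ N := hij
      rcases hb with rfl | rfl | rfl
      · exact Submodule.subset_span ⟨(i, j), show i + j ≤ N + 1 by omega, by simp⟩
      · exact Submodule.subset_span ⟨(i + 1, j), show i + 1 + j ≤ N + 1 by omega,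
          by simp only; ring⟩
      · exact Submodule.subset_span ⟨(i, j + 1), show i + (j + 1) ≤ N + 1 by omega,
          by simp only; ring⟩
  · rw [Submodule.span_le]
    rintro _ ⟨⟨i, j⟩, hij, rfl⟩
    exact pow_mul_pow_mem_linForms x y hij

theorem linForms_pow_le_planeRing (x y : K) (N : ℕ) :
    linForms k x y ^ N ≤ planeRing k x y := by
  refine (pow_le_pow_left' ?_ N).trans (Subalgebra.toSubmodule_pow_le _ N)
  rw [linForms, Submodule.span_le]
  rintro _ (rfl | rfl | rfl)
  · exact Subalgebra.one_mem _
  · exact left_mem_adjoin_pair _ _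
  · exact right_mem_adjoin_pair _ _

theorem exists_mem_linForms_pow {x y r : K} (hr : r ∈ planeRing k x y) :
    ∃ N, r ∈ linForms k x y ^ N := by
  rw [planeRing, toSubmodule_adjoin_pair] at hr
  induction hr using Submodule.span_induction with
  | mem z hz =>
    obtain ⟨⟨i, j⟩, rfl⟩ := hz
    exact ⟨i + j, pow_mul_pow_mem_linForms x y le_rfl⟩
  | zero => exact ⟨0, zero_mem _⟩
  | add a b _ _ ha hb =>
    obtain ⟨M, hM⟩ := ha
    obtain ⟨N, hN⟩ := hb
    exact ⟨max M N, add_mem (linForms_pow_mono x y (le_max_left _ _) hM)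
      (linForms_pow_mono x y (le_max_right _ _) hN)⟩
  | smul c a _ ha =>
    obtain ⟨M, hM⟩ := ha
    exact ⟨M, Submodule.smul_mem _ c hM⟩

theorem relLength_linForms_pow {x y : K} (h : MonIndep k x y) (N : ℕ) :
    relLength ⊥ (linForms k x y ^ N) = ((∑ i ∈ Finset.range (N + 1), (i + 1) : ℕ) : ℕ∞) := by
  let F : Finset (ℕ × ℕ) := ((Finset.range (N + 1)).sigma fun i => Finset.range (i + 1)).image
    fun x => (x.1 - x.2, x.2)
  have hF : ∀ i, i ∈ F ↔ i.1 + i.2 ≤ N := by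
    rintro ⟨i, j⟩
    simp only [F, Finset.mem_image, Finset.mem_sigma, Finset.mem_range, Prod.mk.injEq]
    constructor
    · rintro ⟨⟨a, b⟩, h1, h2⟩
      simp only at h1 h2
      omega
    · intro h1
      exact ⟨⟨i + j, j⟩, ⟨by simp only; omega, by simp only; omega⟩, by simp⟩
  have hcard : F.card = ∑ i ∈ Finset.range (N + 1), (i + 1) := by
    rw [Finset.card_image_of_injOn, Finset.card_sigma]
    · simp
    · rintro ⟨a, b⟩ h1 ⟨c, d⟩ h2 he
      simp only [Finset.coe_sigma, Set.mem_sigma_iff, Finset.mem_coe, Finset.mem_range,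
        Prod.mk.injEq] at h1 h2 he
      obtain ⟨he, rfl⟩ := he
      obtain rfl : a = c := by omega
      rfl
  have hset : {i : ℕ × ℕ | i.1 + i.2 ≤ N} = (F : Set (ℕ × ℕ)) ∪ ∅ := by
    ext i
    simp only [Set.mem_ofPred_eq, Set.union_empty, Finset.mem_coe, hF]
  have := LinearIndependent.relLength_span h F ∅ (Set.disjoint_empty _)
  rwa [← hset, ← linForms_pow_eq_span, Set.image_empty, Submodule.span_empty, hcard] at this

/-- `x^N` times the degree filtration of the chart at infinity. -/
theorem linForms_pow_eq_span_chart {x : K} (hx : x ≠ 0) (y : K) {N D : ℕ} (h : N ≤ D) :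
    scale (x⁻¹ ^ D) (linForms k x y ^ N) =
    Submodule.span k ((fun i : ℕ × ℕ => x⁻¹ ^ i.1 * (y / x) ^ i.2) ''
      {i | i.1 + i.2 ≤ D ∧ D - N ≤ i.1}) := by
  obtain ⟨l, rfl⟩ := Nat.exists_eq_add_of_le h
  rw [linForms_pow_eq_span, scale, Submodule.map_span]
  congr 1
  ext z
  constructor
  · rintro ⟨_, ⟨⟨i, j⟩, hij, rfl⟩, rfl⟩
    obtain ⟨m, rfl⟩ := Nat.exists_eq_add_of_le (show i + j ≤ N from hij)
    refine ⟨(l + m, j), ⟨show l + m + j ≤ i + j + m + l by omega, by simp⟩, ?_⟩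
    simp only [pow_add, div_pow, LinearMap.mulLeft_apply, inv_pow]
    field_simp
  · rintro ⟨⟨i, j⟩, ⟨hij, hi⟩, rfl⟩
    simp only at hij hi
    obtain ⟨m, rfl⟩ := Nat.exists_eq_add_of_le (show l ≤ i by omega)
    obtain ⟨q, rfl⟩ := Nat.exists_eq_add_of_le (show m + j ≤ N by omega)
    refine ⟨_, ⟨(q, j), show q + j ≤ m + j + q by omega, rfl⟩, ?_⟩
    simp only [pow_add, div_pow, LinearMap.mulLeft_apply, inv_pow]
    field_simp

theorem mem_linForms_pow_of_mem_intClosure [Infinite k] {x y : K} (h : MonIndep k x y)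
    {Z : Submodule k K} {N : ℕ} (hZ : Z ≤ linForms k x y ^ N) {b : K}
    (hb : b ∈ planeRing k x y) (hbZ : b ∈ intClosure ⊥ Z) : b ∈ linForms k x y ^ N := by
  have hx := h.ne_zero_left
  obtain ⟨D, hbD, hD⟩ : ∃ D, b ∈ linForms k x y ^ D ∧ N ≤ D := by
    obtain ⟨D, hD⟩ := exists_mem_linForms_pow hb
    exact ⟨max D N, linForms_pow_mono x y (le_max_left _ _) hD, le_max_right _ _⟩
  have hmem : x⁻¹ ^ D * b ∈ scale (x⁻¹ ^ D) (linForms k x y ^ D) := ⟨b, hbD, rfl⟩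
  have h1 : scale (x⁻¹ ^ D) Z ≤ scale (x⁻¹ ^ (D - N)) (planeRing k x⁻¹ (y / x)) := by
    refine (Submodule.map_mono hZ).trans ?_
    refine (linForms_pow_eq_span_chart hx y hD).le.trans ?_
    rw [scale_planeRing_eq_span]
    exact Submodule.span_mono (Set.image_mono fun i hi => hi.2)
  rw [linForms_pow_eq_span_chart hx y le_rfl] at hmem
  have h2 := mem_scale_of_mem_intClosure h.inv_div h1 (b := x⁻¹ ^ D * b) (by
    rw [planeRing, toSubmodule_adjoin_pair]
    exact Submodule.span_mono (Set.image_subset_range _ _) hmem) (by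
    intro v hv
    obtain ⟨w, hw, c, hc, e⟩ := hbZ v fun z hz => by
      obtain ⟨z, rfl⟩ := Algebra.mem_bot.1 hz
      exact hv _ (Subalgebra.algebraMap_mem _ z)
    exact ⟨_, ⟨w, hw, rfl⟩, c, hc, by simp only [e, LinearMap.mulLeft_apply]; ring⟩)
  rw [scale_planeRing_eq_span] at h2
  have h3 := LinearIndependent.span_image_inf h.inv_div _ _ ▸ Submodule.mem_inf.2 ⟨hmem, h2⟩
  have h4 : x⁻¹ ^ D * b ∈ scale (x⁻¹ ^ D) (linForms k x y ^ N) := by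
    rw [linForms_pow_eq_span_chart hx y hD]
    refine Submodule.span_mono (Set.image_mono ?_) h3
    rintro i ⟨hi, hi'⟩
    exact ⟨hi.1, hi'⟩
  obtain ⟨b', hb', e⟩ := h4
  have : x⁻¹ ^ D ≠ 0 := pow_ne_zero _ (inv_ne_zero hx)
  rwa [← mul_left_cancel₀ this e]

theorem mem_adjoin_pair_of_forall_valuationSubring {x y : K} (h : MonIndep k x y)
    [IsFractionRing (Algebra.adjoin k {x, y}) K] {b : K}
    (hb : ∀ v : ValuationSubring K, (∀ z ∈ Algebra.adjoin k {x, y}, z ∈ v) → b ∈ v) :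
    b ∈ Algebra.adjoin k {x, y} := by
  have h' := (monIndep_iff x y).1 h
  have hr : Set.range ![x, y] = {x, y} := by
    ext z
    simp [eq_comm, or_comm]
  have : IsIntegrallyClosed (Algebra.adjoin k (Set.range ![x, y])) :=
    IsIntegrallyClosed.of_equiv h'.aevalEquiv.toRingEquiv
  rw [hr] at this
  have h1 := iInf_valuationSubring_superset (s := (Algebra.adjoin k {x, y} : Set K))
  have h2 : b ∈ (integralClosure (Subring.closure (Algebra.adjoin k {x, y} : Set K)) K).toSubring := by
    rw [← h1, Subring.mem_iInf]
    rintro ⟨v, hv⟩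
    exact hb v fun z hz => hv hz
  have h3 : IsIntegral (Subring.closure (Algebra.adjoin k {x, y} : Set K)) b := h2
  have h4 : IsIntegral (Algebra.adjoin k {x, y}) b := by
    let f : Subring.closure (Algebra.adjoin k {x, y} : Set K) →+* Algebra.adjoin k {x, y} :=
      (Subring.inclusion (T := (Algebra.adjoin k {x, y}).toSubring)
        (Subring.closure_le.2 fun _ hz => hz))
    have := IsIntegral.map_of_comp_eq f (RingHom.id K) (by ext; rfl) h3
    exact this
  obtain ⟨c, rfl⟩ := (IsIntegrallyClosed.isIntegral_iff (R := Algebra.adjoin k {x, y})).1 h4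
  exact c.2

end DegreeFiltration

section BaseCurve

variable {k K : Type*} [Field k] [Field K] [Algebra k K]

/-- The leading forms of degree `e` of the elements of `W` do not vanish simultaneously at a point of
the line at infinity of the chart `x ≠ 0`. -/
def TopFree (x y : K) (e : ℕ) (W : Submodule k K) : Prop :=
  (1 : K) ∈ scale x⁻¹ (planeRing k x⁻¹ (y / x)) ⊔ planeRing k x⁻¹ (y / x) * scale (x ^ e)⁻¹ W

theorem exists_pow_mul_mem_linForms {x : K} (hx : x ≠ 0) {y r : K}
    (hr : r ∈ planeRing k x⁻¹ (y / x)) : ∃ L0, ∀ L, L0 ≤ L → x ^ L * r ∈ linForms k x y ^ L := by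
  rw [planeRing, toSubmodule_adjoin_pair] at hr
  induction hr using Submodule.span_induction with
  | mem z hz =>
    obtain ⟨⟨i, j⟩, rfl⟩ := hz
    refine ⟨i + j, fun L hL => ?_⟩
    obtain ⟨l, rfl⟩ := Nat.exists_eq_add_of_le hL
    have := pow_mul_pow_mem_linForms (k := k) x y (show l + j ≤ i + j + l by omega)
    convert this using 1
    simp only [pow_add, div_pow, inv_pow]
    field_simp
  | zero => exact ⟨0, fun L _ => by simp⟩
  | add a b _ _ ha hb =>
    obtain ⟨M, hM⟩ := ha
    obtain ⟨N, hN⟩ := hb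
    refine ⟨max M N, fun L hL => ?_⟩
    rw [mul_add]
    exact add_mem (hM L (le_of_max_le_left hL)) (hN L (le_of_max_le_right hL))
  | smul c a _ ha =>
    obtain ⟨M, hM⟩ := ha
    refine ⟨M, fun L hL => ?_⟩
    rw [mul_smul_comm]
    exact Submodule.smul_mem _ c (hM L hL)

theorem exists_pow_mul_mem_linForms_mul {x : K} (hx : x ≠ 0) {y z : K} {e : ℕ} {W : Submodule k K}
    (hz : z ∈ planeRing k x⁻¹ (y / x) * scale (x ^ e)⁻¹ W) :
    ∃ L0, ∀ L, L0 ≤ L → x ^ L * z ∈ linForms k x y ^ (L - e) * W := by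
  induction hz using Submodule.mul_induction_on' with
  | mem_mul_mem r hr w hw =>
    obtain ⟨w, hw, rfl⟩ := hw
    obtain ⟨L0, hL0⟩ := exists_pow_mul_mem_linForms hx hr
    refine ⟨L0 + e, fun L hL => ?_⟩
    obtain ⟨l, rfl⟩ := Nat.exists_eq_add_of_le' (show e ≤ L by omega)
    have := Submodule.mul_mem_mul (hL0 l (by omega)) hw
    rw [Nat.add_sub_cancel]
    convert this using 1
    simp only [LinearMap.mulLeft_apply, pow_add]
    field_simp
  | add a _ b _ ha hb =>
    obtain ⟨M, hM⟩ := ha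
    obtain ⟨N, hN⟩ := hb
    refine ⟨max M N, fun L hL => ?_⟩
    rw [mul_add]
    exact add_mem (hM L (le_of_max_le_left hL)) (hN L (le_of_max_le_right hL))

theorem TopFree.exists_pow_mem {x y : K} (hx : x ≠ 0) {e : ℕ} {W : Submodule k K}
    (h : TopFree x y e W) : ∃ L0, ∀ L, L0 ≤ L →
      x ^ L ∈ linForms k x y ^ (L - 1) ⊔ linForms k x y ^ (L - e) * W := by
  obtain ⟨_, ⟨r, hr, rfl⟩, z, hz, e1⟩ := Submodule.mem_sup.1 h
  obtain ⟨M, hM⟩ := exists_pow_mul_mem_linForms hx hr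
  obtain ⟨N, hN⟩ := exists_pow_mul_mem_linForms_mul hx hz
  refine ⟨M + N + 1, fun L hL => ?_⟩
  refine Submodule.mem_sup.2 ⟨_, hM (L - 1) (by omega), _, hN L (by omega), ?_⟩
  obtain ⟨l, rfl⟩ := Nat.exists_eq_add_of_le' (show 1 ≤ L by omega)
  have e2 : x ^ (l + 1) = x ^ (l + 1) * (x⁻¹ * r + z) := by
    rw [show x⁻¹ * r + z = 1 from e1, mul_one]
  conv_rhs => rw [e2]
  rw [Nat.add_sub_cancel, mul_add, pow_succ, ← mul_assoc, mul_assoc _ x x⁻¹,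
    mul_inv_cancel₀ hx, mul_one]

theorem TopFree.exists_pow_le {x y : K} (hx : x ≠ 0) (hy : y ≠ 0) {e : ℕ} {W : Submodule k K}
    (h1 : TopFree x y e W) (h2 : TopFree y x e W) : ∃ D0, ∀ D, D0 ≤ D →
      linForms k x y ^ D ≤ linForms k x y ^ (D - 1) ⊔ linForms k x y ^ (D - e) * W := by
  obtain ⟨L1, hL1⟩ := h1.exists_pow_mem hx
  obtain ⟨L2, hL2⟩ := h2.exists_pow_mem hy
  rw [linForms_comm] at hL2
  obtain ⟨L0, hL01, hL02, hL0e, hL0⟩ : ∃ L0, L1 ≤ L0 ∧ L2 ≤ L0 ∧ e ≤ L0 ∧ 1 ≤ L0 :=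
    ⟨L1 + L2 + e + 1, by omega, by omega, by omega, by omega⟩
  have hmul : ∀ i j z w, L0 ≤ i → z ∈ linForms k x y ^ (i - 1) ⊔ linForms k x y ^ (i - e) * W →
      w ∈ linForms k x y ^ j →
      z * w ∈ linForms k x y ^ (i + j - 1) ⊔ linForms k x y ^ (i + j - e) * W := by
    intro i j z w hi hz hw
    have := Submodule.mul_mem_mul hz hw
    rw [Submodule.sup_mul, mul_right_comm, ← pow_add, ← pow_add] at this
    rwa [show i + j - 1 = i - 1 + j by omega, show i + j - e = i - e + j by omega]
  refine ⟨2 * L0, fun D hD => ?_⟩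
  conv_lhs => rw [linForms_pow_eq_span]
  rw [Submodule.span_le]
  rintro _ ⟨⟨i, j⟩, hij, rfl⟩
  have hij' : i + j ≤ D := hij
  rcases hij'.lt_or_eq with hlt | rfl
  · exact Submodule.mem_sup_left (pow_mul_pow_mem_linForms x y (by omega))
  by_cases hi : L0 ≤ i
  · refine hmul i j _ _ hi (hL1 i (by omega)) ?_
    simpa using pow_mul_pow_mem_linForms (k := k) x y (show 0 + j ≤ j by omega)
  · have := hmul j i (y ^ j) (x ^ i) (by omega) (hL2 j (by omega)) (by
      simpa using pow_mul_pow_mem_linForms (k := k) x y (show i + 0 ≤ i by omega))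
    rwa [mul_comm (y ^ j), add_comm j i] at this

theorem linForms_pow_le_of_step {x y : K} {e D0 : ℕ} {W : Submodule k K}
    (hW : W ≤ linForms k x y ^ e)
    (h : ∀ D, D0 ≤ D →
      linForms k x y ^ D ≤ linForms k x y ^ (D - 1) ⊔ linForms k x y ^ (D - e) * W) (hD0 : 1 ≤ D0)
    (n D : ℕ) (hD : D0 + n * e ≤ D) :
    linForms k x y ^ D ≤ linForms k x y ^ (D - 1) ⊔ linForms k x y ^ (D - n * e) * W ^ n := by
  induction n generalizing D with
  | zero => simp
  | succ n ih =>
    rw [add_mul, one_mul] at hD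
    refine (h D (by omega)).trans (sup_le le_sup_left ?_)
    refine (mul_le_mul' (ih (D - e) (by omega)) le_rfl).trans ?_
    rw [Submodule.sup_mul, mul_assoc, ← pow_succ]
    refine sup_le ?_ ?_
    · refine le_trans ?_ le_sup_left
      refine (mul_le_mul' le_rfl hW).trans ?_
      rw [← pow_add]
      exact linForms_pow_mono x y (by omega)
    · rw [show D - (n + 1) * e = D - e - n * e by rw [add_mul, one_mul]; omega]
      exact le_sup_right

theorem planeRing_le_sup {x y : K} {D0 : ℕ} {I : Submodule k K}
    (h : ∀ D, D0 < D → linForms k x y ^ D ≤ linForms k x y ^ (D - 1) ⊔ I) :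
    planeRing k x y ≤ linForms k x y ^ D0 ⊔ I := by
  have key : ∀ l, linForms k x y ^ (D0 + l) ≤ linForms k x y ^ D0 ⊔ I := by
    intro l
    induction l with
    | zero => exact le_sup_left
    | succ l ih => exact (h _ (by omega)).trans (sup_le ih le_sup_right)
  intro r hr
  obtain ⟨N, hN⟩ := exists_mem_linForms_pow hr
  exact key N (linForms_pow_mono x y (by omega) hN)

/-- A valuation ring not containing `x` but containing `y / x` sees `W` through its leading forms. -/
theorem TopFree.exists_valuation {x y : K} {e : ℕ} {W : Submodule k K}
    (h : TopFree x y e W) (v : ValuationSubring K) (hk : ∀ c : k, algebraMap k K c ∈ v) (hx : x ∉ v)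
    (hyx : y / x ∈ v) : (∀ r ∈ planeRing k x⁻¹ (y / x), r ∈ v) ∧ ∃ w ∈ W, ∃ c ∈ v, x ^ e = c * w := by
  have hx0 : x ≠ 0 := by
    rintro rfl
    exact hx v.zero_mem
  have hxv : 1 < v.valuation x := by
    rwa [← not_le, v.valuation_le_one_iff]
  have hR : ∀ r ∈ Algebra.adjoin k {x⁻¹, y / x}, r ∈ v := by
    intro r hr
    induction hr using Algebra.adjoin_induction with
    | mem z hz =>
      rcases hz with rfl | rfl
      · exact (v.mem_or_inv_mem x).resolve_left hx
      · exact hyx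
    | algebraMap c => exact hk c
    | add a b _ _ ha hb => exact v.add_mem _ _ ha hb
    | mul a b _ _ ha hb => exact v.mul_mem _ _ ha hb
  refine ⟨hR, ?_⟩
  obtain ⟨_, ⟨r, hr, rfl⟩, z, hz, e1⟩ := Submodule.mem_sup.1 h
  obtain ⟨_, ⟨w, hw, rfl⟩, c, hc, rfl⟩ := ValuationSubring.exists_of_mem_mul hR hz
  simp only [LinearMap.mulLeft_apply] at e1
  have h1 : v.valuation (x⁻¹ * r) < 1 := by
    rw [map_mul, map_inv₀]
    refine (mul_le_of_le_one_right' ((v.valuation_le_one_iff r).2 (hR r hr))).trans_lt ?_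
    exact inv_lt_one_of_one_lt₀ hxv
  have h2 : v.valuation (1 - x⁻¹ * r) = 1 := Valuation.map_one_sub_of_lt _ h1
  have h3 : (1 - x⁻¹ * r)⁻¹ ∈ v := by
    rw [← v.valuation_le_one_iff, map_inv₀, h2, inv_one]
  have h4 : (1 - x⁻¹ * r) ≠ 0 := by
    intro h0
    rw [h0, map_zero] at h2
    exact zero_ne_one h2
  refine ⟨w, hw, (1 - x⁻¹ * r)⁻¹ * c, v.mul_mem _ _ h3 hc, ?_⟩
  have h5 : 1 - x⁻¹ * r = c * ((x ^ e)⁻¹ * w) := by rw [← e1]; ring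
  have hxe := pow_ne_zero e hx0
  have h6 : c * w = (1 - x⁻¹ * r) * x ^ e := by rw [h5]; field_simp
  rw [mul_assoc, h6, ← mul_assoc, inv_mul_cancel₀ h4, one_mul]

theorem TopFree.exists_of_mem_linForms {x y : K} {e n : ℕ} {W : Submodule k K}
    (h : TopFree x y e W) (v : ValuationSubring K) (hk : ∀ c : k, algebraMap k K c ∈ v) (hx : x ∉ v)
    (hyx : y / x ∈ v) {b : K} (hb : b ∈ linForms k x y ^ (n * (e + 1))) :
    ∃ w ∈ (linForms k x y * W) ^ n, ∃ c ∈ v, b = c * w := by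
  have hx0 : x ≠ 0 := by
    rintro rfl
    exact hx v.zero_mem
  obtain ⟨hR, w, hw, c, hc, e1⟩ := h.exists_valuation v hk hx hyx
  have h1 : x⁻¹ ^ (n * (e + 1)) * b ∈ planeRing k x⁻¹ (y / x) := by
    have : x⁻¹ ^ (n * (e + 1)) * b ∈ scale (x⁻¹ ^ (n * (e + 1))) (linForms k x y ^ (n * (e + 1))) :=
      ⟨b, hb, rfl⟩
    rw [linForms_pow_eq_span_chart hx0 y le_rfl] at this
    rw [planeRing, toSubmodule_adjoin_pair]
    exact Submodule.span_mono (Set.image_subset_range _ _) this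
  refine ⟨(x * w) ^ n, Submodule.pow_mem_pow _
    (Submodule.mul_mem_mul (Submodule.subset_span (by simp)) hw) n,
    c ^ n * (x⁻¹ ^ (n * (e + 1)) * b), v.mul_mem _ _ (pow_mem hc n) (hR _ h1), ?_⟩
  have hxn := pow_ne_zero (n * (e + 1)) hx0
  have h2 : c ^ n * (x * w) ^ n = x ^ (n * (e + 1)) := by
    rw [← mul_pow, mul_left_comm, ← e1, ← pow_succ', ← pow_mul, mul_comm]
  rw [mul_right_comm, h2, inv_pow, mul_inv_cancel_left₀ hxn]

theorem intClosure_bot_pow_eq [Infinite k] {x y : K} (h : MonIndep k x y)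
    [IsFractionRing (Algebra.adjoin k {x, y}) K] {e n : ℕ} {W : Submodule k K}
    (hW : W ≤ linForms k x y ^ e) (h1 : TopFree x y e W) (h2 : TopFree y x e W) :
    intClosure ⊥ ((linForms k x y * W) ^ n) = linForms k x y ^ (n * (e + 1)) ⊓
      (planeRing k x y ⊓ intClosure (Algebra.adjoin k {x, y}) ((planeRing k x y * W) ^ n)) := by
  have hx := h.ne_zero_left
  have hy := h.ne_zero_right
  have hlin : linForms k x y ≤ planeRing k x y := by simpa using linForms_pow_le_planeRing (k := k) x y 1
  have hWn : (linForms k x y * W) ^ n ≤ linForms k x y ^ (n * (e + 1)) := by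
    rw [mul_comm n, pow_mul]
    refine pow_le_pow_left' ?_ n
    rw [pow_succ']
    exact mul_le_mul' le_rfl hW
  have hbot : ∀ v : ValuationSubring K, (∀ z ∈ (⊥ : Subalgebra k K), z ∈ v) ↔
      ∀ c : k, algebraMap k K c ∈ v := by
    intro v
    constructor
    · exact fun hv c => hv _ (Subalgebra.algebraMap_mem _ c)
    · intro hv z hz
      obtain ⟨c, rfl⟩ := Algebra.mem_bot.1 hz
      exact hv c
  have hle : (linForms k x y * W) ^ n ≤ (planeRing k x y * W) ^ n :=
    pow_le_pow_left' (mul_le_mul' hlin le_rfl) n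
  refine le_antisymm ?_ ?_
  · intro b hb
    have hbR : b ∈ planeRing k x y := by
      refine mem_adjoin_pair_of_forall_valuationSubring h fun v hv => ?_
      obtain ⟨w, hw, c, hc, rfl⟩ := hb v fun z hz => hv z (bot_le (a := Algebra.adjoin k {x, y}) hz)
      exact v.mul_mem _ _ hc (hv _ (linForms_pow_le_planeRing x y _ (hWn hw)))
    exact ⟨mem_linForms_pow_of_mem_intClosure h hWn hbR hb, hbR, intClosure_mono bot_le hle hb⟩
  · rintro b ⟨hbU, hbR, hbI⟩ v hv
    have hk := (hbot v).1 hv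
    by_cases hR : x ∈ v ∧ y ∈ v
    · have hRv : ∀ r ∈ Algebra.adjoin k {x, y}, r ∈ v := by
        intro r hr
        induction hr using Algebra.adjoin_induction with
        | mem z hz =>
          rcases hz with rfl | rfl
          exacts [hR.1, hR.2]
        | algebraMap c => exact hk c
        | add a b _ _ ha hb => exact v.add_mem _ _ ha hb
        | mul a b _ _ ha hb => exact v.mul_mem _ _ ha hb
      obtain ⟨w, hw, c, hc, rfl⟩ := hbI v hRv
      obtain ⟨w', hw', c', hc', rfl⟩ := ValuationSubring.exists_of_mem_mul hRv
        (pow_mul_le (Algebra.adjoin k {x, y}) W n hw)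
      refine ⟨w', ?_, c * c', v.mul_mem _ _ hc hc', by ring⟩
      have hWW : W ≤ linForms k x y * W := fun z hz => by
        have := Submodule.mul_mem_mul (one_mem_linForms (k := k) x y) hz
        rwa [one_mul] at this
      exact pow_le_pow_left' hWW n hw'
    · by_cases hyx : y / x ∈ v
      · have hxv : x ∉ v := fun hxv => hR ⟨hxv, by
          have := v.mul_mem _ _ hyx hxv
          rwa [div_mul_cancel₀ _ hx] at this⟩
        exact h1.exists_of_mem_linForms v hk hxv hyx hbU
      · have hxy : x / y ∈ v := by
          have := (v.mem_or_inv_mem (y / x)).resolve_left hyx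
          rwa [inv_div] at this
        have hyv : y ∉ v := fun hyv => hR ⟨by
          have := v.mul_mem _ _ hxy hyv
          rwa [div_mul_cancel₀ _ hy] at this, hyv⟩
        rw [linForms_comm] at hbU ⊢
        exact h2.exists_of_mem_linForms v hk hyv hxy hbU

theorem planeRing_relLength_closure [Infinite k] {x y : K} (h : MonIndep k x y)
    [IsFractionRing (Algebra.adjoin k {x, y}) K] {e n : ℕ} {W : Submodule k K}
    (hW : W ≤ linForms k x y ^ e) (h1 : TopFree x y e W) (h2 : TopFree y x e W)
    {D0 : ℕ} (hD0 : 1 ≤ D0) (hD : ∀ D, D0 ≤ D →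
      linForms k x y ^ D ≤ linForms k x y ^ (D - 1) ⊔ linForms k x y ^ (D - e) * W) (hn : D0 ≤ n) :
    ((∑ i ∈ Finset.range (n * (e + 1) + 1), (i + 1) : ℕ) : ℕ∞) =
      relLength ⊥ (intClosure ⊥ ((linForms k x y * W) ^ n)) +
      relLength (planeRing k x y ⊓ intClosure (Algebra.adjoin k {x, y}) ((planeRing k x y * W) ^ n))
        (planeRing k x y) := by
  set I := planeRing k x y ⊓ intClosure (Algebra.adjoin k {x, y}) ((planeRing k x y * W) ^ n)
    with hI
  have heq := intClosure_bot_pow_eq (n := n) h hW h1 h2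
  rw [← hI] at heq
  have hsup : planeRing k x y = linForms k x y ^ (n * (e + 1)) ⊔ I := by
    refine le_antisymm (planeRing_le_sup fun D hDD => ?_)
      (sup_le (linForms_pow_le_planeRing x y _) inf_le_left)
    rw [mul_add, mul_one] at hDD
    refine (linForms_pow_le_of_step hW hD hD0 n D (by omega)).trans (sup_le_sup_left ?_ _)
    refine le_inf ?_ ?_
    · refine (mul_le_mul' (linForms_pow_le_planeRing x y _)
        ((pow_le_pow_left' (hW.trans (linForms_pow_le_planeRing x y e)) n).trans
          (Subalgebra.toSubmodule_pow_le _ n))).trans ?_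
      exact (Subalgebra.isIdempotentElem_toSubmodule _).le
    · refine (mul_le_mul' (linForms_pow_le_planeRing x y _) le_rfl).trans ?_
      refine (subalgebra_mul_le_intClosure _ _).trans (intClosure_mono le_rfl ?_)
      exact pow_le_pow_left' (le_subalgebra_mul _ W) n
  rw [heq]
  conv_rhs => rw [hsup]
  rw [relLength_sup, ← relLength_inf I, ← relLength_add bot_le inf_le_left, relLength_linForms_pow h]

theorem finiteDimensional_linForms_pow (x y : K) (N : ℕ) :
    FiniteDimensional k (linForms k x y ^ N : Submodule k K) := by
  rw [← Submodule.fg_iff_finiteDimensional]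
  exact Submodule.FG.pow (Submodule.fg_span (by simp)) N

theorem intClosure_bot_pow_le [Infinite k] {x y : K} (h : MonIndep k x y)
    [IsFractionRing (Algebra.adjoin k {x, y}) K] {e : ℕ} {W : Submodule k K}
    (hW : W ≤ linForms k x y ^ e) (h1 : TopFree x y e W) (h2 : TopFree y x e W) (n : ℕ) :
    intClosure ⊥ ((linForms k x y * W) ^ n) ≤ linForms k x y ^ (n * (e + 1)) := by
  rw [intClosure_bot_pow_eq h hW h1 h2]
  exact inf_le_left

/-- The space of sections of a large multiple, divisible by `p`, of a nef and big linear system on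
a rational surface has dimension prime to `p`. -/
theorem exists_not_dvd_finrank_intClosure [IsAlgClosed k] {x y : K} (h : MonIndep k x y)
    [IsFractionRing (Algebra.adjoin k {x, y}) K] {e : ℕ} {W : Submodule k K}
    (hW : W ≤ linForms k x y ^ e) (h1 : TopFree x y e W) (h2 : TopFree y x e W)
    {p : ℕ} (hp : p.Prime) (hp5 : 5 ≤ p) :
    ∃ n0, ∀ n, n0 ≤ n → p ∣ n →
      ¬ p ∣ Module.finrank k (intClosure ⊥ ((linForms k x y * W) ^ n)) := by
  obtain ⟨D1, hD1⟩ := h1.exists_pow_le h.ne_zero_left h.ne_zero_right h2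
  have hinf : Infinite k := inferInstance
  refine ⟨D1 + 1, fun n hn hpn hdvd => ?_⟩
  have hlen := fun m hm => planeRing_relLength_closure (n := m) h hW h1 h2
    (D0 := D1 + 1) (by omega) (fun D hD => hD1 D (by omega)) hm
  have ha : planeRing k x y * W ≤ planeRing k x y := by
    refine (mul_le_mul' le_rfl (hW.trans (linForms_pow_le_planeRing x y e))).trans ?_
    exact (Subalgebra.isIdempotentElem_toSubmodule _).le
  have hmul : ∀ r ∈ planeRing k x y, ∀ g ∈ planeRing k x y * W, r * g ∈ planeRing k x y * W := by
    intro r hr g hg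
    have := Submodule.mul_mem_mul hr hg
    rwa [← mul_assoc, Subalgebra.isIdempotentElem_toSubmodule] at this
  obtain ⟨D, hD⟩ : ∃ D : ℕ, relLength (planeRing k x y * W) (planeRing k x y) = D := by
    have hsup : planeRing k x y = linForms k x y ^ (D1 + 1) ⊔ planeRing k x y * W := by
      refine le_antisymm (planeRing_le_sup fun D hDD => ?_)
        (sup_le (linForms_pow_le_planeRing x y _) ha)
      exact (hD1 D (by omega)).trans
        (sup_le_sup_left (mul_le_mul' (linForms_pow_le_planeRing x y _) le_rfl) _)
    have hne : relLength (planeRing k x y * W) (planeRing k x y) ≠ ⊤ := by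
      rw [congrArg (relLength (planeRing k x y * W)) hsup, relLength_sup]
      have := finiteDimensional_linForms_pow (k := k) x y (D1 + 1)
      unfold relLength
      rw [Module.length_eq_finrank]
      exact ENat.natCast_ne_top _
    obtain ⟨D, hD⟩ := ENat.ne_top_iff_exists.1 hne
    exact ⟨D, hD.symm⟩
  obtain ⟨d, hpd, hd⟩ := exists_relLength_closure_dvd hp hp5 hpn D h ha hmul hD
  have hfin := finiteDimensional_linForms_pow (k := k) x y (n * (e + 1))
  have hfin' : FiniteDimensional k (intClosure ⊥ ((linForms k x y * W) ^ n)) :=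
    Submodule.finiteDimensional_of_le (intClosure_bot_pow_le h hW h1 h2 n)
  have := hlen n hn
  rw [hd, relLength_bot, Module.length_eq_finrank, ← Nat.cast_add, Nat.cast_inj,
    Finset.sum_range_succ] at this
  have h3 := Nat.dvd_sum_range_succ hp hp5 (hpn.mul_right (e + 1))
  have h4 : p ∣ n * (e + 1) + 1 := by
    rw [← Nat.dvd_add_right h3, this]
    exact dvd_add hdvd hpd
  have := (Nat.dvd_add_right (hpn.mul_right (e + 1))).1 h4
  exact hp.one_lt.ne' (Nat.dvd_one.1 this)

end BaseCurve

section FiniteIntegralClosure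

theorem RingHom.Finite.of_semilinear {R B C : Type*} [CommRing R] [IsNoetherianRing R] [CommRing B]
    [CommRing C] {f : R →+* B} {γ : R →+* C} (hγ : γ.Finite) (β : B →+* C)
    (hβ : Function.Injective β) (h : β.comp f = γ) : f.Finite := by
  algebraize [f, γ]
  have : IsNoetherian R C := isNoetherian_of_isNoetherianRing_of_finite R C
  let l : B →ₗ[R] C :=
    { β with
      map_smul' := fun r b => by
        have h1 : β (f r) = γ r := by rw [← h]; rfl
        simp only [Algebra.smul_def, RingHom.id_apply]
        change β (f r * b) = γ r * β b
        rw [map_mul, h1] }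
  have : IsNoetherian R B := isNoetherian_of_injective l hβ
  exact Module.IsNoetherian.finite R B

theorem finite_iterateFrobenius_mvPolynomial (k : Type*) [Field k] [PerfectField k] (q : ℕ)
    [ExpChar k q] (s : Type*) [Finite s] (m : ℕ) :
    (iterateFrobenius (MvPolynomial s k) q m).Finite := by
  have hperf : PerfectRing k q := PerfectField.toPerfectRing q
  have hft : (iterateFrobenius (MvPolynomial s k) q m).FiniteType := by
    have h1 : ((MvPolynomial.C : k →+* MvPolynomial s k).comp (iterateFrobenius k q m)).FiniteType := by
      refine RingHom.FiniteType.comp (g := (MvPolynomial.C : k →+* MvPolynomial s k)) ?_ ?_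
      · exact RingHom.finiteType_algebraMap.2 inferInstance
      · exact RingHom.FiniteType.of_surjective _ (bijective_iterateFrobenius k q m).2
    have h2 : ((MvPolynomial.C : k →+* MvPolynomial s k).comp (iterateFrobenius k q m)) =
        (iterateFrobenius (MvPolynomial s k) q m).comp MvPolynomial.C := by
      ext c
      simp [iterateFrobenius_def]
    rw [h2] at h1
    exact h1.of_comp_finiteType
  refine RingHom.IsIntegral.to_finite ?_ hft
  intro x
  refine ⟨Polynomial.X ^ (q ^ m) - Polynomial.C x, Polynomial.monic_X_pow_sub_C _ ?_, ?_⟩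
  · exact (pow_pos (expChar_pos k q) m).ne'
  · simp [iterateFrobenius_def]

theorem finite_integralClosure_of_finite_frobenius {P : Type*} (F : Type*) {L : Type*}
    [CommRing P] [IsDomain P] [IsIntegrallyClosed P] [IsNoetherianRing P]
    [Field F] [Field L] [Algebra P F] [IsFractionRing P F] [Algebra F L] [Algebra P L]
    [IsScalarTower P F L] [FiniteDimensional F L] (q : ℕ) [ExpChar P q]
    (hq : ∀ m, (iterateFrobenius P q m).Finite) : Module.Finite P (integralClosure P L) := by
  let E := separableClosure F L
  have hqF : ExpChar F q := expChar_of_injective_algebraMap (IsFractionRing.injective P F) q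
  have hqL : ExpChar L q := expChar_of_injective_algebraMap (algebraMap F L).injective q
  have hqE : ExpChar E q := expChar_of_injective_algebraMap (algebraMap F E).injective q
  have hpi : IsPurelyInseparable E L := separableClosure.isPurelyInseparable F L
  have hfin : FiniteDimensional E L := Module.Finite.right F E L
  have htower : IsScalarTower P E L := IsScalarTower.of_algebraMap_eq fun _ => rfl
  have hC : Module.Finite P (integralClosure P E) :=
    IsIntegralClosure.finite P F E (integralClosure P E)
  let m := IsPurelyInseparable.exponent E L
  let ι : L →+* E := IsPurelyInseparable.iterateFrobenius E L q (n := m) le_rfl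
  have hι : ∀ a : L, ((ι a : E) : L) = a ^ q ^ m :=
    IsPurelyInseparable.algebraMap_iterateFrobenius E q le_rfl
  have hmem : ∀ b : integralClosure P L, ι b ∈ integralClosure P E := by
    intro b
    have h1 : IsIntegral P ((b : L) ^ q ^ m) := IsIntegral.pow b.2 _
    rw [← hι] at h1
    exact (isIntegral_algebraMap_iff (algebraMap E L).injective).1 h1
  let β : integralClosure P L →+* integralClosure P E :=
    (ι.comp (integralClosure P L).subtype).codRestrict (integralClosure P E).toSubring hmem
  rw [← RingHom.finite_algebraMap]
  refine RingHom.Finite.of_semilinear (f := algebraMap P (integralClosure P L))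
    (γ := (algebraMap P (integralClosure P E)).comp (iterateFrobenius P q m))
    (RingHom.Finite.comp (RingHom.finite_algebraMap.2 hC) (hq m)) β ?_ ?_
  · intro a b hab
    have := congrArg (Subtype.val : integralClosure P E → E) hab
    exact Subtype.ext (ι.injective this)
  · ext a
    change ((ι (algebraMap P L a) : E) : L) = ((algebraMap P E (iterateFrobenius P q m a) : E) : L)
    rw [hι, iterateFrobenius_def]
    rw [map_pow]
    rfl

theorem finite_integralClosure_adjoin {k L : Type*} [Field k] [PerfectField k] [Field L]
    [Algebra k L] (T : Finset L) (hT : IntermediateField.adjoin k (T : Set L) = ⊤) :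
    Module.Finite (Algebra.adjoin k (T : Set L))
      (integralClosure (Algebra.adjoin k (T : Set L)) L) := by
  set S := Algebra.adjoin k (T : Set L) with hS
  have hfg : Algebra.FiniteType k S :=
    (Subalgebra.fg_iff_finiteType S).1 ⟨T, rfl⟩
  obtain ⟨s, g, hg, hgfin⟩ := exists_finite_inj_algHom_of_fg k S
  let P := MvPolynomial (Fin s) k
  let F := FractionRing P
  let algPS : Algebra P S := g.toRingHom.toAlgebra
  let algPL : Algebra P L := (S.val.toRingHom.comp g.toRingHom).toAlgebra
  have htower : IsScalarTower P S L := IsScalarTower.of_algebraMap_eq fun _ => rfl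
  have hPS : Module.Finite P S := hgfin
  have hinj : Function.Injective (algebraMap P L) :=
    (Subtype.val_injective (p := (· ∈ S))).comp hg
  have hfaith : FaithfulSMul P L := (faithfulSMul_iff_algebraMap_injective P L).2 hinj
  let algFL : Algebra F L := FractionRing.liftAlgebra P L
  have htowF : IsScalarTower P F L := FractionRing.isScalarTower_liftAlgebra P L
  have hintegral : ∀ z ∈ S, IsIntegral P z := fun z hz =>
    (Algebra.IsIntegral.isIntegral (R := P) (⟨z, hz⟩ : S)).algebraMap
  have hfin : FiniteDimensional F L := by
    have h1 : IntermediateField.adjoin F (T : Set L) = ⊤ := by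
      rw [eq_top_iff]
      intro z _
      have hz : z ∈ IntermediateField.adjoin k (T : Set L) := by rw [hT]; trivial
      have hk : ∀ c : k, algebraMap k L c = algebraMap F L (algebraMap P F (MvPolynomial.C c)) := by
        intro c
        rw [← IsScalarTower.algebraMap_apply]
        change _ = ((g (algebraMap k P c) : S) : L)
        rw [g.commutes]
        rfl
      induction hz using IntermediateField.adjoin_induction with
      | mem x hx => exact IntermediateField.subset_adjoin F _ hx
      | algebraMap c => rw [hk]; exact IntermediateField.algebraMap_mem _ _
      | add x y _ _ hx hy => exact add_mem (hx trivial) (hy trivial)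
      | inv x _ hx => exact inv_mem (hx trivial)
      | mul x y _ _ hx hy => exact mul_mem (hx trivial) (hy trivial)
    have h2 : FiniteDimensional F (IntermediateField.adjoin F (T : Set L)) :=
      IntermediateField.finiteDimensional_adjoin fun z hz =>
        (hintegral z (Algebra.subset_adjoin hz)).tower_top
    rw [h1] at h2
    exact (IntermediateField.topEquiv (F := F) (E := L)).toLinearEquiv.finiteDimensional
  obtain ⟨q, hq⟩ := ExpChar.exists k
  have hqP : ExpChar P q := expChar_of_injective_algebraMap (MvPolynomial.C_injective (Fin s) k) q
  have hB : Module.Finite P (integralClosure P L) :=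
    finite_integralClosure_of_finite_frobenius F q
      (finite_iterateFrobenius_mvPolynomial k q (Fin s))
  have hle : ∀ z : L, z ∈ integralClosure S L → z ∈ integralClosure P L := fun z hz =>
    isIntegral_trans (R := P) (A := S) z hz
  have htow2 : IsScalarTower P S (integralClosure S L) :=
    IsScalarTower.of_algebraMap_eq fun _ => rfl
  have hnoeth : IsNoetherian P (integralClosure P L) :=
    isNoetherian_of_isNoetherianRing_of_finite _ _
  let l : integralClosure S L →ₗ[P] integralClosure P L :=
    { toFun := fun z => ⟨z, hle z z.2⟩
      map_add' := fun _ _ => rfl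
      map_smul' := fun c z => by
        ext
        simp only [Algebra.smul_def]
        rfl }
  have hN : IsNoetherian P (integralClosure S L) :=
    isNoetherian_of_injective l fun a b hab => by
      have h := congrArg Subtype.val hab
      exact Subtype.ext h
  have h3 : Module.Finite P (integralClosure S L) := Module.IsNoetherian.finite P _
  exact Module.Finite.of_restrictScalars_finite P S _

end FiniteIntegralClosure

section FiniteIntegralClosureOfInjective

theorem finite_integralClosure_adjoin_of_injective {k A L : Type*} [Field k] [PerfectField k]
    [CommRing A] [Algebra k A] [Field L] [Algebra k L] (f : A →ₐ[k] L)
    (hf : Function.Injective f) (T : Finset A)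
    (hT : IntermediateField.adjoin k (f '' (T : Set A)) = ⊤) :
    Module.Finite (Algebra.adjoin k (T : Set A)) (integralClosure (Algebra.adjoin k (T : Set A)) A) := by
  classical
  have h1 : ((T.image f : Finset L) : Set L) = f '' T := Finset.coe_image
  have h2 : Module.Finite (Algebra.adjoin k ((T.image f : Finset L) : Set L))
      (integralClosure (Algebra.adjoin k ((T.image f : Finset L) : Set L)) L) :=
    finite_integralClosure_adjoin (T.image f) (by rw [h1]; exact hT)
  have hnoeth : IsNoetherianRing (Algebra.adjoin k (T : Set A)) :=
    isNoetherianRing_of_fg (Subalgebra.fg_adjoin_finset T)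
  have h3 : (Algebra.adjoin k (T : Set A)).map f = Algebra.adjoin k ((T.image f : Finset L) : Set L) := by
    rw [AlgHom.map_adjoin, h1]
  rw [← h3] at h2
  generalize Algebra.adjoin k (T : Set A) = S at h2 hnoeth ⊢
  let g : S →+* S.map f := (S.equivMapOfInjective f hf : S ≃ₐ[k] S.map f).toRingEquiv.toRingHom
  have hg : g.Finite := RingHom.Finite.of_surjective _ (S.equivMapOfInjective f hf).surjective
  have hintegral : ∀ z : A, z ∈ integralClosure S A → f z ∈ integralClosure (S.map f) L := fun z hz =>
    IsIntegral.map_of_comp_eq g (f : A →+* L) (by ext; rfl) hz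
  have hγ : ((algebraMap (S.map f) (integralClosure (S.map f) L)).comp g).Finite :=
    RingHom.Finite.comp (RingHom.finite_algebraMap.2 h2) hg
  let β : integralClosure S A →+* integralClosure (S.map f) L :=
    ((f : A →+* L).comp (integralClosure S A).val.toRingHom).codRestrict
      (integralClosure (S.map f) L) fun z => hintegral z z.2
  have hβ : Function.Injective β := fun a b hab => by
    have h := congrArg Subtype.val hab
    exact Subtype.ext (hf h)
  exact RingHom.finite_algebraMap.1
    (RingHom.Finite.of_semilinear (f := algebraMap S (integralClosure S A)) hγ β hβ (by ext; rfl))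

theorem isNoetherian_integralClosure_adjoin_of_injective {k A L : Type*} [Field k] [PerfectField k]
    [CommRing A] [Algebra k A] [Field L] [Algebra k L] (f : A →ₐ[k] L)
    (hf : Function.Injective f) (T : Finset A)
    (hT : IntermediateField.adjoin k (f '' (T : Set A)) = ⊤) :
    IsNoetherian (Algebra.adjoin k (T : Set A)) (integralClosure (Algebra.adjoin k (T : Set A)) A) := by
  have hfin := finite_integralClosure_adjoin_of_injective f hf T hT
  have hnoeth : IsNoetherianRing (Algebra.adjoin k (T : Set A)) :=
    isNoetherianRing_of_fg (Subalgebra.fg_adjoin_finset T)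
  exact isNoetherian_of_isNoetherianRing_of_finite _ _

end FiniteIntegralClosureOfInjective

section Graded

open Polynomial

variable {k K : Type*} [Field k] [Field K] [Algebra k K]

/-- The subalgebra of `K[X]` generated by the linear monomials with coefficients in `T`. -/
noncomputable abbrev linearRees (k : Type*) {K : Type*} [Field k] [Field K] [Algebra k K] (T : Set K) :
    Subalgebra k K[X] :=
  Algebra.adjoin k ((fun w => C w * X) '' T)

/-- Polynomials whose `n`-th coefficient lies in `G n`. -/
noncomputable def gradedSubmodule (T : Set K) (G : ℕ → Submodule k K)
    (hG : ∀ n, ∀ w ∈ T, ∀ x ∈ G n, w * x ∈ G (n + 1)) : Submodule (linearRees k T) K[X] where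
  carrier := {b | ∀ n, b.coeff n ∈ G n}
  add_mem' ha hb n := by
    rw [coeff_add]
    exact add_mem (ha n) (hb n)
  zero_mem' n := by simp
  smul_mem' := by
    rintro ⟨s, hs⟩ b hb
    change s * b ∈ {b : K[X] | ∀ n, b.coeff n ∈ G n}
    induction hs using Algebra.adjoin_induction generalizing b with
    | mem s hs =>
      obtain ⟨w, hw, rfl⟩ := hs
      intro n
      cases n with
      | zero => simp [mul_assoc]
      | succ n =>
        simp only [mul_assoc, coeff_C_mul, coeff_X_mul]
        exact hG n w hw _ (hb n)
    | algebraMap c =>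
      intro n
      rw [← Algebra.smul_def, coeff_smul]
      exact Submodule.smul_mem _ _ (hb n)
    | add s s' _ _ h h' =>
      intro n
      rw [add_mul, coeff_add]
      exact add_mem (h hb n) (h' hb n)
    | mul s s' _ _ h h' =>
      rw [mul_assoc]
      exact h (h' hb)

variable {T : Set K}

theorem monomial_mem_gradedSubmodule {G : ℕ → Submodule k K} {hG} {n : ℕ} {b : K} :
    monomial n b ∈ gradedSubmodule T G hG ↔ b ∈ G n := by
  refine ⟨fun h => by simpa using h n, fun h m => ?_⟩
  rw [coeff_monomial]
  split_ifs with hm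
  · rwa [← hm]
  · exact zero_mem _

theorem gradedSubmodule_mono {G G' : ℕ → Submodule k K} {hG hG'} (h : ∀ n, G n ≤ G' n) :
    gradedSubmodule T G hG ≤ gradedSubmodule T G' hG' := fun _ hb n => h n (hb n)

theorem exists_forall_le_mul_of_isNoetherian {V : Submodule k K} {G : ℕ → Submodule k K}
    (hV : ∀ n, V * G n ≤ G (n + 1)) (hTV : T ⊆ V) {hG}
    (hN : IsNoetherian (linearRees k T) (gradedSubmodule T G hG)) :
    ∃ n0, ∀ n, n0 ≤ n → G (n + 1) ≤ V * G n := by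
  let G' : ℕ → ℕ → Submodule k K := fun m n => if n ≤ m then G n else V * G (n - 1)
  have hle : ∀ m n, G' m n ≤ G n := by
    intro m n
    simp only [G']
    split_ifs with h
    · exact le_rfl
    · obtain ⟨l, rfl⟩ := Nat.exists_eq_add_of_lt (not_le.1 h)
      exact hV (m + l)
  have hG' : ∀ m n, ∀ w ∈ T, ∀ x ∈ G' m n, w * x ∈ G' m (n + 1) := by
    intro m n w hw x hx
    by_cases h : n + 1 ≤ m
    · have h2 : G' m (n + 1) = G (n + 1) := if_pos h
      rw [h2]
      exact hG n w hw x (hle m n hx)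
    · have h2 : G' m (n + 1) = V * G n := if_neg h
      rw [h2]
      exact Submodule.mul_mem_mul (hTV hw) (hle m n hx)
  let c : ℕ →o Submodule (linearRees k T) (gradedSubmodule T G hG) :=
    { toFun := fun m => (gradedSubmodule T (G' m) (hG' m)).comap (Submodule.subtype _)
      monotone' := by
        intro m m' h
        refine Submodule.comap_mono (gradedSubmodule_mono fun n => ?_)
        by_cases h1 : n ≤ m
        · have h2 : G' m' n = G n := if_pos (h1.trans h)
          rw [h2]
          exact hle m n
        · have h2 : G' m n = V * G (n - 1) := if_neg h1
          rw [h2]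
          simp only [G']
          split_ifs with h3
          · obtain ⟨l, rfl⟩ := Nat.exists_eq_add_of_lt (not_le.1 h1)
            exact hV (m + l)
          · exact le_rfl }
  obtain ⟨n0, hn0⟩ := monotone_stabilizes_iff_noetherian.2 hN c
  refine ⟨n0, fun n hn x hx => ?_⟩
  have h1 : monomial (n + 1) x ∈ gradedSubmodule T G hG := monomial_mem_gradedSubmodule.2 hx
  have h2 : (⟨monomial (n + 1) x, h1⟩ : gradedSubmodule T G hG) ∈ c (n + 1) := by
    change monomial (n + 1) x ∈ gradedSubmodule T (G' (n + 1)) (hG' (n + 1))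
    rw [monomial_mem_gradedSubmodule]
    have h2 : G' (n + 1) (n + 1) = G (n + 1) := if_pos le_rfl
    rwa [h2]
  rw [← hn0 (n + 1) (by lia)] at h2
  have h3 : monomial (n + 1) x ∈ gradedSubmodule T (G' n0) (hG' n0) := h2
  rw [monomial_mem_gradedSubmodule] at h3
  have h4 : G' n0 (n + 1) = V * G n := if_neg (by lia)
  rwa [h4] at h3

theorem wellFoundedGT_hIdeal {ι : Type*} [AddCancelCommMonoid ι] {D : ι → Submodule k K}
    (hind : iSupIndep D) {G : ℕ → Submodule k K}
    (hT : ∀ w ∈ T, ∃ ψ, w ∈ G 1 ⊓ D ψ) {hG}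
    (hN : IsNoetherian (linearRees k T) (gradedSubmodule T G hG)) :
    WellFoundedGT (HIdeal fun i : ℕ × ι => G i.1 ⊓ D i.2) := by
  have hP : ∀ P : HIdeal fun i : ℕ × ι => G i.1 ⊓ D i.2, ∀ n, ∀ w ∈ T,
      ∀ x ∈ ⨆ ψ, P.carrier (n, ψ), w * x ∈ ⨆ ψ, P.carrier (n + 1, ψ) := by
    intro P n w hw x hx
    have h : ⨆ ψ, P.carrier (n, ψ) ≤
        (⨆ ψ, P.carrier (n + 1, ψ)).comap (LinearMap.mulLeft k w) := by
      refine iSup_le fun ψ y hy => ?_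
      obtain ⟨φ, hφ⟩ := hT w hw
      have h2 := P.mul (1, φ) (n, ψ) w y hφ hy
      rw [Prod.mk_add_mk, add_comm 1 n] at h2
      exact Submodule.mem_iSup_of_mem (φ + ψ) h2
    exact h hx
  let Φ : HIdeal (fun i : ℕ × ι => G i.1 ⊓ D i.2) →
      Submodule (linearRees k T) (gradedSubmodule T G hG) := fun P =>
    (gradedSubmodule T (fun n => ⨆ ψ, P.carrier (n, ψ)) (hP P)).comap (Submodule.subtype _)
  have hrec : ∀ P : HIdeal fun i : ℕ × ι => G i.1 ⊓ D i.2, ∀ n ψ, ∀ x ∈ D ψ,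
      x ∈ ⨆ ψ, P.carrier (n, ψ) → x ∈ P.carrier (n, ψ) := by
    intro P n ψ x hxD hx
    have h1 : ⨆ ψ, P.carrier (n, ψ) ≤ P.carrier (n, ψ) ⊔ ⨆ φ, ⨆ _ : φ ≠ ψ, D φ := by
      refine iSup_le fun φ => ?_
      by_cases h : φ = ψ
      · rw [h]
        exact le_sup_left
      · exact le_sup_of_le_right (le_iSup₂_of_le φ h ((P.le _).trans inf_le_right))
    obtain ⟨y, hy, z, hz, rfl⟩ := Submodule.mem_sup.1 (h1 hx)
    have hyD : y ∈ D ψ := (P.le _ hy).2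
    have hz0 : z = 0 := by
      have := (add_mem_cancel_left hyD).1 hxD
      exact Submodule.disjoint_def.1 (hind ψ) z this hz
    rwa [hz0, add_zero]
  have hmem : ∀ P : HIdeal fun i : ℕ × ι => G i.1 ⊓ D i.2, ∀ n ψ x (hx : x ∈ G n ⊓ D ψ),
      x ∈ P.carrier (n, ψ) ↔
        (⟨monomial n x, monomial_mem_gradedSubmodule.2 hx.1⟩ : gradedSubmodule T G hG) ∈ Φ P := by
    intro P n ψ x hx
    change _ ↔ monomial n x ∈ gradedSubmodule T (fun n => ⨆ ψ, P.carrier (n, ψ)) (hP P)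
    rw [monomial_mem_gradedSubmodule]
    exact ⟨fun h => Submodule.mem_iSup_of_mem ψ h, hrec P n ψ x hx.2⟩
  have hmono : StrictMono Φ := by
    refine Monotone.strictMono_of_injective (fun P Q h => ?_) fun P Q h => ?_
    · exact Submodule.comap_mono (gradedSubmodule_mono fun n => iSup_mono fun ψ => h (n, ψ))
    · refine HIdeal.ext (funext fun i => ?_)
      ext x
      refine ⟨fun hx => ?_, fun hx => ?_⟩
      · rw [hmem Q _ _ _ (P.le i hx), ← h]
        exact (hmem P _ _ _ (P.le i hx)).1 hx
      · rw [hmem P _ _ _ (Q.le i hx), h]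
        exact (hmem Q _ _ _ (Q.le i hx)).1 hx
  exact hmono.wellFoundedGT

end Graded

section Graded

open Polynomial

variable {k K : Type*} [Field k] [Field K] [Algebra k K]

theorem mul_mem_intClosure_mul {S : Subalgebra k K} {W W' : Submodule k K} {b b' : K}
    (hb : b ∈ intClosure S W) (hb' : b' ∈ intClosure S W') : b * b' ∈ intClosure S (W * W') := by
  intro v hv
  obtain ⟨w, hw, c, hc, rfl⟩ := hb v hv
  obtain ⟨w', hw', c', hc', rfl⟩ := hb' v hv
  exact ⟨w * w', Submodule.mul_mem_mul hw hw', c * c', mul_mem hc hc', by ring⟩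

/-- The linear map `w ↦ w X ^ n`. -/
noncomputable def mulXPow (k K : Type*) [Field k] [Field K] [Algebra k K] (n : ℕ) : K →ₗ[k] K[X] where
  toFun w := C w * X ^ n
  map_add' a b := by simp [add_mul]
  map_smul' c a := by
    rw [RingHom.id_apply, ← smul_C, smul_mul_assoc]

theorem C_mul_X_pow_mem_linearRees {T : Set K} {n : ℕ} {w : K}
    (hw : w ∈ Submodule.span k T ^ n) : C w * X ^ n ∈ linearRees k T := by
  induction n generalizing w with
  | zero =>
    rw [pow_zero, Submodule.one_eq_range] at hw
    obtain ⟨c, rfl⟩ := hw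
    rw [pow_zero, mul_one]
    exact Subalgebra.algebraMap_mem _ c
  | succ n ih =>
    rw [pow_succ] at hw
    induction hw using Submodule.mul_induction_on' with
    | mem_mul_mem a ha b hb =>
      have h1 : C b * X ∈ linearRees k T := by
        have h2 : Submodule.span k T ≤
            (Subalgebra.toSubmodule (linearRees k T)).comap (mulXPow k K 1) := by
          rw [Submodule.span_le]
          intro w hw
          change C w * X ^ 1 ∈ linearRees k T
          rw [pow_one]
          exact Algebra.subset_adjoin ⟨w, hw, rfl⟩
        have h3 : C b * X ^ 1 ∈ linearRees k T := h2 hb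
        rwa [pow_one] at h3
      have : C (a * b) * X ^ (n + 1) = (C a * X ^ n) * (C b * X) := by
        rw [C_mul]
        ring
      rw [this]
      exact mul_mem (ih ha) h1
    | add a _ b _ ha hb =>
      rw [C_add, add_mul]
      exact add_mem ha hb

theorem isIntegral_C_mul_X_pow {T : Set K} {n : ℕ} {b : K}
    (hb : b ∈ intClosure ⊥ (Submodule.span k T ^ n)) : IsIntegral (linearRees k T) (C b * X ^ n) := by
  let L := FractionRing K[X]
  let f : K[X] →ₐ[k] L := IsScalarTower.toAlgHom k K[X] L
  have hf : Function.Injective f := IsFractionRing.injective K[X] L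
  let S := linearRees k T
  let e := S.equivMapOfInjective f hf
  have h1 := iInf_valuationSubring_superset (s := (S.map f : Set L))
  have h2 : f (C b * X ^ n) ∈ (integralClosure (Subring.closure (S.map f : Set L)) L).toSubring := by
    rw [← h1, Subring.mem_iInf]
    rintro ⟨v, hv⟩
    let u : ValuationSubring K := v.comap ((f : K[X] →+* L).comp C)
    obtain ⟨w, hw, c, hc, rfl⟩ := hb u fun z hz => by
      obtain ⟨a, rfl⟩ := Algebra.mem_bot.1 hz
      exact hv ((S.map f).algebraMap_mem a)
    have h3 : f (C (c * w) * X ^ n) = f (C c) * f (C w * X ^ n) := by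
      rw [← map_mul, C_mul, mul_assoc]
    rw [h3]
    exact mul_mem (s := v) hc (hv ⟨_, C_mul_X_pow_mem_linearRees hw, rfl⟩)
  have h3 : IsIntegral (Subring.closure (S.map f : Set L)) (f (C b * X ^ n)) := h2
  let g : Subring.closure (S.map f : Set L) →+* S.map f :=
    Subring.inclusion (T := (S.map f).toSubring) (Subring.closure_le.2 fun _ hz => hz)
  have h4 : IsIntegral S (f (C b * X ^ n)) := by
    refine IsIntegral.map_of_comp_eq ((e.symm : S.map f →+* S).comp g) (RingHom.id L) ?_ h3
    ext z
    have h5 : (e (e.symm (g z)) : L) = f (e.symm (g z) : S) := rfl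
    rw [AlgEquiv.apply_symm_apply] at h5
    exact h5.symm
  exact (isIntegral_algHom_iff (R := S) (A := K[X]) (B := L)
    (IsScalarTower.toAlgHom S K[X] L) hf).1 h4

theorem adjoin_linearRees_generators {T : Set K} (h1 : (1 : K) ∈ Submodule.span k T)
    (hgen : IntermediateField.adjoin k T = ⊤) :
    IntermediateField.adjoin k (algebraMap K[X] (FractionRing K[X]) '' ((fun w => C w * X) '' T)) = ⊤ := by
  let L := FractionRing K[X]
  let f : K[X] →ₐ[k] L := IsScalarTower.toAlgHom k K[X] L
  set E := IntermediateField.adjoin k (algebraMap K[X] L '' ((fun w => C w * X) '' T)) with hE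
  have h2 : Submodule.span k T ≤
      (Subalgebra.toSubmodule E.toSubalgebra).comap (f.toLinearMap ∘ₗ mulXPow k K 1) := by
    rw [Submodule.span_le]
    intro w hw
    change algebraMap K[X] L (C w * X ^ 1) ∈ E
    rw [pow_one]
    exact IntermediateField.subset_adjoin _ _ ⟨_, ⟨w, hw, rfl⟩, rfl⟩
  have hX : f X ∈ E := by
    have h3 : f (C 1 * X ^ 1) ∈ E := h2 h1
    simpa using h3
  have hX0 : f X ≠ 0 := by
    rw [Ne, map_eq_zero_iff f (IsFractionRing.injective K[X] L)]
    exact X_ne_zero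
  have h4 : ∀ w : K, f (C w) ∈ E := by
    intro w
    have hw : w ∈ IntermediateField.adjoin k T := by rw [hgen]; trivial
    let φ : K →+* L := (f : K[X] →+* L).comp C
    change φ w ∈ E
    induction hw using IntermediateField.adjoin_induction with
    | mem x hx =>
      have h5 : f (C x * X ^ 1) ∈ E := h2 (Submodule.subset_span hx)
      have h6 : φ x = f (C x * X ^ 1) / f X := by
        rw [pow_one, map_mul, mul_div_cancel_right₀ _ hX0]
        rfl
      rw [h6]
      exact div_mem h5 hX
    | algebraMap c => exact E.algebraMap_mem c
    | add x y _ _ hx hy => rw [map_add]; exact add_mem hx hy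
    | inv x _ hx => rw [map_inv₀]; exact inv_mem hx
    | mul x y _ _ hx hy => rw [map_mul]; exact mul_mem hx hy
  have h5 : ∀ q : K[X], f q ∈ E := by
    intro q
    induction q using Polynomial.induction_on' with
    | add p q hp hq => rw [map_add]; exact add_mem hp hq
    | monomial n a =>
      rw [← C_mul_X_pow_eq_monomial, map_mul, map_pow]
      exact mul_mem (h4 a) (pow_mem hX n)
  rw [eq_top_iff]
  intro z _
  obtain ⟨a, c, _, rfl⟩ := IsFractionRing.div_surjective (A := K[X]) z
  exact div_mem (h5 a) (h5 c)

theorem intClosure_pow_step {T : Set K} (n : ℕ) :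
    ∀ w ∈ T, ∀ x ∈ intClosure ⊥ (Submodule.span k T ^ n),
      w * x ∈ intClosure ⊥ (Submodule.span k T ^ (n + 1)) := by
  intro w hw x hx
  rw [pow_succ']
  exact mul_mem_intClosure_mul (le_intClosure _ _ (Submodule.subset_span hw)) hx

theorem isNoetherian_gradedSubmodule_intClosure [PerfectField k] (T : Finset K)
    (h1 : (1 : K) ∈ Submodule.span k (T : Set K))
    (hgen : IntermediateField.adjoin k (T : Set K) = ⊤) :
    IsNoetherian (linearRees k (T : Set K)) (gradedSubmodule (T : Set K)
      (fun n => intClosure ⊥ (Submodule.span k (T : Set K) ^ n)) intClosure_pow_step) := by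
  classical
  let T' : Finset K[X] := T.image fun w => C w * X
  have hT' : (T' : Set K[X]) = (fun w => C w * X) '' (T : Set K) := Finset.coe_image
  have hN : IsNoetherian (Algebra.adjoin k (T' : Set K[X]))
      (integralClosure (Algebra.adjoin k (T' : Set K[X])) K[X]) := by
    refine isNoetherian_integralClosure_adjoin_of_injective
      (IsScalarTower.toAlgHom k K[X] (FractionRing K[X])) (IsFractionRing.injective _ _) T' ?_
    rw [hT']
    exact adjoin_linearRees_generators h1 hgen
  rw [hT'] at hN
  have hle : ∀ z ∈ gradedSubmodule (T : Set K)
      (fun n => intClosure ⊥ (Submodule.span k (T : Set K) ^ n)) intClosure_pow_step,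
      z ∈ integralClosure (linearRees k (T : Set K)) K[X] := by
    intro z hz
    rw [z.as_sum_support_C_mul_X_pow]
    exact sum_mem fun n _ => isIntegral_C_mul_X_pow (hz n)
  let l : gradedSubmodule (T : Set K)
      (fun n => intClosure ⊥ (Submodule.span k (T : Set K) ^ n)) intClosure_pow_step →ₗ[linearRees k (T : Set K)]
      integralClosure (linearRees k (T : Set K)) K[X] :=
    { toFun := fun z => ⟨z, hle z z.2⟩
      map_add' := fun _ _ => rfl
      map_smul' := fun _ _ => rfl }
  exact isNoetherian_of_injective l fun a b hab => by
    have h := congrArg Subtype.val hab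
    exact Subtype.ext h

end Graded

namespace HIdeal

variable {k K ι : Type*} [Field k] [Field K] [Algebra k K] [AddCancelCommMonoid ι]

section Prime

variable {A : ι → Submodule k K} {P : HIdeal A}

theorem pow_mem_piece (hA : ∀ i j a b, a ∈ A i → b ∈ A j → a * b ∈ A (i + j)) (h1 : (1 : K) ∈ A 0)
    {i : ι} {a : K} (ha : a ∈ A i) (n : ℕ) : a ^ n ∈ A (n • i) := by
  induction n with
  | zero => simpa using h1
  | succ n ih =>
    rw [pow_succ, succ_nsmul]
    exact hA _ _ _ _ ih ha

theorem pow_mem_carrier (hA : ∀ i j a b, a ∈ A i → b ∈ A j → a * b ∈ A (i + j))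
    (h1 : (1 : K) ∈ A 0) {i : ι} {a : K} (ha : a ∈ P.carrier i) {n : ℕ} (hn : n ≠ 0) :
    a ^ n ∈ P.carrier (n • i) := by
  obtain ⟨n, rfl⟩ := Nat.exists_eq_succ_of_ne_zero hn
  rw [Nat.succ_eq_add_one, pow_succ, succ_nsmul]
  exact P.mul _ _ _ _ (pow_mem_piece hA h1 (P.le _ ha) n) ha

theorem Prime.one_notMem (hP : P.Prime) : (1 : K) ∉ P.carrier 0 := by
  intro h
  obtain ⟨i, hi⟩ := hP.1
  refine hi (le_antisymm (P.le i) fun a ha => ?_)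
  have := P.mul i 0 a 1 ha h
  rwa [mul_one, add_zero] at this

theorem Prime.mem_of_pow_mem (hP : P.Prime)
    (hA : ∀ i j a b, a ∈ A i → b ∈ A j → a * b ∈ A (i + j)) (h1 : (1 : K) ∈ A 0)
    {i : ι} {a : K} (ha : a ∈ A i) {n : ℕ} (h : a ^ n ∈ P.carrier (n • i)) :
    a ∈ P.carrier i := by
  induction n with
  | zero =>
    rw [pow_zero, zero_nsmul] at h
    exact absurd h hP.one_notMem
  | succ n ih =>
    rw [pow_succ, succ_nsmul] at h
    exact (hP.2 _ _ _ _ (pow_mem_piece hA h1 ha n) ha h).elim ih id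

end Prime

section Weights

variable {D : ι → Submodule k K} {G : ℕ → Submodule k K}

theorem mem_carrier_of_mem_iSup (hind : iSupIndep D)
    (P : HIdeal fun i : ℕ × ι => G i.1 ⊓ D i.2) {n : ℕ} {ψ : ι} {x : K} (hxD : x ∈ D ψ)
    (hx : x ∈ ⨆ ψ, P.carrier (n, ψ)) : x ∈ P.carrier (n, ψ) := by
  have h1 : ⨆ ψ, P.carrier (n, ψ) ≤ P.carrier (n, ψ) ⊔ ⨆ φ, ⨆ _ : φ ≠ ψ, D φ := by
    refine iSup_le fun φ => ?_
    by_cases h : φ = ψ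
    · rw [h]
      exact le_sup_left
    · exact le_sup_of_le_right (le_iSup₂_of_le φ h ((P.le _).trans inf_le_right))
  obtain ⟨y, hy, z, hz, rfl⟩ := Submodule.mem_sup.1 (h1 hx)
  have hyD : y ∈ D ψ := (P.le _ hy).2
  have hz0 : z = 0 := by
    have := (add_mem_cancel_left hyD).1 hxD
    exact Submodule.disjoint_def.1 (hind ψ) z this hz
  rwa [hz0, add_zero]

/-- If all degree one generators lie in `P`, then `P` is irrelevant. -/
theorem irr_of_generators {r : ℕ} {p : ℕ} {D : (Fin r → ZMod p) → Submodule k K} (hind : iSupIndep D)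
    (hG : ∀ n, G n ≤ ⨆ ψ, G n ⊓ D ψ) {T : Set K} {n0 : ℕ}
    (hn0 : ∀ n, n0 ≤ n → G (n + 1) ≤ Submodule.span k T * G n)
    (P : HIdeal fun i : ℕ × (Fin r → ZMod p) => G i.1 ⊓ D i.2)
    (hT : ∀ s ∈ T, ∃ α, s ∈ P.carrier (1, α)) : P.Irr := by
  refine ⟨n0 + 1, fun n hn ψ => le_antisymm (P.le _) fun x hx => ?_⟩
  obtain ⟨n, rfl⟩ : ∃ m, n = m + 1 := ⟨n - 1, by lia⟩
  refine mem_carrier_of_mem_iSup hind P hx.2 ?_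
  have h1 : Submodule.span k T * G n ≤ ⨆ ψ, P.carrier (n + 1, ψ) := by
    refine (mul_le_mul' (le_refl _) (hG n)).trans ?_
    rw [Submodule.mul_le]
    intro a ha b hb
    have h2 : Submodule.span k T ≤ (⨆ ψ, P.carrier (n + 1, ψ)).comap (LinearMap.mulRight k b) := by
      rw [Submodule.span_le]
      intro s hs
      obtain ⟨α, hα⟩ := hT s hs
      have h3 : ⨆ ψ, G n ⊓ D ψ ≤ (⨆ ψ, P.carrier (n + 1, ψ)).comap (LinearMap.mulLeft k s) := by
        refine iSup_le fun φ y hy => ?_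
        have h4 := P.mul (n, φ) (1, α) y s hy hα
        rw [mul_comm] at h4
        exact Submodule.mem_iSup_of_mem (φ + α) h4
      exact h3 hb
    exact h2 ha
  exact h1 (hn0 n (by lia) hx.1)

/-- A prime that is neither irrelevant nor moved by some character contradicts an algebraic
relation among semi-invariants. -/
theorem irr_or_exists_ne {r p : ℕ} {D : (Fin r → ZMod p) → Submodule k K} (hind : iSupIndep D)
    (hD : ∀ i j a b, a ∈ D i → b ∈ D j → a * b ∈ D (i + j)) (h1 : (1 : K) ∈ D 0)
    (hGm : ∀ i j a b, a ∈ G i → b ∈ G j → a * b ∈ G (i + j)) (hG1 : (1 : K) ∈ G 0)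
    (hG : ∀ n, G n ≤ ⨆ ψ, G n ⊓ D ψ) {T : Set K} {n0 : ℕ}
    (hn0 : ∀ n, n0 ≤ n → G (n + 1) ≤ Submodule.span k T * G n)
    (hTh : ∀ s ∈ T, ∃ α, s ∈ G 1 ⊓ D α)
    {Γ : Type*} [AddCommGroup Γ] (w : Γ →+ (Fin r → ZMod p)) (φ : Multiplicative Γ →* K)
    (hφ : ∀ γ, φ (.ofAdd γ) ∈ D (w γ)) (S E : Finset Γ)
    (hE : ∀ e ∈ S, ∀ e' ∈ S, e ≠ e' → ∃ q : ℕ, q ≠ 0 ∧ ∃ γ ∈ E, e - e' = q • γ ∧ w γ ≠ 0)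
    (hTE : ∀ s ∈ T, ∀ γ ∈ E, s * φ (.ofAdd γ) ∈ G 1 ∨ s * φ (.ofAdd (-γ)) ∈ G 1)
    (c : Γ → k) (hc : ∀ e ∈ S, c e ≠ 0) (hS : S.Nonempty) (hsum : ∑ e ∈ S, c e • φ (.ofAdd e) = 0)
    (P : HIdeal fun i : ℕ × (Fin r → ZMod p) => G i.1 ⊓ D i.2) (hP : P.Prime) :
    P.Irr ∨ ∃ m α χ a b, χ ≠ 0 ∧ a ∈ G m ⊓ D α ∧ a ∉ P.carrier (m, α) ∧
      b ∈ G m ⊓ D (α + χ) ∧ b ∉ P.carrier (m, α + χ) := by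
  classical
  by_contra! hcon
  obtain ⟨hirr, hno⟩ := hcon
  obtain ⟨s, hsT, hs⟩ : ∃ s ∈ T, ∀ α, s ∉ P.carrier (1, α) := by
    by_contra! h
    exact hirr (irr_of_generators hind hG hn0 P h)
  obtain ⟨α, hα⟩ := hTh s hsT
  have hA : ∀ i j : ℕ × (Fin r → ZMod p), ∀ a b, a ∈ G i.1 ⊓ D i.2 → b ∈ G j.1 ⊓ D j.2 →
      a * b ∈ G (i + j).1 ⊓ D (i + j).2 := fun i j a b ha hb =>
    ⟨hGm _ _ _ _ ha.1 hb.1, hD _ _ _ _ ha.2 hb.2⟩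
  have h1A : (1 : K) ∈ G (0 : ℕ × (Fin r → ZMod p)).1 ⊓ D (0 : ℕ × (Fin r → ZMod p)).2 := ⟨hG1, h1⟩
  have hpow : ∀ n : ℕ, s ^ n ∈ G n ⊓ D (n • α) := fun n => by
    have h := pow_mem_piece (A := fun i : ℕ × (Fin r → ZMod p) => G i.1 ⊓ D i.2) hA h1A
      (i := (1, α)) hα n
    simpa using h
  have hpowP : ∀ n : ℕ, s ^ n ∉ P.carrier (n, n • α) := fun n h => by
    refine hs α (hP.mem_of_pow_mem hA h1A hα (n := n) ?_)
    simpa using h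
  have hstep : ∀ γ, w γ ≠ 0 → s * φ (.ofAdd γ) ∈ G 1 → ∀ q : ℕ, q ≠ 0 → ∀ Q, q ≤ Q →
      s ^ Q * φ (.ofAdd (q • γ)) ∈ P.carrier (Q, Q • α + w (q • γ)) := by
    intro γ hγ hg q hq Q hQ
    have h2 : s * φ (.ofAdd γ) ∈ P.carrier (1, α + w γ) :=
      hno 1 α (w γ) s _ hγ hα (hs α) ⟨hg, hD _ _ _ _ hα.2 (hφ γ)⟩
    have h3 := pow_mem_carrier hA h1A h2 hq
    have h4 := P.mul (Q - q, (Q - q) • α) _ _ _ (hpow (Q - q)) h3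
    have h5 : s ^ (Q - q) * (s * φ (.ofAdd γ)) ^ q = s ^ Q * φ (.ofAdd (q • γ)) := by
      rw [ofAdd_nsmul, map_pow, mul_pow, ← mul_assoc, ← pow_add, Nat.sub_add_cancel hQ]
    have h6 : ((Q - q, (Q - q) • α) : ℕ × (Fin r → ZMod p)) + q • (1, α + w γ) =
        (Q, Q • α + w (q • γ)) := by
      ext1
      · simp [hQ]
      · simp only [Prod.snd_add, Prod.smul_snd, map_nsmul, nsmul_add]
        rw [← add_assoc, ← add_nsmul, Nat.sub_add_cancel hQ]
    rw [← h5, ← h6]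
    exact h4
  obtain ⟨Q, hQ⟩ : ∃ Q : ℕ, ∀ e ∈ S, ∀ e' ∈ S, e ≠ e' →
      ∃ q : ℕ, q ≠ 0 ∧ q ≤ Q ∧ ∃ γ ∈ E, e - e' = q • γ ∧ w γ ≠ 0 := by
    choose! q hq0 hq using hE
    refine ⟨(S ×ˢ S).sup fun x => q x.1 x.2, fun e he e' he' hne => ⟨q e e', hq0 e he e' he' hne,
      Finset.le_sup (f := fun x : Γ × Γ => q x.1 x.2) (Finset.mk_mem_product he he'),
      hq e he e' he' hne⟩⟩
  let R : Γ → Prop := fun d => s ^ Q * φ (.ofAdd d) ∈ P.carrier (Q, Q • α + w d)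
  have htot : ∀ e ∈ S, ∀ e' ∈ S, e ≠ e' → R (e - e') ∨ R (e' - e) := by
    intro e he e' he' hne
    obtain ⟨q, hq0, hqQ, γ, hγ, heq, hw⟩ := hQ e he e' he' hne
    refine (hTE s hsT γ hγ).imp (fun h => ?_) fun h => ?_
    · rw [heq]
      exact hstep γ hw h q hq0 Q hqQ
    · rw [← neg_sub, heq, ← smul_neg]
      exact hstep (-γ) (by rwa [map_neg, neg_ne_zero]) h q hq0 Q hqQ
  have hAR : ∀ d, R d → s ^ Q * φ (.ofAdd d) ∈ G Q ⊓ D (Q • α + w d) := fun d h => P.le _ h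
  have hR2 : ∀ a, R a → R (-a) → False := by
    intro a h h'
    refine hpowP (Q + Q) ?_
    have h2 := P.mul (Q, Q • α + w a) _ _ _ (hAR a h) h'
    have h3 : s ^ Q * φ (.ofAdd a) * (s ^ Q * φ (.ofAdd (-a))) = s ^ (Q + Q) := by
      rw [mul_mul_mul_comm, ← map_mul, ← ofAdd_add, add_neg_cancel, ofAdd_zero, map_one, mul_one,
        pow_add]
    rw [h3, Prod.mk_add_mk, add_add_add_comm, ← map_add, add_neg_cancel, map_zero, add_zero,
      ← add_nsmul] at h2
    exact h2
  have hR3 : ∀ a b, R a → R b → R (-(a + b)) → False := by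
    intro a b h h' h''
    refine hpowP (Q + Q + Q) ?_
    have h2 := P.mul ((Q, Q • α + w a) + (Q, Q • α + w b)) _ _ _
      (hA (Q, Q • α + w a) (Q, Q • α + w b) _ _ (hAR a h) (hAR b h')) h''
    have h3 : s ^ Q * φ (.ofAdd a) * (s ^ Q * φ (.ofAdd b)) * (s ^ Q * φ (.ofAdd (-(a + b)))) =
        s ^ (Q + Q + Q) := by
      have h4 : φ (.ofAdd a) * φ (.ofAdd b) * φ (.ofAdd (-(a + b))) = 1 := by
        rw [← map_mul, ← map_mul, ← ofAdd_add, ← ofAdd_add, add_neg_cancel, ofAdd_zero, map_one]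
      rw [pow_add, pow_add, ← mul_one (s ^ Q * s ^ Q * s ^ Q), ← h4]
      ring
    rw [h3] at h2
    have h4 : ((Q, Q • α + w a) + (Q, Q • α + w b) + (Q, Q • α + w (-(a + b))) :
        ℕ × (Fin r → ZMod p)) = (Q + Q + Q, (Q + Q + Q) • α) := by
      ext1
      · rfl
      · simp only [Prod.snd_add, map_neg, map_add, add_nsmul]
        abel
    rwa [h4] at h2
  obtain ⟨e0, he0, hmin⟩ : ∃ e0 ∈ S, ∀ e ∈ S, e ≠ e0 → R (e - e0) := by
    let rel : S → S → Prop := fun a b => a ≠ b ∧ R (b - a)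
    have hwf : WellFounded rel := by
      have : IsTrans S rel := ⟨fun a b d ⟨hab, h⟩ ⟨hbd, h'⟩ => by
        have hne : a ≠ d := by
          rintro rfl
          refine hR2 _ h ?_
          rwa [neg_sub]
        refine ⟨hne, ?_⟩
        refine (htot d d.2 a a.2 fun h => hne (Subtype.ext h.symm)).resolve_right fun h'' => ?_
        refine hR3 _ _ h h' ?_
        convert h'' using 1
        abel⟩
      have : Std.Irrefl rel := ⟨fun a h => h.1 rfl⟩
      exact Finite.wellFounded_of_trans_of_irrefl rel
    obtain ⟨a, _, ha⟩ := hwf.has_min Set.univ ⟨⟨hS.choose, hS.choose_spec⟩, trivial⟩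
    refine ⟨a, a.2, fun e he hne => ?_⟩
    refine (htot e he a a.2 hne).resolve_right fun h => ?_
    exact ha ⟨e, he⟩ trivial ⟨fun h' => hne (congrArg Subtype.val h'), h⟩
  have h2 : c e0 • s ^ Q = -∑ e ∈ S.erase e0, c e • (s ^ Q * φ (.ofAdd (e - e0))) := by
    rw [eq_neg_iff_add_eq_zero]
    have h3 : c e0 • s ^ Q = c e0 • (s ^ Q * φ (.ofAdd (e0 - e0))) := by
      rw [sub_self, ofAdd_zero, map_one, mul_one]
    rw [h3, Finset.add_sum_erase S (fun e => c e • (s ^ Q * φ (.ofAdd (e - e0)))) he0]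
    have h4 : ∀ e, c e • (s ^ Q * φ (.ofAdd (e - e0))) =
        s ^ Q * φ (.ofAdd (-e0)) * (c e • φ (.ofAdd e)) := by
      intro e
      rw [mul_smul_comm, sub_eq_neg_add, ofAdd_add, map_mul, mul_assoc]
    rw [Finset.sum_congr rfl fun e _ => h4 e, ← Finset.mul_sum, hsum, mul_zero]
  have h3 : c e0 • s ^ Q ∈ ⨆ ψ, P.carrier (Q, ψ) := by
    rw [h2]
    refine neg_mem (sum_mem fun e he => Submodule.smul_mem _ _ ?_)
    exact Submodule.mem_iSup_of_mem _ (hmin e (Finset.mem_of_mem_erase he) (Finset.ne_of_mem_erase he))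
  rw [Submodule.smul_mem_iff _ (hc e0 he0)] at h3
  exact hpowP Q (mem_carrier_of_mem_iSup hind P (hpow Q).2 h3)

end Weights

end HIdeal

section KrullDim

theorem false_of_prime_chain {k K : Type*} [Field k] [Field K] [Algebra k K]
    (h : Algebra.trdeg k K ≤ 2) (B : Subalgebra k K) (hB : B.FG) (Q : Fin 4 → Ideal B)
    (hQ : ∀ i, (Q i).IsPrime) (hlt : StrictMono Q) : False := by
  have hft : Algebra.FiniteType k B := B.fg_iff_finiteType.1 hB
  obtain ⟨s, g, hg, hintegral⟩ := exists_integral_inj_algHom_of_fg k B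
  have hs : s ≤ 2 := by
    have h1 : AlgebraicIndependent k fun i : Fin s => (g (MvPolynomial.X i) : K) := by
      rw [algebraicIndependent_iff_injective_aeval]
      have h2 : MvPolynomial.aeval (fun i : Fin s => (g (MvPolynomial.X i) : K)) = B.val.comp g := by
        ext i
        simp
      rw [h2]
      exact Subtype.val_injective.comp hg
    have h2 := h1.lift_cardinalMk_le_trdeg.trans (Cardinal.lift_le.2 h)
    simpa using h2
  have hdim : ringKrullDim (MvPolynomial (Fin s) k) = s := by
    rw [MvPolynomial.ringKrullDim_of_isNoetherianRing, ringKrullDim_eq_zero_of_field]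
    simp
  let f : Fin 4 → PrimeSpectrum (MvPolynomial (Fin s) k) := fun i =>
    ⟨(Q i).comap (g : MvPolynomial (Fin s) k →+* B), (hQ i).comap _⟩
  have hf : StrictMono f := by
    intro i j hij
    algebraize [g.toRingHom]
    have : Algebra.IsIntegral (MvPolynomial (Fin s) k) B := ⟨hintegral⟩
    have h1 := Ideal.IsIntegral.comap_lt_comap (R := MvPolynomial (Fin s) k) (hlt hij)
    exact h1
  have h1 := Order.LTSeries.length_le_krullDim (LTSeries.mk 3 f hf)
  change _ ≤ ringKrullDim _ at h1
  rw [hdim] at h1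
  have h2 : (3 : WithBot ℕ∞) ≤ (s : WithBot ℕ∞) := h1
  have h3 : 3 ≤ s := by exact_mod_cast h2
  lia

end KrullDim

namespace HIdeal

variable {k K ι : Type*} [Field k] [Field K] [Algebra k K] [AddCancelCommMonoid ι]
  {A : ι → Submodule k K}

/-- The elements of `K` of the form `b / t ^ j` with `b` homogeneous of degree `j • i`. -/
def chart (hA : ∀ i j a b, a ∈ A i → b ∈ A j → a * b ∈ A (i + j)) (h1 : (1 : K) ∈ A 0)
    {i : ι} {t : K} (ht : t ∈ A i) : Subalgebra k K where
  carrier := {z | ∃ j : ℕ, z * t ^ j ∈ A (j • i)}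
  mul_mem' := by
    rintro a b ⟨j, hj⟩ ⟨l, hl⟩
    refine ⟨j + l, ?_⟩
    rw [pow_add, mul_mul_mul_comm, add_nsmul]
    exact hA _ _ _ _ hj hl
  add_mem' := by
    rintro a b ⟨j, hj⟩ ⟨l, hl⟩
    refine ⟨j + l, ?_⟩
    rw [add_mul]
    refine add_mem ?_ ?_
    · rw [pow_add, ← mul_assoc, add_nsmul]
      exact hA _ _ _ _ hj (pow_mem_piece hA h1 ht l)
    · rw [add_comm, pow_add, ← mul_assoc, add_nsmul]
      exact hA _ _ _ _ hl (pow_mem_piece hA h1 ht j)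
  algebraMap_mem' c := ⟨0, by
    rw [pow_zero, mul_one, zero_nsmul, Algebra.algebraMap_eq_smul_one]
    exact Submodule.smul_mem _ _ h1⟩

variable {hA : ∀ i j a b, a ∈ A i → b ∈ A j → a * b ∈ A (i + j)} {h1 : (1 : K) ∈ A 0}
  {i : ι} {t : K} {ht : t ∈ A i}

/-- The dehomogenization of a homogeneous ideal. -/
def chartIdeal (P : HIdeal A) (hA : ∀ i j a b, a ∈ A i → b ∈ A j → a * b ∈ A (i + j))
    (h1 : (1 : K) ∈ A 0) {i : ι} {t : K} (ht : t ∈ A i) : Ideal (chart hA h1 ht) where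
  carrier := {z | ∃ j : ℕ, (z : K) * t ^ j ∈ P.carrier (j • i)}
  zero_mem' := ⟨0, by simp⟩
  add_mem' := by
    rintro a b ⟨j, hj⟩ ⟨l, hl⟩
    refine ⟨j + l, ?_⟩
    rw [Subalgebra.coe_add, add_mul]
    refine add_mem ?_ ?_
    · rw [add_comm, pow_add, mul_left_comm, add_nsmul]
      exact P.mul _ _ _ _ (pow_mem_piece hA h1 ht l) hj
    · rw [pow_add, mul_left_comm, add_nsmul]
      exact P.mul _ _ _ _ (pow_mem_piece hA h1 ht j) hl
  smul_mem' := by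
    rintro ⟨a, j, hj⟩ b ⟨l, hl⟩
    refine ⟨j + l, ?_⟩
    rw [smul_eq_mul, Subalgebra.coe_mul, pow_add, mul_mul_mul_comm, add_nsmul]
    exact P.mul _ _ _ _ hj hl

theorem Prime.pow_notMem {P : HIdeal A} (hP : P.Prime)
    (hA : ∀ i j a b, a ∈ A i → b ∈ A j → a * b ∈ A (i + j)) (h1 : (1 : K) ∈ A 0) (ht : t ∈ A i)
    (htP : t ∉ P.carrier i) (j : ℕ) : t ^ j ∉ P.carrier (j • i) := fun h =>
  htP (hP.mem_of_pow_mem hA h1 ht h)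

theorem Prime.isPrime_chartIdeal {P : HIdeal A} (hP : P.Prime) (htP : t ∉ P.carrier i) :
    (P.chartIdeal hA h1 ht).IsPrime := by
  refine ⟨fun h => ?_, ?_⟩
  · have h2 : (1 : chart hA h1 ht) ∈ P.chartIdeal hA h1 ht := by rw [h]; trivial
    obtain ⟨j, hj⟩ := h2
    rw [Subalgebra.coe_one, one_mul] at hj
    exact hP.pow_notMem hA h1 ht htP j hj
  · rintro ⟨a, j, hj⟩ ⟨b, l, hl⟩ ⟨m, hm⟩
    have h2 := P.mul _ _ _ _ (pow_mem_piece hA h1 ht (j + l)) hm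
    have h3 : t ^ (j + l) * ((a * b) * t ^ m) = (t ^ m * (a * t ^ j)) * (b * t ^ l) := by ring
    have h4 : (j + l) • i + m • i = (m • i + j • i) + l • i := by
      rw [add_nsmul]
      abel
    simp only [Subalgebra.coe_mul] at h2
    rw [h3, h4] at h2
    refine (hP.2 _ _ _ _ (hA _ _ _ _ (pow_mem_piece hA h1 ht m) hj) hl h2).imp (fun h => ?_)
      fun h => ⟨l, h⟩
    refine ⟨j, (hP.2 _ _ _ _ (pow_mem_piece hA h1 ht m) hj h).resolve_left ?_⟩
    exact hP.pow_notMem hA h1 ht htP m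

theorem div_mem_chart {b : K} (hb : b ∈ A i) (ht0 : t ≠ 0) : b / t ∈ chart hA h1 ht :=
  ⟨1, by rwa [pow_one, div_mul_cancel₀ _ ht0, one_nsmul]⟩

theorem Prime.div_mem_chartIdeal_iff {P : HIdeal A} (hP : P.Prime) (htP : t ∉ P.carrier i)
    (ht0 : t ≠ 0) {b : K} (hb : b ∈ A i) :
    (⟨b / t, div_mem_chart hb ht0⟩ : chart hA h1 ht) ∈ P.chartIdeal hA h1 ht ↔ b ∈ P.carrier i := by
  refine ⟨fun ⟨j, hj⟩ => ?_, fun h => ⟨1, by rwa [pow_one, div_mul_cancel₀ _ ht0, one_nsmul]⟩⟩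
  have h2 := P.mul _ _ _ _ ht hj
  have h3 : t * (b / t * t ^ j) = t ^ j * b := by
    field_simp
  rw [h3, add_comm] at h2
  exact (hP.2 _ _ _ _ (pow_mem_piece hA h1 ht j) hb h2).resolve_left
    (hP.pow_notMem hA h1 ht htP j)

theorem chartIdeal_mono {P Q : HIdeal A} (h : P ≤ Q) :
    P.chartIdeal hA h1 ht ≤ Q.chartIdeal hA h1 ht := fun _ ⟨j, hj⟩ => ⟨j, h _ hj⟩

theorem false_of_chain (h2 : Algebra.trdeg k K ≤ 2)
    (hA : ∀ i j a b, a ∈ A i → b ∈ A j → a * b ∈ A (i + j)) (h1 : (1 : K) ∈ A 0)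
    (P : Fin 4 → HIdeal A) (hP : ∀ l, (P l).Prime) (hmono : Monotone P) (i : ι) {t : K} (ht : t ∈ A i)
    (htP : t ∉ (P 3).carrier i) (b : Fin 3 → K) (hb : ∀ l, b l ∈ (P l.succ).carrier i)
    (hb' : ∀ l : Fin 3, b l ∉ (P l.castSucc).carrier i) : False := by
  have ht0 : t ≠ 0 := fun h => htP (h ▸ zero_mem _)
  have htP' : ∀ l, t ∉ (P l).carrier i := fun l h => htP (hmono (Fin.le_last l) i h)
  have hbA : ∀ l, b l ∈ A i := fun l => (P l.succ).le i (hb l)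
  let B : Subalgebra k K := Algebra.adjoin k (Set.range fun l => b l / t)
  have hBfg : B.FG := Subalgebra.fg_def.2 ⟨_, Set.finite_range _, rfl⟩
  have hle : B ≤ chart hA h1 ht := by
    refine Algebra.adjoin_le ?_
    rintro _ ⟨l, rfl⟩
    exact div_mem_chart (hbA l) ht0
  let Q : Fin 4 → Ideal B := fun l =>
    ((P l).chartIdeal hA h1 ht).comap (Subalgebra.inclusion hle)
  refine false_of_prime_chain h2 B hBfg Q (fun l => ?_) (Fin.strictMono_iff_lt_succ.2 fun l => ?_)
  · have := (hP l).isPrime_chartIdeal (hA := hA) (h1 := h1) (ht := ht) (htP' l)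
    exact this.comap _
  · have hmem : b l / t ∈ B := Algebra.subset_adjoin ⟨l, rfl⟩
    refine SetLike.lt_iff_le_and_exists.2
      ⟨Ideal.comap_mono (chartIdeal_mono (hmono (Fin.castSucc_le_succ l))), ⟨b l / t, hmem⟩, ?_, ?_⟩
    · exact ((hP l.succ).div_mem_chartIdeal_iff (htP' _) ht0 (hbA l)).2 (hb l)
    · exact fun h => hb' l (((hP l.castSucc).div_mem_chartIdeal_iff (htP' _) ht0 (hbA l)).1 h)

theorem exists_mem_notMem_of_lt {P Q : HIdeal A} (h : P < Q) :
    ∃ i, ∃ b ∈ Q.carrier i, b ∉ P.carrier i := by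
  by_contra! hcon
  exact h.not_ge fun i b hb => hcon i b hb

theorem coh_three {r p : ℕ} (hp : p ≠ 0) {A : ℕ × (Fin r → ZMod p) → Submodule k K}
    (h2 : Algebra.trdeg k K ≤ 2)
    (hA : ∀ i j a b, a ∈ A i → b ∈ A j → a * b ∈ A (i + j)) (h1 : (1 : K) ∈ A 0) :
    Coh 3 (zero A) := by
  intro P0 hP0 _ J1 h01 P1 hP1 hJ1 J2 h12 P2 hP2 hJ2 J3 h23 P3 hP3 hJ3
  by_contra hirr
  simp only [Irr] at hirr
  push Not at hirr
  obtain ⟨m, hm, ψ, hψ⟩ := hirr 1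
  obtain ⟨t, ht, htP⟩ : ∃ t ∈ A (m, ψ), t ∉ P3.carrier (m, ψ) := by
    by_contra! hcon
    exact hψ (le_antisymm (P3.le _) hcon)
  let P : Fin 4 → HIdeal A := ![P0, P1, P2, P3]
  have hP : ∀ l, (P l).Prime := by
    intro l
    fin_cases l
    exacts [hP0, hP1, hP2, hP3]
  have hlt : StrictMono P := by
    refine Fin.strictMono_iff_lt_succ.2 fun l => ?_
    fin_cases l
    exacts [h01.trans_le hJ1, h12.trans_le hJ2, h23.trans_le hJ3]
  have htP' : ∀ l, t ∉ (P l).carrier (m, ψ) := fun l h => htP (hlt.monotone (Fin.le_last l) _ h)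
  have hex : ∀ l : Fin 3, ∃ i, ∃ b ∈ (P l.succ).carrier i, b ∉ (P l.castSucc).carrier i ∧ i.1 ≠ 0 := by
    intro l
    obtain ⟨i, b, hb, hb'⟩ := exists_mem_notMem_of_lt (hlt (Fin.castSucc_lt_succ (i := l)))
    refine ⟨(m, ψ) + i, t * b, (P _).mul _ _ _ _ ht hb, fun h => ?_, ?_⟩
    · exact ((hP _).2 _ _ _ _ ht ((P _).le _ hb) h).elim (htP' _) hb'
    · simp only [Prod.fst_add]
      lia
  choose i b hb hb' hi using hex
  let N : ℕ := m * ∏ l, (i l).1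
  have hN : N ≠ 0 := mul_ne_zero (by lia) (Finset.prod_ne_zero_iff.2 fun l _ => hi l)
  have hdeg : ∀ j : ℕ × (Fin r → ZMod p), j.1 ∣ N → ∃ n : ℕ, n ≠ 0 ∧ n • j = (p * N, 0) := by
    rintro ⟨j, φ⟩ ⟨d, hd⟩
    change N = j * d at hd
    refine ⟨p * d, mul_ne_zero hp fun h => hN (by rw [hd, h, mul_zero]), ?_⟩
    ext1
    · simp only [Prod.smul_fst, smul_eq_mul]
      rw [hd]
      ring
    · ext x
      simp
  obtain ⟨n0, hn0, hn0'⟩ := hdeg (m, ψ) (dvd_mul_right _ _)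
  choose n hn hn' using fun l => hdeg (i l)
    (Dvd.dvd.mul_left (Finset.dvd_prod_of_mem (fun l => (i l).1) (Finset.mem_univ l)) m)
  refine false_of_chain h2 hA h1 P hP hlt.monotone (p * N, 0) (t := t ^ n0) ?_ ?_
    (fun l => b l ^ n l) (fun l => ?_) fun l => ?_
  · rw [← hn0']
    exact pow_mem_piece hA h1 ht n0
  · rw [← hn0']
    exact hP3.pow_notMem hA h1 ht htP n0
  · rw [← hn' l]
    exact pow_mem_carrier hA h1 (hb l) (hn l)
  · rw [← hn' l]
    exact (hP _).pow_notMem hA h1 ((P _).le _ (hb l)) (hb' l) _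

end HIdeal

section IndepFinrank

theorem iSupIndep.finrank_iSup {k M ι : Type*} [Field k] [AddCommGroup M] [Module k M] [Fintype ι]
    [DecidableEq ι] {A : ι → Submodule k M} (h : iSupIndep A) [∀ i, FiniteDimensional k (A i)] :
    Module.finrank k (⨆ i, A i : Submodule k M) = ∑ i, Module.finrank k (A i) := by
  have h1 := h.dfinsupp_lsum_injective
  rw [Submodule.iSup_eq_range_dfinsupp_lsum, LinearMap.finrank_range_of_inj h1]
  exact Module.finrank_directSum (R := k) fun i => A i

end IndepFinrank

section Eigenspaces

variable {k K : Type*} [Field k] [Field K] [Algebra k K] {p r : ℕ} [Fact p.Prime]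
  {ζ : k} (hζ : IsPrimitiveRoot ζ p)
  (ρ : Multiplicative (Fin r → ZMod p) →* (K ≃ₐ[k] K))

/-- The value at `g` of the character of `(ℤ/p)^r` with weight `ψ`. -/
noncomputable def weightChar (hζ : IsPrimitiveRoot ζ p) (ψ g : Fin r → ZMod p) : k :=
  AddChar.zmodChar p hζ.pow_eq_one (ψ ⬝ᵥ g)

theorem weightChar_add_left (ψ φ g : Fin r → ZMod p) :
    weightChar hζ (ψ + φ) g = weightChar hζ ψ g * weightChar hζ φ g := by
  rw [weightChar, add_dotProduct, AddChar.map_add_eq_mul]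
  rfl

theorem weightChar_add_right (ψ g h : Fin r → ZMod p) :
    weightChar hζ ψ (g + h) = weightChar hζ ψ g * weightChar hζ ψ h := by
  rw [weightChar, dotProduct_add, AddChar.map_add_eq_mul]
  rfl

theorem weightChar_zero_left (g : Fin r → ZMod p) : weightChar hζ 0 g = 1 := by
  rw [weightChar, zero_dotProduct, AddChar.map_zero_eq_one]

theorem weightChar_zero_right (ψ : Fin r → ZMod p) : weightChar hζ ψ 0 = 1 := by
  rw [weightChar, dotProduct_zero, AddChar.map_zero_eq_one]

theorem weightChar_comm (ψ φ : Fin r → ZMod p) : weightChar hζ ψ φ = weightChar hζ φ ψ := by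
  rw [weightChar, dotProduct_comm]
  rfl

theorem weightChar_neg_mul (ψ g : Fin r → ZMod p) :
    weightChar hζ (-ψ) g * weightChar hζ ψ g = 1 := by
  rw [← weightChar_add_left, neg_add_cancel, weightChar_zero_left]

theorem exists_weightChar_ne_one {ψ : Fin r → ZMod p} (h : ψ ≠ 0) : ∃ g, weightChar hζ ψ g ≠ 1 := by
  obtain ⟨i, hi⟩ := Function.ne_iff.1 h
  refine ⟨Pi.single i (ψ i)⁻¹, ?_⟩
  rw [weightChar, dotProduct_single, mul_inv_cancel₀ hi, AddChar.zmodChar_apply,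
    ZMod.val_one_eq_one_mod, Nat.mod_eq_of_lt (Fact.out : p.Prime).one_lt, pow_one]
  exact hζ.ne_one (Fact.out : p.Prime).one_lt

theorem sum_weightChar {ψ : Fin r → ZMod p} (h : ψ ≠ 0) : ∑ g, weightChar hζ ψ g = 0 := by
  obtain ⟨g, hg⟩ := exists_weightChar_ne_one hζ h
  have h1 : weightChar hζ ψ g * ∑ x, weightChar hζ ψ x = ∑ x, weightChar hζ ψ x := by
    rw [Finset.mul_sum, ← Equiv.sum_comp (Equiv.addLeft g) fun x => weightChar hζ ψ x]
    exact Finset.sum_congr rfl fun x _ => (weightChar_add_right hζ ψ g x).symm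
  have h2 : (weightChar hζ ψ g - 1) * ∑ x, weightChar hζ ψ x = 0 := by
    rw [sub_mul, h1, one_mul, sub_self]
  exact (mul_eq_zero.1 h2).resolve_left (sub_ne_zero.2 hg)

/-- The semi-invariants of weight `ψ`. -/
noncomputable def weightSpace (ψ : Fin r → ZMod p) : Submodule k K where
  carrier := {f | ∀ g, ρ (.ofAdd g) f = weightChar hζ ψ g • f}
  add_mem' ha hb g := by rw [map_add, ha g, hb g, smul_add]
  zero_mem' g := by simp
  smul_mem' c x hx g := by rw [map_smul, hx g, smul_comm]

theorem mul_mem_weightSpace (ψ φ : Fin r → ZMod p) (a b : K) (ha : a ∈ weightSpace hζ ρ ψ)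
    (hb : b ∈ weightSpace hζ ρ φ) : a * b ∈ weightSpace hζ ρ (ψ + φ) := fun g => by
  rw [map_mul, ha g, hb g, weightChar_add_left, smul_mul_smul_comm]

theorem one_mem_weightSpace : (1 : K) ∈ weightSpace hζ ρ 0 := fun g => by
  rw [map_one, weightChar_zero_left, one_smul]

theorem inv_mem_weightSpace {ψ : Fin r → ZMod p} {a : K} (ha : a ∈ weightSpace hζ ρ ψ) :
    a⁻¹ ∈ weightSpace hζ ρ (-ψ) := fun g => by
  rw [map_inv₀, ha g, smul_inv₀, eq_inv_of_mul_eq_one_left (weightChar_neg_mul hζ ψ g)]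

/-- The unnormalized projector to the weight space. -/
noncomputable def weightProj (ψ : Fin r → ZMod p) : K →ₗ[k] K :=
  ∑ g, weightChar hζ (-ψ) g • (ρ (.ofAdd g)).toLinearMap

theorem weightProj_apply (ψ : Fin r → ZMod p) (f : K) :
    weightProj hζ ρ ψ f = ∑ g, weightChar hζ (-ψ) g • ρ (.ofAdd g) f := by
  simp [weightProj]

theorem weightProj_mem (ψ : Fin r → ZMod p) (f : K) :
    weightProj hζ ρ ψ f ∈ weightSpace hζ ρ ψ := by
  intro h
  rw [weightProj_apply, map_sum, Finset.smul_sum, ← Equiv.sum_comp (Equiv.addLeft h)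
    fun g => weightChar hζ ψ h • weightChar hζ (-ψ) g • ρ (.ofAdd g) f]
  refine Finset.sum_congr rfl fun g _ => ?_
  rw [map_smul, Equiv.coe_addLeft, weightChar_add_right, ofAdd_add, map_mul, AlgEquiv.mul_apply,
    smul_smul, ← mul_assoc, mul_comm (weightChar hζ ψ h), weightChar_neg_mul, one_mul]

theorem weightProj_eq_zero {ψ φ : Fin r → ZMod p} (h : φ ≠ ψ) {f : K}
    (hf : f ∈ weightSpace hζ ρ φ) : weightProj hζ ρ ψ f = 0 := by
  rw [weightProj_apply]
  have h1 : ∀ g, weightChar hζ (-ψ) g • ρ (.ofAdd g) f = weightChar hζ (-ψ + φ) g • f := fun g => by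
    rw [hf g, smul_smul, ← weightChar_add_left]
  rw [Finset.sum_congr rfl fun g _ => h1 g, ← Finset.sum_smul, sum_weightChar, zero_smul]
  rwa [Ne, neg_add_eq_zero, eq_comm]

theorem weightProj_eq_smul {ψ : Fin r → ZMod p} {f : K} (hf : f ∈ weightSpace hζ ρ ψ) :
    weightProj hζ ρ ψ f = ((p : k) ^ r) • f := by
  rw [weightProj_apply]
  have h1 : ∀ g, weightChar hζ (-ψ) g • ρ (.ofAdd g) f = f := fun g => by
    rw [hf g, smul_smul, weightChar_neg_mul, one_smul]
  rw [Finset.sum_congr rfl fun g _ => h1 g, Finset.sum_const, Finset.card_univ, Fintype.card_fun,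
    ZMod.card, Fintype.card_fin, ← Nat.cast_smul_eq_nsmul k, Nat.cast_pow]

theorem sum_weightProj (f : K) : ∑ ψ, weightProj hζ ρ ψ f = ((p : k) ^ r) • f := by
  simp only [weightProj_apply]
  rw [Finset.sum_comm, Finset.sum_eq_single 0]
  · have h1 : ∀ ψ : Fin r → ZMod p, weightChar hζ (-ψ) 0 • ρ (.ofAdd 0) f = f := fun ψ => by
      rw [weightChar_zero_right, one_smul, ofAdd_zero, map_one, AlgEquiv.one_apply]
    rw [Finset.sum_congr rfl fun g _ => h1 g, Finset.sum_const, Finset.card_univ, Fintype.card_fun,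
      ZMod.card, Fintype.card_fin, ← Nat.cast_smul_eq_nsmul k, Nat.cast_pow]
  · intro g _ hg
    rw [← Finset.sum_smul, ← Equiv.sum_comp (Equiv.neg (Fin r → ZMod p))]
    simp only [Equiv.neg_apply, neg_neg]
    rw [Finset.sum_congr rfl fun ψ _ => weightChar_comm hζ ψ g, sum_weightChar hζ hg, zero_smul]
  · simp

theorem natCast_pow_ne_zero_of_primitiveRoot {ζ : k} (hζ : IsPrimitiveRoot ζ p) : (p : k) ^ r ≠ 0 := by
  have : NeZero p := ⟨(Fact.out : p.Prime).ne_zero⟩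
  exact pow_ne_zero _ (hζ.neZero').out

theorem iSupIndep_weightSpace : iSupIndep (weightSpace hζ ρ) := by
  intro ψ
  rw [Submodule.disjoint_def]
  intro x hx hx'
  have h1 : ⨆ φ, ⨆ _ : φ ≠ ψ, weightSpace hζ ρ φ ≤ LinearMap.ker (weightProj hζ ρ ψ) :=
    iSup₂_le fun φ hφ f hf => weightProj_eq_zero hζ ρ hφ hf
  have h2 : weightProj hζ ρ ψ x = 0 := h1 hx'
  rw [weightProj_eq_smul hζ ρ hx] at h2
  exact (smul_eq_zero.1 h2).resolve_left (natCast_pow_ne_zero_of_primitiveRoot hζ)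

theorem le_iSup_inf_weightSpace {W : Submodule k K} (hW : ∀ g, ∀ w ∈ W, ρ g w ∈ W) :
    W ≤ ⨆ ψ, W ⊓ weightSpace hζ ρ ψ := by
  intro f hf
  rw [← Submodule.smul_mem_iff _ (natCast_pow_ne_zero_of_primitiveRoot (r := r) hζ),
    ← sum_weightProj hζ ρ f]
  refine sum_mem fun ψ _ => Submodule.mem_iSup_of_mem ψ ⟨?_, weightProj_mem hζ ρ ψ f⟩
  rw [weightProj_apply]
  exact sum_mem fun g _ => Submodule.smul_mem _ _ (hW _ _ hf)

theorem iSup_inf_weightSpace {W : Submodule k K} (hW : ∀ g, ∀ w ∈ W, ρ g w ∈ W) :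
    ⨆ ψ, W ⊓ weightSpace hζ ρ ψ = W :=
  le_antisymm (iSup_le fun _ => inf_le_left) (le_iSup_inf_weightSpace hζ ρ hW)

theorem exists_mem_weightSpace_ne_zero (hρ : Function.Injective ρ) (ψ : Fin r → ZMod p) :
    ∃ f ∈ weightSpace hζ ρ ψ, f ≠ 0 := by
  by_contra! hcon
  have h1 : ∀ f, weightProj hζ ρ ψ f = 0 := fun f => hcon _ (weightProj_mem hζ ρ ψ f)
  let m : (Fin r → ZMod p) → (K →* K) := fun g => ((ρ (.ofAdd g) : K →ₐ[k] K) : K →* K)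
  have hm : Function.Injective m := fun g h hgh => by
    have h2 : ρ (.ofAdd g) = ρ (.ofAdd h) := AlgEquiv.ext fun x => DFunLike.congr_fun hgh x
    exact Multiplicative.ofAdd.injective (hρ h2)
  have h2 := (linearIndependent_monoidHom K K).comp m hm
  rw [Fintype.linearIndependent_iff] at h2
  have h3 := h2 (fun g => algebraMap k K (weightChar hζ (-ψ) g)) (by
    ext f
    have h4 := h1 f
    rw [weightProj_apply] at h4
    simp only [Finset.sum_apply, Pi.smul_apply, Pi.zero_apply, smul_eq_mul]
    rw [← h4]
    exact Finset.sum_congr rfl fun g _ => (Algebra.smul_def _ _).symm) 0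
  rw [weightChar_zero_right, map_one] at h3
  exact one_ne_zero h3

end Eigenspaces

section Stability

variable {k K : Type*} [Field k] [Field K] [Algebra k K]

theorem map_mem_intClosure (σ : K ≃ₐ[k] K) {W W' : Submodule k K} (hW : ∀ w ∈ W, σ w ∈ W') {b : K}
    (hb : b ∈ intClosure ⊥ W) : σ b ∈ intClosure ⊥ W' := by
  intro v hv
  obtain ⟨w, hw, c, hc, rfl⟩ := hb (v.comap (σ : K →+* K)) fun z hz => by
    obtain ⟨a, rfl⟩ := Algebra.mem_bot.1 hz
    change σ (algebraMap k K a) ∈ v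
    rw [σ.commutes]
    exact hv _ (Subalgebra.algebraMap_mem _ a)
  exact ⟨σ w, hW w hw, σ c, hc, map_mul _ _ _⟩

theorem map_mem_pow (σ : K ≃ₐ[k] K) {W : Submodule k K} (hW : ∀ w ∈ W, σ w ∈ W) (n : ℕ) :
    ∀ w ∈ W ^ n, σ w ∈ W ^ n := by
  intro w hw
  have h1 : (W ^ n).map (σ : K →ₐ[k] K).toLinearMap ≤ W ^ n := by
    rw [Submodule.map_pow]
    exact pow_le_pow_left' (Submodule.map_le_iff_le_comap.2 hW) n
  exact h1 ⟨w, hw, rfl⟩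

end Stability

section Relation

variable {k K : Type*} [Field k] [Field K] [Algebra k K]

/-- The homomorphism `γ ↦ ∏ f_j ^ γ_j` for nonzero elements `f_j` of a field. -/
def zpowHom {J : Type*} [Fintype J] (f : J → K) (hf : ∀ j, f j ≠ 0) :
    Multiplicative (J → ℤ) →* K where
  toFun γ := ∏ j, f j ^ (γ.toAdd j)
  map_one' := by simp
  map_mul' a b := by
    rw [← Finset.prod_mul_distrib]
    exact Finset.prod_congr rfl fun j _ => by rw [toAdd_mul, Pi.add_apply, zpow_add₀ (hf j)]

theorem zpowHom_apply {J : Type*} [Fintype J] (f : J → K) (hf : ∀ j, f j ≠ 0) (γ : J → ℤ) :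
    zpowHom f hf (.ofAdd γ) = ∏ j, f j ^ γ j := rfl

theorem exists_relation_of_trdeg_le_two (h2 : Algebra.trdeg k K ≤ 2) (f : Fin 3 → K)
    (hf : ∀ j, f j ≠ 0) : ∃ (S : Finset (Fin 3 → ℤ)) (c : (Fin 3 → ℤ) → k), S.Nonempty ∧
      (∀ e ∈ S, c e ≠ 0) ∧ ∑ e ∈ S, c e • zpowHom f hf (.ofAdd e) = 0 := by
  classical
  have h1 : ¬ AlgebraicIndependent k f := fun h => by
    have h3 := h.lift_cardinalMk_le_trdeg
    have h4 := h3.trans (Cardinal.lift_le.2 h2)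
    simp only [Cardinal.mk_fintype, Fintype.card_fin, Cardinal.lift_natCast,
      Cardinal.lift_ofNat] at h4
    exact absurd (by exact_mod_cast h4 : (3 : ℕ) ≤ 2) (by norm_num)
  rw [algebraicIndependent_iff] at h1
  push Not at h1
  obtain ⟨P, hP, hP0⟩ := h1
  let u : (Fin 3 →₀ ℕ) → (Fin 3 → ℤ) := fun m j => (m j : ℤ)
  have hu : Function.Injective u := fun a b h => Finsupp.ext fun j => by
    have h3 : (a j : ℤ) = b j := congrFun h j
    exact_mod_cast h3
  refine ⟨P.support.image u, fun e => P.coeff (Function.invFun u e), ?_, ?_, ?_⟩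
  · exact (MvPolynomial.support_nonempty.2 hP0).image _
  · intro e he
    obtain ⟨m, hm, rfl⟩ := Finset.mem_image.1 he
    change P.coeff (Function.invFun u (u m)) ≠ 0
    rw [Function.leftInverse_invFun hu]
    exact MvPolynomial.mem_support_iff.1 hm
  · rw [Finset.sum_image fun a _ b _ h => hu h]
    rw [MvPolynomial.aeval_def, MvPolynomial.eval₂_eq'] at hP
    rw [← hP]
    refine Finset.sum_congr rfl fun m _ => ?_
    simp only [Function.leftInverse_invFun hu m, Algebra.smul_def, zpowHom_apply]
    simp [u]

theorem exists_eq_nsmul_of_ne_zero {J : Type*} [Fintype J] {p : ℕ} (hp : p.Prime) {γ : J → ℤ}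
    (h : γ ≠ 0) : ∃ q : ℕ, q ≠ 0 ∧ ∃ δ : J → ℤ, γ = q • δ ∧ ∃ j, ¬ (p : ℤ) ∣ δ j := by
  classical
  obtain ⟨j0, hj0⟩ := Function.ne_iff.1 h
  obtain ⟨δ, h1, h3⟩ := Finset.extract_gcd γ (⟨j0, Finset.mem_univ _⟩ : Finset.univ.Nonempty)
  have hg : ((Finset.univ.gcd γ).natAbs : ℤ) = Finset.univ.gcd γ := by
    rw [Int.natCast_natAbs, Int.abs_eq_normalize, Finset.normalize_gcd]
  refine ⟨(Finset.univ.gcd γ).natAbs, ?_, δ, ?_, ?_⟩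
  · rw [Int.natAbs_ne_zero]
    intro h0
    exact hj0 (by rw [h1 j0 (Finset.mem_univ _), h0, zero_mul]; rfl)
  · funext j
    rw [Pi.smul_apply, nsmul_eq_mul, hg]
    exact h1 j (Finset.mem_univ _)
  · by_contra! hcon
    have h4 : (p : ℤ) ∣ Finset.univ.gcd δ := Finset.dvd_gcd fun j _ => hcon j
    rw [h3] at h4
    exact hp.one_lt.ne' (by simpa using Int.eq_one_of_dvd_one (by positivity) h4)

end Relation

section Homogeneous

variable {k K : Type*} [Field k] [Field K] [Algebra k K] {p r : ℕ} [Fact p.Prime]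
  {ζ : k} (hζ : IsPrimitiveRoot ζ p)
  (ρ : Multiplicative (Fin r → ZMod p) →* (K ≃ₐ[k] K))

theorem pow_mem_weightSpace {ψ : Fin r → ZMod p} {a : K} (ha : a ∈ weightSpace hζ ρ ψ) (n : ℕ) :
    a ^ n ∈ weightSpace hζ ρ (n • ψ) := by
  induction n with
  | zero => simpa using one_mem_weightSpace hζ ρ
  | succ n ih =>
    rw [pow_succ, succ_nsmul]
    exact mul_mem_weightSpace hζ ρ _ _ _ _ ih ha

theorem zpow_mem_weightSpace {ψ : Fin r → ZMod p} {a : K} (ha : a ∈ weightSpace hζ ρ ψ) (n : ℤ) :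
    a ^ n ∈ weightSpace hζ ρ (n • ψ) := by
  cases n with
  | ofNat n => simpa using pow_mem_weightSpace hζ ρ ha n
  | negSucc n =>
    rw [zpow_negSucc, negSucc_zsmul]
    exact inv_mem_weightSpace hζ ρ (pow_mem_weightSpace hζ ρ ha _)

theorem prod_mem_weightSpace {J : Type*} (s : Finset J) {ψ : J → Fin r → ZMod p} {a : J → K}
    (ha : ∀ j ∈ s, a j ∈ weightSpace hζ ρ (ψ j)) :
    ∏ j ∈ s, a j ∈ weightSpace hζ ρ (∑ j ∈ s, ψ j) := by
  classical
  induction s using Finset.induction_on with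
  | empty => simpa using one_mem_weightSpace hζ ρ
  | insert j s hj ih =>
    rw [Finset.prod_insert hj, Finset.sum_insert hj]
    exact mul_mem_weightSpace hζ ρ _ _ _ _ (ha j (Finset.mem_insert_self _ _))
      (ih fun i hi => ha i (Finset.mem_insert_of_mem hi))

theorem exists_homogeneous_span {W : Submodule k K} [FiniteDimensional k W]
    (hW : ∀ g, ∀ w ∈ W, ρ g w ∈ W) : ∃ T : Finset K, Submodule.span k (T : Set K) = W ∧
      ∀ s ∈ T, ∃ α, s ∈ weightSpace hζ ρ α := by
  classical
  have h1 : ∀ ψ, ∃ t : Finset K, Submodule.span k (t : Set K) = W ⊓ weightSpace hζ ρ ψ := fun ψ => by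
    have : FiniteDimensional k (W ⊓ weightSpace hζ ρ ψ : Submodule k K) :=
      Submodule.finiteDimensional_of_le inf_le_left
    exact Module.Finite.iff_fg.1 this
  choose t ht using h1
  refine ⟨Finset.univ.biUnion t, ?_, fun s hs => ?_⟩
  · rw [Finset.coe_biUnion, Submodule.span_iUnion₂]
    simp only [ht, Finset.coe_univ, Set.mem_univ, iSup_pos]
    exact iSup_inf_weightSpace hζ ρ hW
  · obtain ⟨ψ, -, hψ⟩ := Finset.mem_biUnion.1 hs
    have h2 : s ∈ W ⊓ weightSpace hζ ρ ψ := by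
      rw [← ht]
      exact Submodule.subset_span hψ
    exact ⟨ψ, h2.2⟩

theorem map_mem_span_of_homogeneous {T : Set K} (hT : ∀ s ∈ T, ∃ α, s ∈ weightSpace hζ ρ α)
    (g : Multiplicative (Fin r → ZMod p)) : ∀ w ∈ Submodule.span k T, ρ g w ∈ Submodule.span k T := by
  have h1 : Submodule.span k T ≤ (Submodule.span k T).comap (ρ g : K →ₐ[k] K).toLinearMap := by
    refine Submodule.span_le.2 fun s hs => ?_
    obtain ⟨α, hα⟩ := hT s hs
    change ρ g s ∈ Submodule.span k T
    rw [← ofAdd_toAdd g, hα]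
    exact Submodule.smul_mem _ _ (Submodule.subset_span hs)
  exact fun w hw => h1 hw

/-- Every finite-dimensional subspace containing `1` divides a stable one. -/
theorem exists_stable_mul (U : Submodule k K) [FiniteDimensional k U] (hU : (1 : K) ∈ U) :
    ∃ W : Submodule k K, FiniteDimensional k W ∧ (1 : K) ∈ W ∧ ∀ g, ∀ w ∈ U * W, ρ g w ∈ U * W := by
  classical
  let F : Multiplicative (Fin r → ZMod p) → Submodule k K :=
    fun g => U.map (ρ g : K →ₐ[k] K).toLinearMap
  have hF1 : F 1 = U := by
    simp only [F, map_one]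
    exact Submodule.map_id U
  have hFg : ∀ g h, (F h).map (ρ g : K →ₐ[k] K).toLinearMap = F (g * h) := fun g h => by
    simp only [F, map_mul, ← Submodule.map_comp]
    rfl
  have hone : ∀ g, (1 : K) ∈ F g := fun g => ⟨1, hU, map_one (ρ g)⟩
  refine ⟨∏ g ∈ Finset.univ.erase 1, F g, ?_, ?_, ?_⟩
  · refine Finset.prod_induction F (fun W => FiniteDimensional k W) ?_ ?_ ?_
    · intro a b ha hb
      exact Module.Finite.iff_fg.2 ((Module.Finite.iff_fg.1 ha).mul (Module.Finite.iff_fg.1 hb))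
    · rw [Submodule.one_eq_span]
      infer_instance
    · intro g _
      infer_instance
  · have h := Finset.prod_induction (s := Finset.univ.erase (1 : Multiplicative (Fin r → ZMod p))) F
      (fun W => (1 : K) ∈ W) (fun a b ha hb => by simpa using Submodule.mul_mem_mul ha hb)
      (Submodule.one_le.1 le_rfl) (fun g _ => hone g)
    exact h
  · have h1 : U * ∏ g ∈ Finset.univ.erase 1, F g = ∏ g, F g := by
      rw [← Finset.mul_prod_erase Finset.univ F (Finset.mem_univ 1), hF1]
    rw [h1]
    intro g w hw
    have h2 : (∏ h, F h).map (ρ g : K →ₐ[k] K).toLinearMap = ∏ h, F h := by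
      have h3 := map_prod (Submodule.mapHom (ρ g : K →ₐ[k] K)) F Finset.univ
      change (∏ h, F h).map (ρ g : K →ₐ[k] K).toLinearMap
        = ∏ h, (F h).map (ρ g : K →ₐ[k] K).toLinearMap at h3
      rw [h3]
      simp only [hFg]
      exact Equiv.prod_comp (Equiv.mulLeft g) F
    rw [← h2]
    exact ⟨w, hw, rfl⟩

end Homogeneous

section Assembly

variable {k K : Type*} [Field k] [Field K] [Algebra k K] {p r : ℕ} [Fact p.Prime]
  {ζ : k} (ρ : Multiplicative (Fin r → ZMod p) →* (K ≃ₐ[k] K))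

theorem exists_dvd_finrank_of_homogeneous [PerfectField k] (hζ : IsPrimitiveRoot ζ p) (hp5 : 5 ≤ p)
    (h2 : Algebra.trdeg k K ≤ 2) (T : Finset K)
    (h1 : (1 : K) ∈ Submodule.span k (T : Set K))
    (hgen : IntermediateField.adjoin k (T : Set K) = ⊤)
    (hTh : ∀ s ∈ T, ∃ α, s ∈ weightSpace hζ ρ α)
    (hfin : ∀ n, FiniteDimensional k (intClosure ⊥ (Submodule.span k (T : Set K) ^ n)))
    {Γ : Type*} [AddCommGroup Γ] (w : Γ →+ (Fin r → ZMod p)) (φ : Multiplicative Γ →* K)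
    (hφ : ∀ γ, φ (.ofAdd γ) ∈ weightSpace hζ ρ (w γ)) (S E : Finset Γ)
    (hE : ∀ e ∈ S, ∀ e' ∈ S, e ≠ e' → ∃ q : ℕ, q ≠ 0 ∧ ∃ γ ∈ E, e - e' = q • γ ∧ w γ ≠ 0)
    (hTE : ∀ s ∈ T, ∀ γ ∈ E, s * φ (.ofAdd γ) ∈ Submodule.span k (T : Set K) ∨
      s * φ (.ofAdd (-γ)) ∈ Submodule.span k (T : Set K))
    (c : Γ → k) (hc : ∀ e ∈ S, c e ≠ 0) (hS : S.Nonempty)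
    (hsum : ∑ e ∈ S, c e • φ (.ofAdd e) = 0) :
    ∃ N0, ∀ N, N0 ≤ N →
      p ∣ Module.finrank k (intClosure ⊥ (Submodule.span k (T : Set K) ^ N)) := by
  classical
  let V := Submodule.span k (T : Set K)
  let G : ℕ → Submodule k K := fun n => intClosure ⊥ (V ^ n)
  let D := weightSpace hζ ρ
  have hVG : V ≤ G 1 := by
    simpa only [G, pow_one] using le_intClosure ⊥ V
  have hGm : ∀ i j a b, a ∈ G i → b ∈ G j → a * b ∈ G (i + j) := fun i j a b ha hb => by
    simpa only [G, pow_add] using mul_mem_intClosure_mul ha hb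
  have hG1 : (1 : K) ∈ G 0 := by
    refine le_intClosure ⊥ _ ?_
    rw [pow_zero]
    exact Submodule.one_le.1 le_rfl
  have hstab : ∀ n g, ∀ x ∈ G n, ρ g x ∈ G n := fun n g x hx =>
    map_mem_intClosure (ρ g) (map_mem_pow (ρ g) (map_mem_span_of_homogeneous hζ ρ hTh g) n) hx
  have hG : ∀ n, ⨆ ψ, G n ⊓ D ψ = G n := fun n => iSup_inf_weightSpace hζ ρ (hstab n)
  have hN := isNoetherian_gradedSubmodule_intClosure T h1 hgen
  have hV : ∀ n, V * G n ≤ G (n + 1) := fun n => Submodule.mul_le.2 fun a ha b hb => by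
    rw [add_comm]
    exact hGm 1 n a b (hVG ha) hb
  have hT1 : ∀ s ∈ (T : Set K), ∃ α, s ∈ G 1 ⊓ D α := fun s hs =>
    (hTh s hs).imp fun α hα => ⟨hVG (Submodule.subset_span hs), hα⟩
  obtain ⟨n0, hn0⟩ := exists_forall_le_mul_of_isNoetherian hV Submodule.subset_span hN
  have hind : iSupIndep D := iSupIndep_weightSpace hζ ρ
  have hD : ∀ i j a b, a ∈ D i → b ∈ D j → a * b ∈ D (i + j) := mul_mem_weightSpace hζ ρ
  have h1D : (1 : K) ∈ D 0 := one_mem_weightSpace hζ ρ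
  let A : ℕ × (Fin r → ZMod p) → Submodule k K := fun i => G i.1 ⊓ D i.2
  have hwf : WellFoundedGT (HIdeal A) := wellFoundedGT_hIdeal hind hT1 hN
  have hfA : ∀ i, FiniteDimensional k (A i) := fun i =>
    have := hfin i.1
    Submodule.finiteDimensional_of_le (S₂ := G i.1) inf_le_left
  have hA : ∀ i j a b, a ∈ A i → b ∈ A j → a * b ∈ A (i + j) := fun i j a b ha hb =>
    ⟨hGm _ _ _ _ ha.1 hb.1, hD _ _ _ _ ha.2 hb.2⟩
  have h1A : (1 : K) ∈ A 0 := ⟨hG1, h1D⟩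
  obtain ⟨N0, hN0⟩ := HIdeal.dvd_sum_finrank hp5 hA h1A
    (HIdeal.irr_or_exists_ne hind hD h1D hGm hG1 (fun n => (hG n).ge) hn0 hT1 w φ hφ S E hE
      (fun s hs γ hγ => (hTE s hs γ hγ).imp (fun h => hVG h) fun h => hVG h) c hc hS hsum)
    (HIdeal.coh_three (Fact.out : p.Prime).ne_zero h2 hA h1A)
  refine ⟨N0, fun N hN => ?_⟩
  have h3 : iSupIndep fun ψ => A (N, ψ) := hind.mono fun ψ => inf_le_right
  have h4 := h3.finrank_iSup
  have h5 : ⨆ ψ, A (N, ψ) = G N := hG N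
  rw [h5] at h4
  change p ∣ Module.finrank k (G N)
  rw [h4]
  exact hN0 N hN

/-- The homomorphism `ℤ^J → M` with prescribed images of the standard basis. -/
def zsmulHom {J M : Type*} [Fintype J] [AddCommGroup M] (e : J → M) : (J → ℤ) →+ M where
  toFun γ := ∑ j, γ j • e j
  map_zero' := by simp
  map_add' a b := by simp only [Pi.add_apply, add_smul, Finset.sum_add_distrib]

theorem zsmulHom_apply {J M : Type*} [Fintype J] [AddCommGroup M] (e : J → M) (γ : J → ℤ) :
    zsmulHom e γ = ∑ j, γ j • e j := rfl

theorem zsmulHom_single_ne_zero {J I : Type*} [Fintype J] [DecidableEq I] {ι : J → I}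
    (hι : Function.Injective ι) {p : ℕ} {γ : J → ℤ} (h : ∃ j, ¬ (p : ℤ) ∣ γ j) :
    zsmulHom (fun j => (Pi.single (ι j) 1 : I → ZMod p)) γ ≠ 0 := by
  obtain ⟨j, hj⟩ := h
  intro h
  refine hj ((ZMod.intCast_zmod_eq_zero_iff_dvd _ _).1 ?_)
  have h3 := congrFun h (ι j)
  rw [zsmulHom_apply, Finset.sum_apply, Finset.sum_eq_single j] at h3
  · simpa using h3
  · intro i _ hi
    have : ι j ≠ ι i := fun h => hi (hι h.symm)
    simp [this]
  · simp

theorem exists_weighted_relation (hζ : IsPrimitiveRoot ζ p) (hr : 3 ≤ r)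
    (hρ : Function.Injective ρ) (h2 : Algebra.trdeg k K ≤ 2) :
    ∃ (w : (Fin 3 → ℤ) →+ (Fin r → ZMod p)) (φ : Multiplicative (Fin 3 → ℤ) →* K)
      (S E : Finset (Fin 3 → ℤ)) (c : (Fin 3 → ℤ) → k),
      (∀ γ, φ (.ofAdd γ) ∈ weightSpace hζ ρ (w γ)) ∧ S.Nonempty ∧ (∀ e ∈ S, c e ≠ 0) ∧
      ∑ e ∈ S, c e • φ (.ofAdd e) = 0 ∧
      ∀ e ∈ S, ∀ e' ∈ S, e ≠ e' → ∃ q : ℕ, q ≠ 0 ∧ ∃ γ ∈ E, e - e' = q • γ ∧ w γ ≠ 0 := by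
  classical
  let e : Fin 3 → Fin r → ZMod p := fun j => Pi.single (Fin.castLE hr j) 1
  have hf : ∀ j, ∃ f ∈ weightSpace hζ ρ (e j), f ≠ 0 := fun j =>
    exists_mem_weightSpace_ne_zero hζ ρ hρ (e j)
  choose f hfe hf0 using hf
  obtain ⟨S, c, hS, hc, hsum⟩ := exists_relation_of_trdeg_le_two h2 f hf0
  let w : (Fin 3 → ℤ) →+ (Fin r → ZMod p) := zsmulHom e
  have hφ : ∀ γ, zpowHom f hf0 (.ofAdd γ) ∈ weightSpace hζ ρ (w γ) := fun γ => by
    rw [zsmulHom_apply, zpowHom_apply]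
    exact prod_mem_weightSpace hζ ρ Finset.univ fun j _ => zpow_mem_weightSpace hζ ρ (hfe j) (γ j)
  have hdiv : ∀ γ : Fin 3 → ℤ, ∃ δ : Fin 3 → ℤ, γ ≠ 0 → ∃ q : ℕ, q ≠ 0 ∧ γ = q • δ ∧ w δ ≠ 0 := by
    intro γ
    by_cases h : γ = 0
    · exact ⟨0, fun h' => absurd h h'⟩
    · obtain ⟨q, hq, δ, h3, h4⟩ := exists_eq_nsmul_of_ne_zero (Fact.out : p.Prime) h
      exact ⟨δ, fun _ => ⟨q, hq, h3, zsmulHom_single_ne_zero (Fin.castLE_injective hr) h4⟩⟩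
  choose δ hδ using hdiv
  refine ⟨w, zpowHom f hf0, S, (S ×ˢ S).image fun a => δ (a.1 - a.2), c, hφ, hS, hc, hsum, ?_⟩
  intro a ha b hb hab
  obtain ⟨q, hq, h3, h4⟩ := hδ (a - b) (sub_ne_zero.2 hab)
  exact ⟨q, hq, δ (a - b), Finset.mem_image.2 ⟨(a, b), Finset.mk_mem_product ha hb, rfl⟩, h3, h4⟩

/-- A homogeneous spanning set can be enlarged so that each of its elements may be multiplied by
`φ γ` or by `φ (-γ)` for each `γ` in a given finite set. -/
theorem exists_homogeneous_enlargement (hζ : IsPrimitiveRoot ζ p) (T0 : Finset K)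
    (hT0h : ∀ s ∈ T0, ∃ α, s ∈ weightSpace hζ ρ α) {Γ : Type*} [AddCommGroup Γ]
    (w : Γ →+ (Fin r → ZMod p)) (φ : Multiplicative Γ →* K)
    (hφ : ∀ γ, φ (.ofAdd γ) ∈ weightSpace hζ ρ (w γ)) (E : Finset Γ) :
    ∃ T T1 : Finset K, (1 : K) ∈ T1 ∧
      Submodule.span k (T : Set K) = Submodule.span k (T0 : Set K) * Submodule.span k (T1 : Set K) ∧
      (∀ s ∈ T, ∃ α, s ∈ weightSpace hζ ρ α) ∧
      ∀ s ∈ T, ∀ γ ∈ E, s * φ (.ofAdd γ) ∈ T ∨ s * φ (.ofAdd (-γ)) ∈ T := by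
  classical
  let m : Finset Γ → K := fun I => ∏ γ ∈ I, φ (.ofAdd γ)
  have hm : ∀ I, m I ∈ weightSpace hζ ρ (∑ γ ∈ I, w γ) := fun I =>
    prod_mem_weightSpace hζ ρ I fun γ _ => hφ γ
  refine ⟨Finset.image₂ (fun a b => a * b) T0 (E.powerset.image m), E.powerset.image m,
    Finset.mem_image.2 ⟨∅, Finset.empty_mem_powerset _, Finset.prod_empty⟩, ?_, ?_, ?_⟩
  · rw [Submodule.span_mul_span, Finset.coe_image₂]
    rfl
  · intro s hs
    obtain ⟨a, ha, b, hb, rfl⟩ := Finset.mem_image₂.1 hs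
    obtain ⟨I, -, rfl⟩ := Finset.mem_image.1 hb
    obtain ⟨α, hα⟩ := hT0h a ha
    exact ⟨_, mul_mem_weightSpace hζ ρ _ _ _ _ hα (hm I)⟩
  · intro s hs γ hγ
    obtain ⟨a, ha, b, hb, rfl⟩ := Finset.mem_image₂.1 hs
    obtain ⟨I, hI, rfl⟩ := Finset.mem_image.1 hb
    rw [Finset.mem_powerset] at hI
    by_cases h : γ ∈ I
    · right
      refine Finset.mem_image₂.2 ⟨a, ha, m (I.erase γ),
        Finset.mem_image.2 ⟨_, Finset.mem_powerset.2 ((Finset.erase_subset _ _).trans hI), rfl⟩, ?_⟩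
      have h3 : φ (.ofAdd γ) * φ (.ofAdd (-γ)) = 1 := by
        rw [← map_mul, ← ofAdd_add, add_neg_cancel, ofAdd_zero, map_one]
      have h4 : m I = φ (.ofAdd γ) * m (I.erase γ) :=
        (Finset.mul_prod_erase I (fun γ => φ (.ofAdd γ)) h).symm
      rw [mul_assoc, h4, mul_right_comm, h3, one_mul]
    · left
      refine Finset.mem_image₂.2 ⟨a, ha, m (insert γ I),
        Finset.mem_image.2 ⟨_, Finset.mem_powerset.2 (Finset.insert_subset hγ hI), rfl⟩, ?_⟩
      have h4 : m (insert γ I) = φ (.ofAdd γ) * m I := Finset.prod_insert h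
      rw [h4, mul_assoc, mul_comm (φ _)]

theorem exists_dvd_finrank_intClosure [PerfectField k] (hζ : IsPrimitiveRoot ζ p) (hp5 : 5 ≤ p)
    (hr : 3 ≤ r) (hρ : Function.Injective ρ) (h2 : Algebra.trdeg k K ≤ 2) (U : Submodule k K)
    [FiniteDimensional k U] (h1 : (1 : K) ∈ U)
    (hgen : IntermediateField.adjoin k (U : Set K) = ⊤)
    (hfin : ∀ W : Submodule k K, FiniteDimensional k W → FiniteDimensional k (intClosure ⊥ W)) :
    ∃ W : Submodule k K, FiniteDimensional k W ∧ W ≠ ⊥ ∧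
      ∃ N0, ∀ N, N0 ≤ N → p ∣ Module.finrank k (intClosure ⊥ ((U * W) ^ N)) := by
  obtain ⟨W0, hW0, hW1, hW0s⟩ := exists_stable_mul ρ U h1
  have hUW : FiniteDimensional k (U * W0 : Submodule k K) :=
    Module.Finite.iff_fg.2 ((Module.Finite.iff_fg.1 ‹_›).mul (Module.Finite.iff_fg.1 hW0))
  obtain ⟨T0, hT0, hT0h⟩ := exists_homogeneous_span hζ ρ hW0s
  obtain ⟨w, φ, S, E, c, hφ, hS, hc, hsum, hE⟩ := exists_weighted_relation ρ hζ hr hρ h2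
  obtain ⟨T, T1, hT1, hTspan, hTh, hTE⟩ := exists_homogeneous_enlargement ρ hζ T0 hT0h w φ hφ E
  rw [hT0, mul_assoc] at hTspan
  have hone : (1 : K) ∈ W0 * Submodule.span k (T1 : Set K) := by
    have h := Submodule.mul_mem_mul hW1 (Submodule.subset_span (R := k) (s := (T1 : Set K)) hT1)
    rwa [one_mul] at h
  have hUT : U ≤ Submodule.span k (T : Set K) := by
    rw [hTspan]
    intro u hu
    have h := Submodule.mul_mem_mul hu hone
    rwa [mul_one] at h
  have hTfin : FiniteDimensional k (Submodule.span k (T : Set K)) :=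
    FiniteDimensional.span_finset k T
  refine ⟨W0 * Submodule.span k (T1 : Set K), ?_, ?_, ?_⟩
  · exact Module.Finite.iff_fg.2 ((Module.Finite.iff_fg.1 hW0).mul ⟨T1, rfl⟩)
  · exact fun h => one_ne_zero ((Submodule.mem_bot k).1 (h ▸ hone))
  rw [← hTspan]
  refine exists_dvd_finrank_of_homogeneous ρ hζ hp5 h2 T (hUT h1) ?_ hTh ?_ w φ hφ S E hE ?_ c hc hS
    hsum
  · rw [eq_top_iff, ← hgen, IntermediateField.adjoin_le_iff]
    intro u hu
    have h3 : Submodule.span k (T : Set K) ≤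
        Subalgebra.toSubmodule (IntermediateField.adjoin k (T : Set K)).toSubalgebra :=
      Submodule.span_le.2 (IntermediateField.subset_adjoin k _)
    exact h3 (hUT hu)
  · exact fun n => hfin _ (Module.Finite.iff_fg.2 ((Module.Finite.iff_fg.1 hTfin).pow n))
  · exact fun s hs γ hγ => (hTE s hs γ hγ).imp (fun h => Submodule.subset_span h)
      fun h => Submodule.subset_span h

end Assembly

section PlaneZeros

variable {k : Type*} [Field k]

/-- Polynomials in two variables without common factor have finitely many common zeros. -/
theorem MvPolynomial.finite_zeros_of_forall_exists_not_dvd {I : Ideal (MvPolynomial (Fin 2) k)}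
    (hI : ∀ f, ¬ IsUnit f → ∃ g ∈ I, ¬ f ∣ g) :
    {P : Fin 2 → k | ∀ g ∈ I, MvPolynomial.aeval P g = 0}.Finite := by
  have hmem : ∀ P : Fin 2 → k, ∀ g : MvPolynomial (Fin 2) k,
      g ∈ MvPolynomial.vanishingIdeal k {P} ↔ MvPolynomial.aeval P g = 0 := fun P g =>
    MvPolynomial.mem_vanishingIdeal_singleton_iff P g
  refine Set.Finite.of_injOn (f := fun P => MvPolynomial.vanishingIdeal k {P})
    (t := I.minimalPrimes) ?_ ?_ (Ideal.finite_minimalPrimes_of_isNoetherianRing _ I)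
  · intro P hP
    have hm : (MvPolynomial.vanishingIdeal k {P} : Ideal (MvPolynomial (Fin 2) k)).IsMaximal :=
      inferInstance
    obtain ⟨Q, hQ, hQP⟩ := Ideal.exists_minimalPrimes_le
      (show I ≤ MvPolynomial.vanishingIdeal k {P} from fun g hg => (hmem P g).2 (hP g hg))
    have hQp : Q.IsPrime := hQ.isPrime
    rcases hQP.lt_or_eq with hlt | rfl
    · exfalso
      have hQ0 : Q ≠ ⊥ := by
        obtain ⟨g, hg, hg0⟩ := hI 0 not_isUnit_zero
        rintro rfl
        exact hg0 (zero_dvd_iff.2 (by simpa using hQ.1.2 hg))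
      obtain ⟨f, hfQ, hf⟩ := hQp.exists_mem_prime_of_ne_bot hQ0
      obtain ⟨g, hg, hfg⟩ := hI f hf.not_isUnit
      have hlt2 : Ideal.span {f} < Q := by
        refine lt_of_le_of_ne ((Ideal.span_singleton_le_iff_mem _).2 hfQ) ?_
        rintro rfl
        exact hfg (Ideal.mem_span_singleton.1 (hQ.1.2 hg))
      have hfp : (Ideal.span {f}).IsPrime := (Ideal.span_singleton_prime hf.ne_zero).2 hf
      have hlt3 : ⊥ < Ideal.span {f} := by
        rw [bot_lt_iff_ne_bot, Ne, Ideal.span_singleton_eq_bot]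
        exact hf.ne_zero
      let F : Fin 4 → PrimeSpectrum (MvPolynomial (Fin 2) k) :=
        ![⟨⊥, Ideal.isPrime_bot⟩, ⟨_, hfp⟩, ⟨Q, hQp⟩, ⟨_, hm.isPrime⟩]
      have hF : StrictMono F := by
        rw [Fin.strictMono_iff_lt_succ]
        intro i
        fin_cases i
        · exact hlt3
        · exact hlt2
        · exact hlt
      have h1 := Order.LTSeries.length_le_krullDim (LTSeries.mk 3 F hF)
      change _ ≤ ringKrullDim _ at h1
      rw [MvPolynomial.ringKrullDim_of_isNoetherianRing, ringKrullDim_eq_zero_of_field] at h1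
      have h2 : (3 : WithBot ℕ∞) ≤ (2 : ℕ) := by simpa using h1
      have h3 : 3 ≤ 2 := by exact_mod_cast h2
      lia
    · exact hQ
  · intro P _ P' _ h
    funext i
    have h1 : MvPolynomial.X i - MvPolynomial.C (P i) ∈ MvPolynomial.vanishingIdeal k {P'} := by
      change MvPolynomial.vanishingIdeal k {P} = MvPolynomial.vanishingIdeal k {P'} at h
      rw [← h, hmem]
      simp
    rw [hmem] at h1
    simpa [sub_eq_zero, eq_comm] using h1

end PlaneZeros

section Degree

variable {k K : Type*} [Field k] [Field K] [Algebra k K]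

theorem aeval_mem_linForms_pow (s t : K) {e : ℕ} {g : MvPolynomial (Fin 2) k}
    (hg : g.totalDegree ≤ e) : MvPolynomial.aeval ![s, t] g ∈ linForms k s t ^ e := by
  rw [MvPolynomial.aeval_def, MvPolynomial.eval₂_eq']
  refine sum_mem fun m hm => ?_
  rw [← Algebra.smul_def, Fin.prod_univ_two]
  refine Submodule.smul_mem _ _ (pow_mul_pow_mem_linForms s t (le_trans ?_ hg))
  have h := MvPolynomial.le_totalDegree hm
  rw [Finsupp.sum_fintype _ _ (by simp), Fin.sum_univ_two] at h
  exact h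

theorem MonIndep.mem_linForms_pow_iff {s t : K} (h : MonIndep k s t) {e : ℕ}
    {g : MvPolynomial (Fin 2) k} :
    MvPolynomial.aeval ![s, t] g ∈ linForms k s t ^ e ↔ g.totalDegree ≤ e := by
  refine ⟨fun hg => ?_, aeval_mem_linForms_pow s t⟩
  have h1 : ∀ z ∈ linForms k s t ^ e, ∃ f : MvPolynomial (Fin 2) k, f.totalDegree ≤ e ∧
      MvPolynomial.aeval ![s, t] f = z := by
    have h2 : linForms k s t ^ e ≤ (MvPolynomial.restrictTotalDegree (Fin 2) k e).map
        (MvPolynomial.aeval ![s, t]).toLinearMap := by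
      rw [linForms_pow_eq_span, Submodule.span_le]
      rintro _ ⟨⟨i, j⟩, hij, rfl⟩
      refine ⟨MvPolynomial.X 0 ^ i * MvPolynomial.X 1 ^ j, ?_, by simp⟩
      refine (MvPolynomial.mem_restrictTotalDegree _ _ _).2 ?_
      refine (MvPolynomial.totalDegree_mul _ _).trans ?_
      rw [MvPolynomial.totalDegree_X_pow, MvPolynomial.totalDegree_X_pow]
      exact hij
    intro z hz
    obtain ⟨f, hf, rfl⟩ := h2 hz
    exact ⟨f, (MvPolynomial.mem_restrictTotalDegree _ _ _).1 hf, rfl⟩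
  obtain ⟨f, hf, hfg⟩ := h1 _ hg
  rw [← ((monIndep_iff s t).1 h) hfg]
  exact hf

theorem mem_planeRing_iff_exists_aeval {s t z : K} :
    z ∈ planeRing k s t ↔ ∃ g : MvPolynomial (Fin 2) k, MvPolynomial.aeval ![s, t] g = z := by
  constructor
  · intro hz
    obtain ⟨N, hN⟩ := exists_mem_linForms_pow hz
    rw [linForms_pow_eq_span] at hN
    have h2 : Submodule.span k ((fun i : ℕ × ℕ => s ^ i.1 * t ^ i.2) '' {i | i.1 + i.2 ≤ N}) ≤
        LinearMap.range (MvPolynomial.aeval (R := k) ![s, t]).toLinearMap := by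
      rw [Submodule.span_le]
      rintro _ ⟨⟨i, j⟩, -, rfl⟩
      exact ⟨MvPolynomial.X 0 ^ i * MvPolynomial.X 1 ^ j, by simp⟩
    exact h2 hN
  · rintro ⟨g, rfl⟩
    exact linForms_pow_le_planeRing s t _ (aeval_mem_linForms_pow s t le_rfl)

end Degree

section ChartZeros

variable {k K : Type*} [Field k] [Field K] [Algebra k K]

theorem linForms_eq_scale {x : K} (hx : x ≠ 0) (y : K) :
    linForms k x y = scale x (linForms k x⁻¹ (y / x)) := by
  rw [scale, linForms, Submodule.map_span]
  congr 1
  simp only [Set.image_insert_eq, Set.image_singleton, LinearMap.mulLeft_apply, mul_one,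
    mul_inv_cancel₀ hx, mul_div_cancel₀ _ hx]
  exact Set.insert_comm _ _ _

theorem exists_finset_chart_zeros {x y : K} (h : MonIndep k x y) {W : Submodule k K} (hW0 : W ≠ ⊥)
    {e : ℕ} (hW : W ≤ linForms k x y ^ e)
    (hmin : ∀ c : K, c ≠ 0 → ∀ e', scale c W ≤ linForms k x y ^ e' → e ≤ e') :
    ∃ F : Finset (Fin 2 → k), ∀ ε : Algebra.adjoin k {x⁻¹, y / x} →ₐ[k] k,
      (∀ r : Algebra.adjoin k {x⁻¹, y / x}, (r : K) ∈ scale (x ^ e)⁻¹ W → ε r = 0) →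
      ![ε ⟨x⁻¹, left_mem_adjoin_pair _ _⟩, ε ⟨y / x, right_mem_adjoin_pair _ _⟩] ∈ F := by
  have hx := h.ne_zero_left
  have hst := h.inv_div
  have hinj : Function.Injective (MvPolynomial.aeval (R := k) ![x⁻¹, y / x]) :=
    (monIndep_iff _ _).1 hst
  have hlin : ∀ n, linForms k x y ^ n = scale (x ^ n) (linForms k x⁻¹ (y / x) ^ n) := fun n => by
    rw [linForms_eq_scale hx, scale_pow]
  have hrep : ∀ w ∈ W, ∃ g : MvPolynomial (Fin 2) k, g.totalDegree ≤ e ∧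
      x ^ e * MvPolynomial.aeval ![x⁻¹, y / x] g = w := fun w hw => by
    have h1 := hW hw
    rw [hlin] at h1
    obtain ⟨u, hu, rfl⟩ := h1
    obtain ⟨g, rfl⟩ := mem_planeRing_iff_exists_aeval.1 (linForms_pow_le_planeRing _ _ _ hu)
    exact ⟨g, hst.mem_linForms_pow_iff.1 hu, rfl⟩
  let I : Ideal (MvPolynomial (Fin 2) k) := Ideal.span
    {g | MvPolynomial.aeval ![x⁻¹, y / x] g ∈ scale (x ^ e)⁻¹ W}
  have hmemI : ∀ w ∈ W, ∀ g : MvPolynomial (Fin 2) k,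
      x ^ e * MvPolynomial.aeval ![x⁻¹, y / x] g = w → g ∈ I := fun w hw g hg => by
    refine Ideal.subset_span (mem_scale.2 ⟨w, hw, ?_⟩)
    rw [← hg, inv_mul_cancel_left₀ (pow_ne_zero _ hx)]
  have hfin : {P : Fin 2 → k | ∀ g ∈ I, MvPolynomial.aeval P g = 0}.Finite := by
    refine MvPolynomial.finite_zeros_of_forall_exists_not_dvd fun f hf => ?_
    by_contra! hcon
    obtain ⟨w0, hw0, hw00⟩ := Submodule.exists_mem_ne_zero_of_ne_bot hW0
    obtain ⟨g0, hg0, hgw0⟩ := hrep w0 hw0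
    have hg00 : g0 ≠ 0 := by
      rintro rfl
      exact hw00 (by rw [← hgw0, map_zero, mul_zero])
    have hfg0 := hcon g0 (hmemI w0 hw0 g0 hgw0)
    have hf0 : f ≠ 0 := by
      rintro rfl
      exact hg00 (zero_dvd_iff.1 hfg0)
    have hd : f.totalDegree ≠ 0 := fun hd => by
      rw [MvPolynomial.totalDegree_eq_zero_iff_eq_C] at hd
      refine hf ?_
      rw [hd]
      refine (IsUnit.mk0 _ fun h0 => hf0 ?_).map MvPolynomial.C
      rw [hd, h0, map_zero]
    have hde : f.totalDegree ≤ e :=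
      (MvPolynomial.totalDegree_le_of_dvd_of_isDomain hfg0 hg00).trans hg0
    have hfK : MvPolynomial.aeval ![x⁻¹, y / x] f ≠ 0 := fun h0 => hf0 (hinj (by rw [h0, map_zero]))
    have hle := hmin ((MvPolynomial.aeval ![x⁻¹, y / x] f)⁻¹ * (x ^ (e - f.totalDegree) * (x ^ e)⁻¹))
      (mul_ne_zero (inv_ne_zero hfK)
        (mul_ne_zero (pow_ne_zero _ hx) (inv_ne_zero (pow_ne_zero _ hx))))
      (e - f.totalDegree) ?_
    · lia
    rintro _ ⟨w, hw, rfl⟩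
    obtain ⟨g, hg, hgw⟩ := hrep w hw
    obtain ⟨q, rfl⟩ := hcon g (hmemI w hw g hgw)
    rw [hlin]
    refine mem_scale.2 ⟨MvPolynomial.aeval ![x⁻¹, y / x] q, ?_, ?_⟩
    · rcases eq_or_ne q 0 with rfl | hq
      · rw [map_zero]
        exact zero_mem _
      · rw [MvPolynomial.totalDegree_mul_of_isDomain hf0 hq] at hg
        exact aeval_mem_linForms_pow _ _ (by lia)
    · have hxe : x ^ e ≠ 0 := pow_ne_zero _ hx
      rw [LinearMap.mulLeft_apply, ← hgw, map_mul]
      generalize MvPolynomial.aeval (R := k) ![x⁻¹, y / x] f = a at hfK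
      field_simp
  refine ⟨hfin.toFinset, fun ε hε => ?_⟩
  rw [Set.Finite.mem_toFinset]
  let s' : Algebra.adjoin k {x⁻¹, y / x} := ⟨x⁻¹, left_mem_adjoin_pair _ _⟩
  let t' : Algebra.adjoin k {x⁻¹, y / x} := ⟨y / x, right_mem_adjoin_pair _ _⟩
  have h1 : MvPolynomial.aeval ![ε s', ε t'] = ε.comp (MvPolynomial.aeval ![s', t']) := by
    ext i
    fin_cases i <;> simp
  have h2 : MvPolynomial.aeval (R := k) ![x⁻¹, y / x] =
      (Algebra.adjoin k {x⁻¹, y / x}).val.comp (MvPolynomial.aeval ![s', t']) := by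
    ext i
    fin_cases i <;> simp [s', t']
  have h3 : I ≤ RingHom.ker (MvPolynomial.aeval (R := k) ![ε s', ε t']) := by
    refine Ideal.span_le.2 fun g hg => ?_
    change MvPolynomial.aeval ![ε s', ε t'] g = 0
    rw [h1]
    refine hε _ ?_
    have h4 : MvPolynomial.aeval ![x⁻¹, y / x] g ∈ scale (x ^ e)⁻¹ W := hg
    rw [h2] at h4
    exact h4
  exact fun g hg => h3 hg

end ChartZeros

section LineAtInfinity

variable {k K : Type*} [Field k] [Field K] [Algebra k K]

open Polynomial in
theorem exists_forall_quadratic_ne_zero [Infinite k] (F F' : Finset (Fin 2 → k)) :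
    ∃ a : k, (∀ P ∈ F, P 0 + a + a ^ 2 * P 1 ≠ 0) ∧ ∀ P ∈ F', P 0 + a ^ 2 + a * P 1 ≠ 0 := by
  let f : k[X] := (∏ P ∈ F, (C (P 0) + X + X ^ 2 * C (P 1))) *
    ∏ P ∈ F', (C (P 0) + X ^ 2 + X * C (P 1))
  have hf : f ≠ 0 := by
    refine mul_ne_zero (Finset.prod_ne_zero_iff.2 fun P _ h => ?_)
      (Finset.prod_ne_zero_iff.2 fun P _ h => ?_)
    · have := congrArg (fun q => Polynomial.coeff q 1) h
      simp [Polynomial.coeff_X_pow] at this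
    · have := congrArg (fun q => Polynomial.coeff q 2) h
      simp at this
  obtain ⟨a, ha⟩ : ∃ a, f.eval a ≠ 0 := by
    by_contra! h
    exact hf (Polynomial.funext fun a => by rw [h, Polynomial.eval_zero])
  refine ⟨a, ?_⟩
  simp only [mul_comm a, mul_comm (a ^ 2)]
  simpa [f, Polynomial.eval_prod, Finset.prod_eq_zero_iff] using ha

theorem one_add_smul_add_smul_ne_zero {x y : K} (h : MonIndep k x y) (b c : k) :
    1 + b • x + c • y ≠ 0 := by
  intro h0
  have h1 : (1 + MvPolynomial.C b * MvPolynomial.X 0 + MvPolynomial.C c * MvPolynomial.X 1 :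
      MvPolynomial (Fin 2) k) = 0 := by
    have hinj : Function.Injective (MvPolynomial.aeval (R := k) ![x, y]) := (monIndep_iff _ _).1 h
    refine hinj ?_
    simpa [Algebra.smul_def] using h0
  simpa using congrArg MvPolynomial.constantCoeff h1

theorem inv_div_of_eq {x y l : K} (hx : x ≠ 0) {b c : k} (hlxy : l = 1 + b • x + c • y) :
    (x / l)⁻¹ = x⁻¹ + algebraMap k K b + c • (y / x) := by
  rw [inv_div, hlxy]
  simp only [Algebra.smul_def]
  field_simp

theorem adjoin_inv_div_eq {x y l : K} (hx : x ≠ 0) (hl : l ≠ 0) {b c : k}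
    (hlxy : l = 1 + b • x + c • y) :
    Algebra.adjoin k {(x / l)⁻¹, y / l / (x / l)} = Algebra.adjoin k {x⁻¹, y / x} := by
  have h1 := inv_div_of_eq hx hlxy
  rw [div_div_div_cancel_right₀ hl]
  refine le_antisymm (adjoin_pair_le ?_ (right_mem_adjoin_pair _ _))
    (adjoin_pair_le ?_ (right_mem_adjoin_pair _ _))
  · rw [h1]
    exact add_mem (add_mem (left_mem_adjoin_pair _ _) (Subalgebra.algebraMap_mem _ _))
      (Subalgebra.smul_mem _ (right_mem_adjoin_pair _ _) _)
  · have h2 : x⁻¹ = (x / l)⁻¹ - algebraMap k K b - c • (y / x) := by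
      rw [h1]
      ring
    rw [h2]
    exact sub_mem (sub_mem (left_mem_adjoin_pair _ _) (Subalgebra.algebraMap_mem _ _))
      (Subalgebra.smul_mem _ (right_mem_adjoin_pair _ _) _)

theorem MonIndep.div_div {x y l : K} (h : MonIndep k x y) {b c : k}
    (hlxy : l = 1 + b • x + c • y) : MonIndep k (x / l) (y / l) := by
  have hl : l ≠ 0 := hlxy ▸ one_add_smul_add_smul_ne_zero h b c
  have hx := h.ne_zero_left
  have := (h.inv_div.of_adjoin_eq (adjoin_inv_div_eq hx hl hlxy)).inv_div
  rwa [inv_inv, div_inv_eq_mul, div_mul_cancel₀ _ (div_ne_zero hx hl)] at this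

theorem linForms_div_div {x y l : K} (hl : l ≠ 0) {b c : k}
    (hlxy : l = 1 + b • x + c • y) :
    linForms k x y = scale l (linForms k (x / l) (y / l)) := by
  have h1 : l ∈ linForms k x y := by
    rw [hlxy]
    refine add_mem (add_mem (Submodule.subset_span (by simp)) (Submodule.smul_mem _ _ ?_))
      (Submodule.smul_mem _ _ ?_)
    all_goals exact Submodule.subset_span (by simp)
  apply le_antisymm
  · refine Submodule.span_le.2 ?_
    rintro z (rfl | rfl | rfl)
    · refine mem_scale.2 ⟨l⁻¹, ?_, mul_inv_cancel₀ hl⟩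
      have : l⁻¹ = 1 - b • (x / l) - c • (y / l) := by
        rw [Algebra.smul_def, Algebra.smul_def]
        field_simp
        rw [hlxy, Algebra.smul_def, Algebra.smul_def]
        ring
      rw [this]
      refine sub_mem (sub_mem (Submodule.subset_span (by simp)) (Submodule.smul_mem _ _ ?_))
        (Submodule.smul_mem _ _ ?_)
      all_goals exact Submodule.subset_span (by simp)
    · exact mem_scale.2 ⟨z / l, Submodule.subset_span (by simp), mul_div_cancel₀ _ hl⟩
    · exact mem_scale.2 ⟨z / l, Submodule.subset_span (by simp), mul_div_cancel₀ _ hl⟩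
  · rw [scale, Submodule.map_le_iff_le_comap]
    refine Submodule.span_le.2 ?_
    rintro z (rfl | rfl | rfl)
    · simpa using h1
    · simpa [mul_div_cancel₀ _ hl] using
        (Submodule.subset_span (by simp) : x ∈ Submodule.span k {1, x, y})
    · simpa [mul_div_cancel₀ _ hl] using
        (Submodule.subset_span (by simp) : y ∈ Submodule.span k {1, x, y})

theorem isFractionRing_adjoin_div_div {x y l : K} [IsFractionRing (Algebra.adjoin k {x, y}) K]
    (hl : l ≠ 0) {b c : k} (hlxy : l = 1 + b • x + c • y) :
    IsFractionRing (Algebra.adjoin k {x / l, y / l}) K := by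
  have hlin : l⁻¹ = 1 - b • (x / l) - c • (y / l) := by
    rw [Algebra.smul_def, Algebra.smul_def]
    field_simp
    rw [hlxy, Algebra.smul_def, Algebra.smul_def]
    ring
  let E := IntermediateField.adjoin k {x / l, y / l}
  have hx : x / l ∈ E := IntermediateField.subset_adjoin _ _ (by simp)
  have hy : y / l ∈ E := IntermediateField.subset_adjoin _ _ (by simp)
  have hlE : l ∈ E := by
    rw [← inv_inv l, hlin]
    exact inv_mem (sub_mem (sub_mem (one_mem _) (E.smul_mem hx)) (E.smul_mem hy))
  have hle : Algebra.adjoin k {x, y} ≤ E.toSubalgebra := by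
    refine adjoin_pair_le ?_ ?_
    · have := mul_mem hx hlE
      rwa [div_mul_cancel₀ _ hl] at this
    · have := mul_mem hy hlE
      rwa [div_mul_cancel₀ _ hl] at this
  refine .of_field _ _ fun z => ?_
  have hz : z ∈ E := by
    obtain ⟨u, v, -, rfl⟩ := IsFractionRing.div_surjective (Algebra.adjoin k {x, y}) z
    exact div_mem (hle u.2) (hle v.2)
  obtain ⟨u, hu, v, hv, rfl⟩ := IntermediateField.mem_adjoin_iff_div.1 hz
  exact ⟨⟨u, hu⟩, ⟨v, hv⟩, rfl⟩

theorem topFree_div_div [IsAlgClosed k] {x y l : K} (hx : x ≠ 0) (hl : l ≠ 0) {b c : k}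
    (hlxy : l = 1 + b • x + c • y) {e : ℕ} {W : Submodule k K} {F : Finset (Fin 2 → k)}
    (hF : ∀ ε : Algebra.adjoin k {x⁻¹, y / x} →ₐ[k] k,
      (∀ r : Algebra.adjoin k {x⁻¹, y / x}, (r : K) ∈ scale (x ^ e)⁻¹ W → ε r = 0) →
      ![ε ⟨x⁻¹, left_mem_adjoin_pair _ _⟩, ε ⟨y / x, right_mem_adjoin_pair _ _⟩] ∈ F)
    (hbc : ∀ P ∈ F, P 0 + b + c * P 1 ≠ 0) :
    TopFree (x / l) (y / l) e (scale (l ^ e)⁻¹ W) := by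
  have h1 := inv_div_of_eq hx hlxy
  have h2 : scale ((x / l) ^ e)⁻¹ (scale (l ^ e)⁻¹ W) = scale (x ^ e)⁻¹ W := by
    ext z
    simp only [mem_scale]
    constructor
    · rintro ⟨_, ⟨w, hw, rfl⟩, rfl⟩
      refine ⟨w, hw, ?_⟩
      rw [div_pow]
      field_simp
    · rintro ⟨w, hw, rfl⟩
      refine ⟨_, ⟨w, hw, rfl⟩, ?_⟩
      rw [div_pow]
      field_simp
  rw [TopFree, h2, planeRing, adjoin_inv_div_eq hx hl hlxy]
  by_contra hcon
  have hmul : ∀ r ∈ Algebra.adjoin k {x⁻¹, y / x}, ∀ g ∈ scale (x / l)⁻¹ (planeRing k x⁻¹ (y / x)) ⊔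
      planeRing k x⁻¹ (y / x) * scale (x ^ e)⁻¹ W,
      r * g ∈ scale (x / l)⁻¹ (planeRing k x⁻¹ (y / x)) ⊔
        planeRing k x⁻¹ (y / x) * scale (x ^ e)⁻¹ W := by
    intro r hr g hg
    obtain ⟨u, hu, v, hv, rfl⟩ := Submodule.mem_sup.1 hg
    rw [mul_add]
    refine Submodule.add_mem_sup ?_ ?_
    · obtain ⟨u, hu', rfl⟩ := mem_scale.1 hu
      exact mem_scale.2 ⟨r * u, Subalgebra.mul_mem _ hr hu', by ring⟩
    · have : planeRing k x⁻¹ (y / x) * planeRing k x⁻¹ (y / x) = planeRing k x⁻¹ (y / x) :=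
        Subalgebra.isIdempotentElem_toSubmodule _
      rw [← this, mul_assoc]
      exact Submodule.mul_mem_mul hr hv
  obtain ⟨ε, hε⟩ := exists_algHom_of_submodule hmul hcon
  have hP := hF ε fun r hr => hε r (Submodule.mem_sup_right (by
    have := Submodule.mul_mem_mul (show (1 : K) ∈ planeRing k x⁻¹ (y / x) from
      (Algebra.adjoin k {x⁻¹, y / x}).one_mem) hr
    rwa [one_mul] at this))
  refine hbc _ hP ?_
  have h3 := hε (⟨x⁻¹, left_mem_adjoin_pair _ _⟩ + algebraMap k _ b +
    c • ⟨y / x, right_mem_adjoin_pair _ _⟩) (Submodule.mem_sup_left (mem_scale.2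
      ⟨1, (Algebra.adjoin k {x⁻¹, y / x}).one_mem, by rw [mul_one, h1]; rfl⟩))
  rw [map_add, map_add, map_smul, AlgHom.commutes] at h3
  exact h3

end LineAtInfinity

section PlaneModel

variable {k K : Type*} [Field k] [Field K] [Algebra k K]

theorem scale_scale (c d : K) (W : Submodule k K) : scale c (scale d W) = scale (c * d) W := by
  simp only [scale_eq_span_mul, ← mul_assoc, Submodule.span_mul_span, Set.singleton_mul_singleton]

theorem scale_mul_scale (c d : K) (V W : Submodule k K) :
    scale c V * scale d W = scale (c * d) (V * W) := by
  rw [scale_eq_span_mul, scale_eq_span_mul, mul_mul_mul_comm, Submodule.span_mul_span,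
    Set.singleton_mul_singleton, ← scale_eq_span_mul]

theorem scale_one (W : Submodule k K) : scale 1 W = W := by
  rw [scale_eq_span_mul, ← Submodule.one_eq_span, one_mul]

theorem intClosure_scale (S : Subalgebra k K) {c : K} (hc : c ≠ 0) (W : Submodule k K) :
    intClosure S (scale c W) = scale c (intClosure S W) := by
  ext b
  rw [mem_scale]
  constructor
  · intro hb
    refine ⟨c⁻¹ * b, fun v hv => ?_, mul_inv_cancel_left₀ hc b⟩
    obtain ⟨_, ⟨w, hw, rfl⟩, d, hd, rfl⟩ := hb v hv
    refine ⟨w, hw, d, hd, ?_⟩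
    rw [LinearMap.mulLeft_apply, mul_left_comm, inv_mul_cancel_left₀ hc]
  · rintro ⟨b, hb, rfl⟩ v hv
    obtain ⟨w, hw, d, hd, rfl⟩ := hb v hv
    exact ⟨c * w, ⟨w, hw, rfl⟩, d, hd, by ring⟩

theorem exists_scale_le_linForms_pow {x y : K} [IsFractionRing (Algebra.adjoin k {x, y}) K]
    (W : Submodule k K) [FiniteDimensional k W] :
    ∃ e, ∃ c : K, c ≠ 0 ∧ scale c W ≤ linForms k x y ^ e := by
  obtain ⟨s, rfl⟩ := Module.Finite.iff_fg.1 ‹FiniteDimensional k W›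
  obtain ⟨d, hd⟩ := IsLocalization.exist_integer_multiples_of_finset
    (nonZeroDivisors (Algebra.adjoin k {x, y})) s
  have hmem : ∀ a ∈ s, ∃ N, ((d : Algebra.adjoin k {x, y}) : K) * a ∈ linForms k x y ^ N := by
    intro a ha
    obtain ⟨r, hr⟩ := hd a ha
    obtain ⟨N, hN⟩ := exists_mem_linForms_pow r.2
    refine ⟨N, ?_⟩
    have : ((d : Algebra.adjoin k {x, y}) : K) * a = r := hr.symm
    rwa [this]
  choose! N hN using hmem
  refine ⟨s.sup N, ((d : Algebra.adjoin k {x, y}) : K), ?_, ?_⟩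
  · have := nonZeroDivisors.ne_zero d.2
    exact fun h0 => this (Subtype.ext h0)
  · rw [scale, Submodule.map_span, Submodule.span_le]
    rintro _ ⟨a, ha, rfl⟩
    exact linForms_pow_mono x y (Finset.le_sup ha) (hN a ha)

/-- After a projective change of coordinates, every finite-dimensional linear system on the plane
has no fixed curve and no base point on the line at infinity. -/
theorem exists_topFree_model [IsAlgClosed k] {x y : K} (h : MonIndep k x y)
    [IsFractionRing (Algebra.adjoin k {x, y}) K] (W : Submodule k K) [FiniteDimensional k W]
    (hW : W ≠ ⊥) : ∃ (x' y' q : K) (e : ℕ) (W' : Submodule k K), q ≠ 0 ∧ MonIndep k x' y' ∧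
      IsFractionRing (Algebra.adjoin k {x', y'}) K ∧ W' ≤ linForms k x' y' ^ e ∧
      TopFree x' y' e W' ∧ TopFree y' x' e W' ∧
      linForms k x y * W = scale q (linForms k x' y' * W') := by
  classical
  have hex := exists_scale_le_linForms_pow (x := x) (y := y) W
  obtain ⟨e, ⟨d, hd, hdW⟩, hmin⟩ : ∃ e, (∃ d : K, d ≠ 0 ∧ scale d W ≤ linForms k x y ^ e) ∧
      ∀ e', (∃ c : K, c ≠ 0 ∧ scale c W ≤ linForms k x y ^ e') → e ≤ e' :=
    ⟨Nat.find hex, Nat.find_spec hex, fun _ => Nat.find_min' hex⟩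
  replace hmin : ∀ c : K, c ≠ 0 → ∀ e', scale c (scale d W) ≤ linForms k x y ^ e' → e ≤ e' :=
    fun c hc e' he' => hmin e' ⟨c * d, mul_ne_zero hc hd, by rwa [scale_scale] at he'⟩
  have hdW0 : scale d W ≠ ⊥ := fun h0 => hW (by
    rw [← scale_one W, ← inv_mul_cancel₀ hd, ← scale_scale, h0]
    exact Submodule.map_bot _)
  obtain ⟨F, hF⟩ := exists_finset_chart_zeros h hdW0 hdW hmin
  obtain ⟨F', hF'⟩ := exists_finset_chart_zeros h.swap hdW0 (by rwa [linForms_comm])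
    (fun c hc e' he' => hmin c hc e' (by rwa [linForms_comm] at he'))
  have hinf : Infinite k := inferInstance
  obtain ⟨a, haF, haF'⟩ := exists_forall_quadratic_ne_zero F F'
  obtain ⟨l, hl⟩ : ∃ l, l = 1 + a • x + a ^ 2 • y := ⟨_, rfl⟩
  have hl0 : l ≠ 0 := hl ▸ one_add_smul_add_smul_ne_zero h _ _
  have hle0 : l ^ e ≠ 0 := pow_ne_zero _ hl0
  refine ⟨x / l, y / l, l * (d⁻¹ * l ^ e), e, scale (l ^ e)⁻¹ (scale d W),
    mul_ne_zero hl0 (mul_ne_zero (inv_ne_zero hd) hle0), h.div_div hl,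
    isFractionRing_adjoin_div_div hl0 hl, ?_, topFree_div_div h.ne_zero_left hl0 hl hF haF,
    topFree_div_div h.ne_zero_right hl0 (hl.trans (add_right_comm _ _ _)) hF' haF', ?_⟩
  · refine (Submodule.map_mono hdW).trans ?_
    rw [linForms_div_div hl0 hl, scale_pow]
    refine ((scale_scale _ _ _).trans ?_).le
    rw [inv_mul_cancel₀ hle0, scale_one]
  · rw [← scale_mul_scale, ← linForms_div_div hl0 hl, scale_scale, scale_scale]
    have : d⁻¹ * l ^ e * ((l ^ e)⁻¹ * d) = 1 := by field_simp
    rw [mul_assoc (d⁻¹ * l ^ e), this, scale_one]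

theorem intClosure_linForms_mul_pow_eq {x y x' y' q : K} {W W' : Submodule k K} (hq : q ≠ 0)
    (h : linForms k x y * W = scale q (linForms k x' y' * W')) (n : ℕ) :
    intClosure ⊥ ((linForms k x y * W) ^ n) =
      scale (q ^ n) (intClosure ⊥ ((linForms k x' y' * W') ^ n)) := by
  rw [h, scale_pow, intClosure_scale _ (pow_ne_zero _ hq)]

theorem finiteDimensional_intClosure_bot [IsAlgClosed k] {x y : K} (h : MonIndep k x y)
    [IsFractionRing (Algebra.adjoin k {x, y}) K] (W : Submodule k K) [FiniteDimensional k W] :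
    FiniteDimensional k (intClosure ⊥ W) := by
  have hinf : Infinite k := inferInstance
  obtain ⟨x', y', q, e, W', hq, h', hfr, hW', h1, h2, heq⟩ :=
    exists_topFree_model h (W ⊔ Submodule.span k {1}) fun h0 => by
      have : (1 : K) ∈ W ⊔ Submodule.span k {1} :=
        Submodule.mem_sup_right (Submodule.mem_span_singleton_self 1)
      rw [h0, Submodule.mem_bot] at this
      exact one_ne_zero this
  have hfd := finiteDimensional_linForms_pow (k := k) x' y' (1 * (e + 1))
  have hle := intClosure_bot_pow_le h' hW' h1 h2 1
  have hle2 : intClosure ⊥ W ≤ scale (q ^ 1) (linForms k x' y' ^ (1 * (e + 1))) := by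
    refine (intClosure_mono le_rfl ?_).trans
      ((intClosure_linForms_mul_pow_eq hq heq 1).le.trans (Submodule.map_mono hle))
    rw [pow_one]
    intro w hw
    simpa using Submodule.mul_mem_mul (one_mem_linForms x y) (Submodule.mem_sup_left hw)
  exact Submodule.finiteDimensional_of_le hle2

theorem exists_not_dvd_finrank_intClosure_of_finiteDimensional [IsAlgClosed k] {x y : K}
    (h : MonIndep k x y) [IsFractionRing (Algebra.adjoin k {x, y}) K] (W : Submodule k K)
    [FiniteDimensional k W] (hW : W ≠ ⊥) {p : ℕ} (hp : p.Prime) (hp5 : 5 ≤ p) :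
    ∃ n0, ∀ n, n0 ≤ n → p ∣ n →
      ¬ p ∣ Module.finrank k (intClosure ⊥ ((linForms k x y * W) ^ n)) := by
  obtain ⟨x', y', q, e, W', hq, h', hfr, hW', h1, h2, heq⟩ := exists_topFree_model h W hW
  obtain ⟨n0, hn0⟩ := exists_not_dvd_finrank_intClosure h' hW' h1 h2 hp hp5
  refine ⟨n0, fun n hn hpn => ?_⟩
  rw [intClosure_linForms_mul_pow_eq hq heq n, ← (Submodule.equivMapOfInjective
    (LinearMap.mulLeft k (q ^ n)) (mul_right_injective₀ (pow_ne_zero _ hq)) _).finrank_eq]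
  exact hn0 n hn hpn


theorem adjoin_linForms_eq_top (x y : K) [IsFractionRing (Algebra.adjoin k {x, y}) K] :
    IntermediateField.adjoin k (linForms k x y : Set K) = ⊤ := by
  refine top_unique fun z _ => ?_
  have hle : Algebra.adjoin k {x, y} ≤
      (IntermediateField.adjoin k (linForms k x y : Set K)).toSubalgebra :=
    adjoin_pair_le (IntermediateField.subset_adjoin _ _ (Submodule.subset_span (by simp)))
      (IntermediateField.subset_adjoin _ _ (Submodule.subset_span (by simp)))
  obtain ⟨u, v, -, rfl⟩ := IsFractionRing.div_surjective (Algebra.adjoin k {x, y}) z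
  exact div_mem (hle u.2) (hle v.2)

theorem trdeg_le_two_of_isFractionRing (x y : K) [IsFractionRing (Algebra.adjoin k {x, y}) K] :
    Algebra.trdeg k K ≤ 2 := by
  have : Algebra.IsAlgebraic (Algebra.adjoin k {x, y}) K :=
    IsLocalization.isAlgebraic _ (nonZeroDivisors (Algebra.adjoin k {x, y}))
  refine (Algebra.IsAlgebraic.trdeg_le_cardinalMk k {x, y}).trans ?_
  refine (Cardinal.mk_insert_le).trans ?_
  rw [Cardinal.mk_singleton, one_add_one_eq_two]

/-- An elementary abelian `p`-group acting faithfully on a rational function field in two variables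
has rank at most two. -/
theorem le_two_of_injective_of_monIndep [IsAlgClosed k] {x y : K} (h : MonIndep k x y)
    [IsFractionRing (Algebra.adjoin k {x, y}) K] {p : ℕ} (hp : p.Prime) (hp5 : 5 ≤ p)
    (hpk : (p : k) ≠ 0) {r : ℕ} (ρ : Multiplicative (Fin r → ZMod p) →* (K ≃ₐ[k] K))
    (hρ : Function.Injective ρ) : r ≤ 2 := by
  by_contra! hr
  have hpf : Fact p.Prime := ⟨hp⟩
  have hne : NeZero (p : k) := ⟨hpk⟩
  obtain ⟨ζ, hζ⟩ := HasEnoughRootsOfUnity.exists_primitiveRoot k p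
  have hfd : FiniteDimensional k (linForms k x y) :=
    Module.Finite.iff_fg.2 (Submodule.fg_span (by simp))
  obtain ⟨W, hW, hW0, N, hN⟩ := exists_dvd_finrank_intClosure ρ hζ hp5 hr hρ
    (trdeg_le_two_of_isFractionRing x y) (linForms k x y) (one_mem_linForms x y)
    (adjoin_linForms_eq_top x y) (fun W _ => finiteDimensional_intClosure_bot h W)
  obtain ⟨M, hM⟩ := exists_not_dvd_finrank_intClosure_of_finiteDimensional h W hW0 hp hp5
  have hle : N + M ≤ p * (N + M) := Nat.le_mul_of_pos_left _ hp.pos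
  exact hM (p * (N + M)) (by lia) (dvd_mul_right _ _) (hN _ (by lia))

end PlaneModel

section Cremona

variable (k : Type*) [Field k]

theorem adjoin_algebraMap_X_pair :
    Algebra.adjoin k {algebraMap (MvPolynomial (Fin 2) k) (Kxy k) (MvPolynomial.X 0),
      algebraMap (MvPolynomial (Fin 2) k) (Kxy k) (MvPolynomial.X 1)} =
    (IsScalarTower.toAlgHom k (MvPolynomial (Fin 2) k) (Kxy k)).range := by
  rw [← Algebra.map_top, ← MvPolynomial.adjoin_range_X, AlgHom.map_adjoin, ← Set.range_comp]
  congr 1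
  ext z
  simp [eq_comm]

theorem monIndep_algebraMap_X :
    MonIndep k (algebraMap (MvPolynomial (Fin 2) k) (Kxy k) (MvPolynomial.X 0))
      (algebraMap (MvPolynomial (Fin 2) k) (Kxy k) (MvPolynomial.X 1)) := by
  rw [monIndep_iff]
  have heq : ![algebraMap (MvPolynomial (Fin 2) k) (Kxy k) (MvPolynomial.X 0),
      algebraMap (MvPolynomial (Fin 2) k) (Kxy k) (MvPolynomial.X 1)] =
      IsScalarTower.toAlgHom k (MvPolynomial (Fin 2) k) (Kxy k) ∘ MvPolynomial.X := by
    funext i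
    fin_cases i <;> rfl
  rw [heq]
  exact (MvPolynomial.algebraicIndependent_X (Fin 2) k).map'
    (f := IsScalarTower.toAlgHom k (MvPolynomial (Fin 2) k) (Kxy k))
    (IsFractionRing.injective (MvPolynomial (Fin 2) k) (Kxy k))

theorem isFractionRing_adjoin_algebraMap_X :
    IsFractionRing (Algebra.adjoin k
      {algebraMap (MvPolynomial (Fin 2) k) (Kxy k) (MvPolynomial.X 0),
        algebraMap (MvPolynomial (Fin 2) k) (Kxy k) (MvPolynomial.X 1)}) (Kxy k) := by
  rw [adjoin_algebraMap_X_pair]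
  refine .of_field _ _ fun z => ?_
  obtain ⟨u, v, -, rfl⟩ := IsFractionRing.div_surjective (MvPolynomial (Fin 2) k) z
  exact ⟨⟨_, u, rfl⟩, ⟨_, v, rfl⟩, rfl⟩

end Cremona

/-- if `k` is algebraically closed, `p ≥ 5` a prime different from `char k`,
and `G ≤ Cr_k = Aut_k(k(x,y))` is isomorphic to `(ℤ/p)^r`, then `r ≤ 2`. -/
theorem p_elementary_rank_le_two
    (k : Type*) [Field k] [IsAlgClosed k]
    (p : ℕ) (hp : p.Prime) (hp5 : 5 ≤ p) (hchar : ringChar k ≠ p)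
    (r : ℕ) (G : Subgroup (Kxy k ≃ₐ[k] Kxy k))
    (hG : Nonempty (G ≃* Multiplicative (Fin r → ZMod p))) :
    r ≤ 2 := by
  obtain ⟨φ⟩ := hG
  have hfr := isFractionRing_adjoin_algebraMap_X k
  refine le_two_of_injective_of_monIndep (monIndep_algebraMap_X k) hp hp5 (fun h0 => hchar ?_)
    (G.subtype.comp φ.symm.toMonoidHom)
    (G.subtype_injective.comp φ.symm.injective)
  have hdvd := (ringChar.spec k p).1 h0
  rcases (Nat.dvd_prime hp).1 hdvd with h1 | h1
  · have := CharP.ringChar_ne_one (R := k)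
    exact absurd h1 this
  · exact h1
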